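/- arXiv:1603.04187 — 2 statements merged into one kernel-verified Lean document; each statement's English description precedes it below -/
import Mathlib

section
/- Let s ≥ 1 and for each i ∈ {1,…,s} let e_i = (e_{i,1},…,e_{i,u_i}) and f_i = (f_{i,1},…,f_{i,v_i}) be disjoint tuples of positive integers such that: (i) v_i − u_i ≥ 2 for all i; (ii) the rational numbers C_{e_i,f_i} := (Π_k e_{i,k}^{e_{i,k}})/(Π_k f_{i,k}^{f_{i,k}}) are pairwise distinct; (iii) for each i, the factorial ratio sequence Q_{e_i,f_i}(n) := Π_k (e_{i,k} n)! / Π_k (f_{i,k} n)! is integer-valued and satisfies the p-Lucas property for all primes p. Then the generating series F_{e_1,f_1}(z), …, F_{e_s,f_s}(z), where F_{e,f}(z) = Σ_{n≥0} Q_{e,f}(n) z^n, are algebraically independent over ℂ(z). -/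
section PartA
open Polynomial

/-- In a power series ring over `𝔽_p`, elements with equal `(p-1)`-th powers are proportional. -/
lemma fr_root (p : ℕ) [Fact p.Prime] (x y : PowerSeries (ZMod p)) (hy : y ≠ 0)
    (h : x ^ (p - 1) = y ^ (p - 1)) : ∃ t : ZMod p, x = PowerSeries.C t * y := by
  let F := FractionRing (PowerSeries (ZMod p))
  have inj : Function.Injective (algebraMap (PowerSeries (ZMod p)) F) :=
    IsFractionRing.injective _ _
  have : CharP (PowerSeries (ZMod p)) p :=
    charP_of_injective_ringHom (PowerSeries.C_injective (R := ZMod p)) p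
  have : CharP F p := charP_of_injective_ringHom inj p
  have hy' : algebraMap (PowerSeries (ZMod p)) F y ≠ 0 := by
    intro h0; exact hy (inj (by simpa using h0))
  have hp1 : p = (p - 1) + 1 := by have := (Fact.out : p.Prime).pos; omega
  have ht : (algebraMap _ F x / algebraMap _ F y) ^ p = algebraMap _ F x / algebraMap _ F y := by
    have h1 : (algebraMap _ F x / algebraMap _ F y) ^ (p - 1) = 1 := by
      rw [div_pow, ← map_pow, ← map_pow, h, div_self]
      rw [map_pow]; exact pow_ne_zero _ hy'
    obtain ⟨r, hr⟩ : ∃ r, r = p - 1 := ⟨_, rfl⟩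
    rw [← hr] at h1 hp1
    have h3 : ∀ t : F, t ^ r = 1 → t ^ (r + 1) = t := fun t ht => by rw [pow_succ, ht, one_mul]
    have h4 := h3 _ h1
    have h5 : ∀ t : F, t ^ p = t ^ (r + 1) := fun t => congrArg (fun k : ℕ => t ^ k) hp1
    rw [h5]; exact h4
  rw [← Subfield.mem_bot_iff_pow_eq_self F p, mem_bot_iff_intCast p F] at ht
  obtain ⟨n, hn⟩ := ht
  refine ⟨(n : ZMod p), inj ?_⟩
  rw [map_mul, map_intCast, map_intCast, hn, div_mul_cancel₀ _ hy']

lemma fr_coe {ι K : Type*} [Fintype ι] [Field K] (A : ι → K[X]) (m : ι → ℕ) :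
    ((∏ i, A i ^ m i : K[X]) : PowerSeries K) = ∏ i, (A i : PowerSeries K) ^ m i := by
  have h := map_prod (Polynomial.coeToPowerSeries.ringHom (R := K)) (fun i => A i ^ m i) Finset.univ
  simp only [map_pow] at h
  exact h

lemma fr_min {ι : Type*} [Fintype ι] (p : ℕ) [Fact p.Prime]
    (f : ι → PowerSeries (ZMod p)) (A : ι → (ZMod p)[X])
    (hf : ∀ i, f i ≠ 0) (hA : ∀ i, (A i : PowerSeries (ZMod p)) * f i ^ p = f i)
    (d : ℕ) (S : Finset (ι → ℕ)) (hd : ∀ m ∈ S, ∀ i, m i ≤ d) (N : ℕ) :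
    ∀ c : (ι → ℕ) → (ZMod p)[X], (S.filter (fun m => c m ≠ 0)).card = N →
      ∑ m ∈ S, (c m : PowerSeries (ZMod p)) * ∏ i, f i ^ m i = 0 → (∃ m ∈ S, c m ≠ 0) →
      ∃ m ∈ S, ∃ m' ∈ S, m ≠ m' ∧ ∃ a b : (ZMod p)[X], a ≠ 0 ∧ b ≠ 0 ∧
        a ^ (p - 1) * ∏ i, A i ^ (d - m i) = b ^ (p - 1) * ∏ i, A i ^ (d - m' i) := by
  classical
  have hp1 : p = (p - 1) + 1 := by have := (Fact.out : p.Prime).pos; omega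
  have : CharP (PowerSeries (ZMod p)) p :=
    charP_of_injective_ringHom (PowerSeries.C_injective (R := ZMod p)) p
  have hprod : ∀ m : ι → ℕ, ∏ i, f i ^ m i ≠ 0 := fun m =>
    Finset.prod_ne_zero_iff.2 fun i _ => pow_ne_zero _ (hf i)
  induction N using Nat.strong_induction_on with
  | _ N ih =>
    intro c hcard hsum ⟨m0, hm0, hcm0⟩
    let c2 : (ι → ℕ) → (ZMod p)[X] := fun m =>
      c m0 * (c m ^ p * ∏ i, A i ^ (d - m i)) - c m0 ^ p * (∏ i, A i ^ (d - m0 i)) * c m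
    by_cases hc2 : ∀ m ∈ S, c2 m = 0
    · have : ∃ m1 ∈ S, m1 ≠ m0 ∧ c m1 ≠ 0 := by
        by_contra hcon
        push Not at hcon
        rw [Finset.sum_eq_single_of_mem m0 hm0] at hsum
        · rcases mul_eq_zero.1 hsum with h | h
          · exact hcm0 (by simpa using h)
          · exact hprod _ h
        · intro b hb hbm
          rw [hcon b hb hbm]; simp
      obtain ⟨m1, hm1, hne, hcm1⟩ := this
      refine ⟨m1, hm1, m0, hm0, hne, c m1, c m0, hcm1, hcm0, ?_⟩
      have h := sub_eq_zero.1 (hc2 m1 hm1)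
      have h2 : (c m0 * c m1) * (c m1 ^ (p - 1) * ∏ i, A i ^ (d - m1 i)) =
          (c m0 * c m1) * (c m0 ^ (p - 1) * ∏ i, A i ^ (d - m0 i)) := by
        calc _ = c m0 * (c m1 ^ ((p - 1) + 1) * ∏ i, A i ^ (d - m1 i)) := by ring
          _ = c m0 ^ ((p - 1) + 1) * (∏ i, A i ^ (d - m0 i)) * c m1 := by
            rw [← hp1]; exact h
          _ = _ := by ring
      exact mul_left_cancel₀ (mul_ne_zero hcm0 hcm1) h2
    · push Not at hc2
      have hlt : (S.filter (fun m => c2 m ≠ 0)).card < N := by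
        rw [← hcard]
        apply Finset.card_lt_card
        rw [Finset.ssubset_iff_of_subset]
        · refine ⟨m0, by simp [hm0, hcm0], ?_⟩
          simp only [Finset.mem_filter, not_and, not_not]
          intro _
          simp only [c2]
          ring
        · intro m hm
          simp only [Finset.mem_filter] at hm ⊢
          refine ⟨hm.1, fun h0 => hm.2 ?_⟩
          simp only [c2, h0]
          rw [zero_pow (Fact.out : p.Prime).ne_zero]; ring
      refine ih _ hlt c2 rfl ?_ hc2
      have hfrob : ∑ m ∈ S, (c m : PowerSeries (ZMod p)) ^ p * (∏ i, f i ^ m i) ^ p = 0 := by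
        have := congrArg (· ^ p) hsum
        simp only [sum_pow_char] at this
        rw [zero_pow (Fact.out : p.Prime).ne_zero] at this
        rw [← this]
        exact Finset.sum_congr rfl fun m _ => by rw [mul_pow]
      have hterm : ∀ m ∈ S, (∏ i, (A i : PowerSeries (ZMod p)) ^ (d - m i)) * ∏ i, f i ^ m i =
          (∏ i, (A i : PowerSeries (ZMod p)) ^ d) * (∏ i, f i ^ m i) ^ p := by
        intro m hm
        rw [← Finset.prod_pow, ← Finset.prod_mul_distrib, ← Finset.prod_mul_distrib]
        refine Finset.prod_congr rfl fun i _ => ?_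
        conv_lhs => rw [← hA i]
        rw [mul_pow, ← mul_assoc, ← pow_add, Nat.sub_add_cancel (hd m hm i)]
        ring
      have hs : ∀ m ∈ S, (c2 m : PowerSeries (ZMod p)) * ∏ i, f i ^ m i =
          (c m0 : PowerSeries (ZMod p)) * (∏ i, (A i : PowerSeries (ZMod p)) ^ d) *
            ((c m : PowerSeries (ZMod p)) ^ p * (∏ i, f i ^ m i) ^ p) -
          ((c m0 : PowerSeries (ZMod p)) ^ p * (∏ i, (A i : PowerSeries (ZMod p)) ^ (d - m0 i))) *
            ((c m : PowerSeries (ZMod p)) * ∏ i, f i ^ m i) := by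
        intro m hm
        have hcoe : ∀ m : ι → ℕ, ((∏ i, A i ^ (d - m i) : (ZMod p)[X]) : PowerSeries (ZMod p)) =
            ∏ i, (A i : PowerSeries (ZMod p)) ^ (d - m i) := by
          intro m
          exact fr_coe A (fun i => d - m i)
        simp only [c2, Polynomial.coe_sub, Polynomial.coe_mul, Polynomial.coe_pow, hcoe]
        linear_combination (c m0 : PowerSeries (ZMod p)) * (c m : PowerSeries (ZMod p)) ^ p * hterm m hm
      rw [Finset.sum_congr rfl hs, Finset.sum_sub_distrib, ← Finset.mul_sum, ← Finset.mul_sum,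
        hfrob, hsum]
      simp

lemma fr_gcd {K : Type*} [Field K] (a b : K[X]) (hb : b ≠ 0) :
    ∃ g a' b' : K[X], g ≠ 0 ∧ IsCoprime a' b' ∧ a = g * a' ∧ b = g * b' := by
  classical
  obtain ⟨a', ha⟩ := EuclideanDomain.gcd_dvd_left a b
  obtain ⟨b', hb'⟩ := EuclideanDomain.gcd_dvd_right a b
  have hbz := EuclideanDomain.gcd_eq_gcd_ab a b
  generalize EuclideanDomain.gcd a b = g at ha hb' hbz
  generalize EuclideanDomain.gcdA a b = x at hbz
  generalize EuclideanDomain.gcdB a b = y at hbz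
  have h0 : g ≠ 0 := by rintro rfl; exact hb (by rw [hb', zero_mul])
  refine ⟨g, a', b', h0, ⟨x, y, ?_⟩, ha, hb'⟩
  apply mul_left_cancel₀ h0
  rw [mul_one]
  conv_rhs => rw [hbz, ha, hb']
  ring

lemma fr_modp {ι : Type*} [Fintype ι] (p : ℕ) [Fact p.Prime]
    (f : ι → PowerSeries (ZMod p)) (A : ι → (ZMod p)[X]) (hAd : ∀ i, (A i).natDegree ≤ p - 1)
    (hf : ∀ i, f i ≠ 0) (hA : ∀ i, (A i : PowerSeries (ZMod p)) * f i ^ p = f i)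
    (d : ℕ) (S : Finset (ι → ℕ)) (hd : ∀ m ∈ S, ∀ i, m i ≤ d)
    (c : (ι → ℕ) → (ZMod p)[X])
    (hsum : ∑ m ∈ S, (c m : PowerSeries (ZMod p)) * ∏ i, f i ^ m i = 0) (hc : ∃ m ∈ S, c m ≠ 0) :
    ∃ m ∈ S, ∃ m' ∈ S, m ≠ m' ∧ ∃ a b : (ZMod p)[X], a ≠ 0 ∧
      a.natDegree ≤ Fintype.card ι * d ∧ b.natDegree ≤ Fintype.card ι * d ∧
      (a : PowerSeries (ZMod p)) * ∏ i, f i ^ m i = (b : PowerSeries (ZMod p)) * ∏ i, f i ^ m' i := by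
  classical
  have hp2 := (Fact.out : p.Prime).two_le
  have hp1 : p = (p - 1) + 1 := by omega
  obtain ⟨m, hm, m', hm', hne, a, b, ha, hb, hab⟩ := fr_min p f A hf hA d S hd _ c rfl hsum hc
  have hprod : ∀ m : ι → ℕ, ∏ i, f i ^ m i ≠ 0 := fun m =>
    Finset.prod_ne_zero_iff.2 fun i _ => pow_ne_zero _ (hf i)
  have hA1 : ∀ i, (A i : PowerSeries (ZMod p)) * f i ^ (p - 1) = 1 := by
    intro i
    have h := hA i
    have h5 : f i ^ p = f i ^ (p - 1) * f i := by
      rw [← pow_succ]; exact congrArg (fun k : ℕ => f i ^ k) hp1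
    rw [h5, ← mul_assoc] at h
    exact mul_right_cancel₀ (hf i) (by rw [one_mul]; exact h)
  have hA0 : ∀ i, A i ≠ 0 := by
    intro i h0
    have := hA1 i
    rw [h0] at this
    simp at this
  obtain ⟨g, a', b', hg0, hrel, ha', hb'⟩ := fr_gcd a b hb
  have hab' : a' ^ (p - 1) * ∏ i, A i ^ (d - m i) = b' ^ (p - 1) * ∏ i, A i ^ (d - m' i) := by
    rw [ha', hb', mul_pow, mul_pow, mul_assoc, mul_assoc] at hab
    exact mul_left_cancel₀ (pow_ne_zero _ hg0) hab
  have ha0 : a' ≠ 0 := by rintro rfl; exact ha (by rw [ha']; simp)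
  have hb0 : b' ≠ 0 := by rintro rfl; exact hb (by rw [hb']; simp)
  have hdegA : ∀ m : ι → ℕ, (∏ i, A i ^ (d - m i)).natDegree ≤ (p - 1) * (Fintype.card ι * d) := by
    intro m
    refine (natDegree_prod_le _ _).trans ?_
    refine (Finset.sum_le_card_nsmul _ _ ((p - 1) * d) ?_).trans ?_
    · intro i _
      refine natDegree_pow_le.trans ?_
      rw [mul_comm]
      exact Nat.mul_le_mul (hAd i) (Nat.sub_le _ _)
    · simp; apply le_of_eq; ring
  have hPne : ∀ m : ι → ℕ, (∏ i, A i ^ (d - m i)) ≠ 0 := fun m =>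
    Finset.prod_ne_zero_iff.2 fun i _ => pow_ne_zero _ (hA0 i)
  have hdeg : ∀ (a b : (ZMod p)[X]) (m m' : ι → ℕ), IsCoprime a b →
      a ^ (p - 1) * ∏ i, A i ^ (d - m i) = b ^ (p - 1) * ∏ i, A i ^ (d - m' i) →
      a.natDegree ≤ Fintype.card ι * d := by
    intro a b m m' hco h
    have hdvd : a ^ (p - 1) ∣ ∏ i, A i ^ (d - m' i) :=
      (hco.pow (m := p - 1) (n := p - 1)).dvd_of_dvd_mul_left ⟨_, h.symm⟩
    have h1 := natDegree_le_of_dvd hdvd (hPne m')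
    rw [natDegree_pow] at h1
    exact Nat.le_of_mul_le_mul_left (h1.trans (hdegA m')) (by omega)
  have hkey : ((a' : PowerSeries (ZMod p)) * ∏ i, f i ^ m i) ^ (p - 1) =
      ((b' : PowerSeries (ZMod p)) * ∏ i, f i ^ m' i) ^ (p - 1) := by
    have hterm : ∀ m ∈ S, (∏ i, (A i : PowerSeries (ZMod p)) ^ (d - m i)) *
        ∏ i, (f i ^ (p - 1)) ^ d = (∏ i, f i ^ m i) ^ (p - 1) := by
      intro m hm
      rw [← Finset.prod_pow, ← Finset.prod_mul_distrib]
      refine Finset.prod_congr rfl fun i _ => ?_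
      have : d = (d - m i) + m i := (Nat.sub_add_cancel (hd m hm i)).symm
      conv_lhs => rw [this]
      rw [Nat.add_sub_cancel, pow_add, ← mul_assoc, ← mul_pow, hA1, one_pow, one_mul]
      ring
    have hcoe : ∀ m : ι → ℕ, ((∏ i, A i ^ (d - m i) : (ZMod p)[X]) : PowerSeries (ZMod p)) =
        ∏ i, (A i : PowerSeries (ZMod p)) ^ (d - m i) := by
      intro m
      exact fr_coe A (fun i => d - m i)
    have h := congrArg (fun q : (ZMod p)[X] => (q : PowerSeries (ZMod p))) hab'
    simp only [Polynomial.coe_mul, Polynomial.coe_pow, hcoe] at h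
    rw [mul_pow, mul_pow, ← hterm m hm, ← hterm m' hm', ← mul_assoc, ← mul_assoc, h]
  obtain ⟨t, ht⟩ := fr_root p _ _ (mul_ne_zero (by simpa using hb0) (hprod m')) hkey
  refine ⟨m, hm, m', hm', hne, a', C t * b', ha0, hdeg a' b' m m' hrel hab', ?_, ?_⟩
  · exact (natDegree_C_mul_le _ _).trans (hdeg b' a' m' m hrel.symm hab'.symm)
  · rw [ht, Polynomial.coe_mul, Polynomial.coe_C, mul_assoc]

/-- The Lucas congruences as an identity of power series mod `p`. -/
lemma fr_lucas (p : ℕ) [Fact p.Prime] (q : ℕ → ZMod p)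
    (h : ∀ a n : ℕ, a < p → q (a + n * p) = q a * q n) :
    ((∑ a ∈ Finset.range p, C (q a) * X ^ a : (ZMod p)[X]) : PowerSeries (ZMod p)) *
      (PowerSeries.mk q) ^ p = PowerSeries.mk q := by
  have hp0 : p ≠ 0 := (Fact.out : p.Prime).ne_zero
  have hfrob : (PowerSeries.mk q) ^ p = PowerSeries.expand p hp0 (PowerSeries.mk q) := by
    have := MvPowerSeries.map_frobenius_expand p hp0 (f := (PowerSeries.mk q : MvPowerSeries Unit (ZMod p)))
    rw [ZMod.frobenius_zmod] at this
    simpa [PowerSeries.expand] using this.symm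
  rw [hfrob]
  ext N
  rw [PowerSeries.coeff_mul, PowerSeries.coeff_mk]
  have hmod : N % p < p := Nat.mod_lt _ (Nat.pos_of_ne_zero hp0)
  rw [Finset.sum_eq_single (N % p, p * (N / p))]
  · rw [PowerSeries.coeff_expand_mul, PowerSeries.coeff_mk, Polynomial.coeff_coe]
    simp only [finsetSum_coeff, coeff_C_mul, coeff_X_pow]
    simp [hmod]
    rw [← h _ _ hmod, mul_comm, Nat.mod_add_div]
  · rintro ⟨i, j⟩ hij hne
    rw [Finset.HasAntidiagonal.mem_antidiagonal] at hij
    simp only at hij ⊢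
    rw [PowerSeries.coeff_expand]
    split_ifs with hd
    · obtain ⟨k, rfl⟩ := hd
      rw [Polynomial.coeff_coe]
      simp only [finsetSum_coeff, coeff_C_mul, coeff_X_pow]
      by_cases hi : i < p
      · exfalso
        apply hne
        have h1 : N % p = i := by rw [← hij, Nat.add_mul_mod_self_left, Nat.mod_eq_of_lt hi]
        have h2 : N / p = k := by
          rw [← hij, Nat.add_mul_div_left _ _ (Nat.pos_of_ne_zero hp0), Nat.div_eq_of_lt hi, zero_add]
        rw [h1, h2]
      · simp [hi]
    · simp
  · intro hno
    exact absurd (by rw [Finset.HasAntidiagonal.mem_antidiagonal]; exact Nat.mod_add_div N p) hno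


lemma fr_clear {κ : Type*} (T : Finset κ) (c : κ → ℚ) :
    ∃ D : ℤ, D ≠ 0 ∧ ∃ c' : κ → ℤ, ∀ j ∈ T, (c' j : ℚ) = D * c j := by
  obtain ⟨b, hb⟩ := IsLocalization.exist_integer_multiples (nonZeroDivisors ℤ) T c
  refine ⟨b, nonZeroDivisors.coe_ne_zero b, ?_⟩
  choose! c' hc' using hb
  refine ⟨c', fun j hj => ?_⟩
  have := hc' j hj
  simpa [Algebra.smul_def] using this

lemma fr_descend {κ : Type*} (T : Finset κ) (γ : κ → ℂ) (w : κ → ℕ → ℤ)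
    (h0 : ∃ j ∈ T, γ j ≠ 0) (h : ∀ n, ∑ j ∈ T, γ j * (w j n : ℂ) = 0) :
    ∃ γ' : κ → ℤ, (∃ j ∈ T, γ' j ≠ 0) ∧ ∀ n, ∑ j ∈ T, γ' j * w j n = 0 := by
  obtain ⟨j0, hj0, hne⟩ := h0
  obtain ⟨φ, hφ⟩ : ∃ φ : Module.Dual ℚ ℂ, φ (γ j0) ≠ 0 := by
    by_contra hcon
    push Not at hcon
    exact hne ((Module.forall_dual_apply_eq_zero_iff ℚ _).1 hcon)
  obtain ⟨D, hD, c', hc'⟩ := fr_clear T (fun j => φ (γ j))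
  refine ⟨c', ⟨j0, hj0, fun h0 => ?_⟩, fun n => ?_⟩
  · have := hc' j0 hj0
    rw [h0] at this
    simp [hD, hφ] at this
  · have h1 : ∑ j ∈ T, φ (γ j) * (w j n : ℚ) = 0 := by
      have := congrArg φ (h n)
      rw [map_sum, map_zero] at this
      rw [← this]
      refine Finset.sum_congr rfl fun j _ => ?_
      have : γ j * (w j n : ℂ) = (w j n : ℤ) • γ j := by simp [mul_comm]
      rw [this, map_zsmul]; simp [mul_comm]
    have h2 : ((∑ j ∈ T, c' j * w j n : ℤ) : ℚ) = 0 := by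
      push_cast
      rw [Finset.sum_congr rfl (fun j hj => by rw [hc' j hj, mul_assoc]), ← Finset.mul_sum, h1, mul_zero]
    exact_mod_cast h2

lemma fr_lift {J : Type*} [Fintype J] [DecidableEq J] (w : J → ℕ → ℤ)
    (h : ∀ N : ℕ, ∃ p > N, p.Prime ∧ ∃ c : J → ZMod p, c ≠ 0 ∧
      ∀ n, ∑ j, c j * (w j n : ZMod p) = 0) :
    ∃ c : J → ℚ, c ≠ 0 ∧ ∀ n, ∑ j, c j * (w j n : ℚ) = 0 := by
  by_contra hcon
  push Not at hcon
  let T : (N : ℕ) → (J → ℚ) →ₗ[ℚ] (Fin N → ℚ) := fun N =>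
    { toFun := fun c n => ∑ j, c j * (w j n : ℚ)
      map_add' := by intro a b; ext n; simp [add_mul, Finset.sum_add_distrib]
      map_smul' := by intro a b; ext n; simp [Finset.mul_sum, mul_assoc] }
  have hTa : ∀ N c n, T N c n = ∑ j, c j * (w j n : ℚ) := fun _ _ _ => rfl
  have hinj : ∃ N, LinearMap.ker (T N) = ⊥ := by
    let g : ℕ →o (Submodule ℚ (J → ℚ))ᵒᵈ :=
      { toFun := fun N => OrderDual.toDual (LinearMap.ker (T N))
        monotone' := by
          intro N M hNM
          rw [OrderDual.toDual_le_toDual]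
          intro c hc
          rw [LinearMap.mem_ker] at hc ⊢
          ext n
          exact congrFun hc ⟨n, lt_of_lt_of_le n.2 hNM⟩ }
    obtain ⟨N, hN⟩ := IsArtinian.monotone_stabilizes g
    refine ⟨N, ?_⟩
    rw [Submodule.eq_bot_iff]
    intro c hc
    by_contra hc0
    obtain ⟨n, hn⟩ := hcon c hc0
    have h1 : LinearMap.ker (T N) = LinearMap.ker (T (max N (n + 1))) := hN _ (le_max_left _ _)
    rw [h1, LinearMap.mem_ker] at hc
    exact hn (congrFun hc ⟨n, by omega⟩)
  obtain ⟨N, hN⟩ := hinj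
  obtain ⟨L, hL⟩ := LinearMap.exists_leftInverse_of_injective (T N) hN
  obtain ⟨D, hD, l, hl⟩ := fr_clear (Finset.univ : Finset (J × Fin N))
    (fun x => L (Pi.single x.2 1) x.1)
  have hid : ∀ j j', ∑ n : Fin N, l (j, n) * w j' n = if j = j' then D else 0 := by
    intro j j'
    have h1 := congrFun (LinearMap.congr_fun hL (Pi.single j' 1)) j
    rw [LinearMap.comp_apply, LinearMap.id_apply] at h1
    have h2 : T N (Pi.single j' 1) = ∑ n : Fin N, (w j' n : ℚ) • (Pi.single n 1 : Fin N → ℚ) := by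
      ext n
      rw [hTa]
      simp [Finset.sum_apply, Pi.single_apply]
    rw [h2, map_sum, Finset.sum_apply] at h1
    have h3 : ((∑ n : Fin N, l (j, n) * w j' n : ℤ) : ℚ) = D * ∑ n : Fin N, L ((w j' n : ℚ) • (Pi.single n 1 : Fin N → ℚ)) j := by
      push_cast
      rw [Finset.mul_sum]
      refine Finset.sum_congr rfl fun n _ => ?_
      rw [hl (j, n) (Finset.mem_univ _), map_smul]
      simp only [Pi.smul_apply, smul_eq_mul]; ring
    rw [h1, Pi.single_apply] at h3
    split_ifs at h3 ⊢ with hjj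
    · rw [mul_one] at h3; exact_mod_cast h3
    · rw [mul_zero] at h3; exact_mod_cast h3
  obtain ⟨p, hpD, hp, c, hc0, hc⟩ := h D.natAbs
  have : Fact p.Prime := ⟨hp⟩
  apply hc0
  ext j
  have hDp : (D : ZMod p) ≠ 0 := by
    intro h0
    rw [ZMod.intCast_zmod_eq_zero_iff_dvd] at h0
    have := Int.natAbs_dvd_natAbs.2 h0
    rw [Int.natAbs_natCast] at this
    exact absurd (Nat.le_of_dvd (Int.natAbs_pos.2 hD) this) (by omega)
  have h2 : ∑ j', c j' * (((∑ n : Fin N, l (j, n) * w j' n : ℤ)) : ZMod p) = 0 := by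
    have : ∑ j', c j' * (((∑ n : Fin N, l (j, n) * w j' n : ℤ)) : ZMod p) =
        ∑ n : Fin N, (l (j, n) : ZMod p) * ∑ j', c j' * (w j' n : ZMod p) := by
      simp only [Int.cast_sum, Int.cast_mul, Finset.mul_sum]
      rw [Finset.sum_comm]
      exact Finset.sum_congr rfl fun _ _ => Finset.sum_congr rfl fun _ _ => by ring
    rw [this]
    simp [hc]
  simp only [hid] at h2
  simpa [hDp] using h2

/-- integer coefficients of `X^k * F^m`. -/
noncomputable def frW {ι : Type*} [Fintype ι] (q : ι → ℕ → ℤ) (m : ι → ℕ) (k n : ℕ) : ℤ :=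
  PowerSeries.coeff n (PowerSeries.X ^ k * ∏ i, (PowerSeries.mk (q i)) ^ m i)

lemma frW_cast {ι : Type*} [Fintype ι] (q : ι → ℕ → ℤ) (m : ι → ℕ) (k n : ℕ)
    (R : Type*) [CommRing R] : (frW q m k n : R) =
    PowerSeries.coeff n (PowerSeries.X ^ k * ∏ i, (PowerSeries.mk fun n => (q i n : R)) ^ m i) := by
  have h : (PowerSeries.X ^ k * ∏ i, (PowerSeries.mk fun n => (q i n : R)) ^ m i) =
      PowerSeries.map (Int.castRingHom R)
        (PowerSeries.X ^ k * ∏ i, (PowerSeries.mk (q i)) ^ m i) := by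
    rw [map_mul, map_pow, PowerSeries.map_X, map_prod]
    congr 1
    refine Finset.prod_congr rfl fun i _ => ?_
    rw [map_pow]
    congr 1
  rw [h, PowerSeries.coeff_map]
  rfl

lemma fr_flat {ι : Type*} [Fintype ι] (q : ι → ℕ → ℤ) (m : ι → ℕ) (n h : ℕ)
    (R : Type*) [CommRing R] (γ : ℕ → R) :
    PowerSeries.coeff n (((∑ k ∈ Finset.range (h + 1), C (γ k) * X ^ k : R[X]) : PowerSeries R) *
      ∏ i, (PowerSeries.mk fun n => (q i n : R)) ^ m i) =
    ∑ k ∈ Finset.range (h + 1), γ k * (frW q m k n : R) := by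
  have hc : ((∑ k ∈ Finset.range (h + 1), C (γ k) * X ^ k : R[X]) : PowerSeries R) =
      ∑ k ∈ Finset.range (h + 1), PowerSeries.C (γ k) * PowerSeries.X ^ k := by
    have := map_sum (Polynomial.coeToPowerSeries.ringHom (R := R)) (fun k => C (γ k) * X ^ k)
      (Finset.range (h + 1))
    simp only [map_mul, map_pow] at this
    rw [Polynomial.coeToPowerSeries.ringHom_apply] at this
    rw [this]
    simp only [Polynomial.coeToPowerSeries.ringHom_apply, Polynomial.coe_C, Polynomial.coe_X]
  rw [hc, Finset.sum_mul, map_sum]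
  refine Finset.sum_congr rfl fun k _ => ?_
  rw [frW_cast, mul_assoc, PowerSeries.coeff_C_mul]

lemma fr_poly {R : Type*} [CommRing R] (h : ℕ) (P : R[X]) (hP : P.natDegree ≤ h) :
    P = ∑ k ∈ Finset.range (h + 1), C (P.coeff k) * X ^ k :=
  P.as_sum_range_C_mul_X_pow' (by omega)

theorem fr_arith {ι : Type*} [Fintype ι] (q : ι → ℕ → ℤ) (hq0 : ∀ i, q i 0 = 1)
    (hl : ∀ i, ∀ p : ℕ, p.Prime → ∀ a n : ℕ, a < p →
        q i (a + n * p) ≡ q i a * q i n [ZMOD (p : ℤ)])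
    (hdep : ¬ AlgebraicIndependent ℂ[X] (fun i => PowerSeries.mk fun n => (q i n : ℂ))) :
    ∃ m m' : ι → ℕ, m ≠ m' ∧ ∃ a b : ℝ[X], a ≠ 0 ∧ b ≠ 0 ∧
      (a : PowerSeries ℝ) * ∏ i, (PowerSeries.mk fun n => (q i n : ℝ)) ^ m i =
      (b : PowerSeries ℝ) * ∏ i, (PowerSeries.mk fun n => (q i n : ℝ)) ^ m' i := by
  classical
  rw [algebraicIndependent_iff] at hdep
  push Not at hdep
  obtain ⟨P, hP, hP0⟩ := hdep
  rw [MvPolynomial.aeval_def, MvPolynomial.eval₂_eq'] at hP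
  -- bounds
  let h : ℕ := ∑ m ∈ P.support, (P.coeff m).natDegree
  have hh : ∀ m ∈ P.support, (P.coeff m).natDegree ≤ h := fun m hm =>
    Finset.single_le_sum (f := fun m => (P.coeff m).natDegree) (fun _ _ => Nat.zero_le _) hm
  let S : Finset (ι → ℕ) := P.support.image (fun m : ι →₀ ℕ => (⇑m : ι → ℕ))
  let d : ℕ := ∑ m ∈ S, ∑ i, m i
  have hd : ∀ m ∈ S, ∀ i, m i ≤ d := fun m hm i =>
    (Finset.single_le_sum (f := fun i => m i) (fun _ _ => Nat.zero_le _) (Finset.mem_univ i)).trans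
    (Finset.single_le_sum (f := fun m : ι → ℕ => ∑ i, m i) (fun _ _ => Nat.zero_le _) hm)
  let γ : (ι → ℕ) × ℕ → ℂ := fun x => (P.coeff (Finsupp.equivFunOnFinite.symm x.1)).coeff x.2
  obtain ⟨γ', hγ0, hγ⟩ := fr_descend (S ×ˢ Finset.range (h + 1)) γ (fun x n => frW q x.1 x.2 n)
    (by
      obtain ⟨m, hm⟩ := MvPolynomial.support_nonempty.2 hP0
      refine ⟨(m, (P.coeff m).natDegree), ?_, ?_⟩
      · rw [Finset.mem_product]
        refine ⟨Finset.mem_image_of_mem _ hm, Finset.mem_range.2 (Nat.lt_succ_of_le (hh m hm))⟩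
      · simp only [γ]
        have : Finsupp.equivFunOnFinite.symm (m : ι → ℕ) = m := by ext; simp
        rw [this]
        simpa using hm)
    (by
      intro n
      have h1 := congrArg (PowerSeries.coeff n) hP
      rw [map_sum, map_zero] at h1
      rw [Finset.sum_product, ← h1, Finset.sum_image (by intro a _ b _ hab; exact DFunLike.coe_injective hab)]
      refine Finset.sum_congr rfl fun m hm => ?_
      have : Finsupp.equivFunOnFinite.symm (m : ι → ℕ) = m := by ext; simp
      simp only [γ, this]
      rw [← fr_flat, ← fr_poly h _ (hh m hm)]
      rfl)
  obtain ⟨⟨m0, k0⟩, hmk, hne0⟩ := hγ0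
  rw [Finset.mem_product] at hmk
  let D := Fintype.card ι * d
  -- mod p
  have hmodp : ∀ p : ℕ, p.Prime → (γ' (m0, k0)).natAbs < p →
      ∃ mm ∈ S ×ˢ S, mm.1 ≠ mm.2 ∧ ∃ c : Bool × Fin (D + 1) → ZMod p, c ≠ 0 ∧
        ∀ n, ∑ j, c j * ((frW q (if j.1 then mm.1 else mm.2) j.2 n : ℤ) : ZMod p) = 0 := by
    intro p hp hlt
    have : Fact p.Prime := ⟨hp⟩
    let f : ι → PowerSeries (ZMod p) := fun i => PowerSeries.mk fun n => (q i n : ZMod p)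
    let A : ι → (ZMod p)[X] := fun i => ∑ a ∈ Finset.range p, C ((q i a : ZMod p)) * X ^ a
    let c : (ι → ℕ) → (ZMod p)[X] := fun m =>
      ∑ k ∈ Finset.range (h + 1), C ((γ' (m, k) : ZMod p)) * X ^ k
    obtain ⟨m, hm, m', hm', hne, a, b, ha, hda, hdb, hab⟩ := fr_modp p f A
      (fun i => by
        refine natDegree_sum_le_of_forall_le _ _ fun a ha => ?_
        refine (natDegree_C_mul_X_pow_le _ _).trans ?_
        have := Finset.mem_range.1 ha
        omega)
      (fun i h0 => by
        have := congrArg (PowerSeries.coeff 0) h0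
        simp [f, hq0] at this)
      (fun i => fr_lucas p (fun n => (q i n : ZMod p)) (fun a n ha => by
        have := (ZMod.intCast_eq_intCast_iff _ _ p).2 (hl i p hp a n ha)
        push_cast at this
        exact this))
      d S hd c
      (by
        ext n
        rw [map_sum, map_zero]
        have := congrArg (Int.cast : ℤ → ZMod p) (hγ n)
        rw [Finset.sum_product] at this
        push_cast at this
        rw [← this]
        exact Finset.sum_congr rfl fun m _ => fr_flat q m n h (ZMod p) _)
      ⟨m0, hmk.1, fun h0 => by
        have h1 := congrArg (fun P => P.coeff k0) h0
        simp only [c, finsetSum_coeff, coeff_C_mul, coeff_X_pow, coeff_zero] at h1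
        rw [Finset.sum_eq_single_of_mem k0 hmk.2 (by intro b _ hb; simp [hb.symm])] at h1
        rw [if_pos rfl, mul_one, ZMod.intCast_zmod_eq_zero_iff_dvd] at h1
        have := Int.natAbs_dvd_natAbs.2 h1
        rw [Int.natAbs_natCast] at this
        exact absurd (Nat.le_of_dvd (Int.natAbs_pos.2 hne0) this) (by omega)⟩
    refine ⟨(m, m'), Finset.mem_product.2 ⟨hm, hm'⟩, hne,
      fun j => if j.1 then a.coeff j.2 else - b.coeff j.2, ?_, ?_⟩
    · intro h0
      apply ha
      ext k
      by_cases hk : k < D + 1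
      · have := congrFun h0 (true, ⟨k, hk⟩)
        simpa using this
      · rw [coeff_eq_zero_of_natDegree_lt, coeff_zero]
        exact lt_of_le_of_lt hda (by omega)
    · intro n
      rw [Fintype.sum_prod_type]
      simp only [Fintype.sum_bool, if_true, Bool.false_eq_true, if_false]
      have h1 := congrArg (PowerSeries.coeff n) hab
      rw [fr_poly D a hda, fr_poly D b hdb, fr_flat, fr_flat] at h1
      rw [← Fin.sum_univ_eq_sum_range (fun k => a.coeff k * (frW q m k n : ZMod p)),
        ← Fin.sum_univ_eq_sum_range (fun k => b.coeff k * (frW q m' k n : ZMod p))] at h1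
      simp only [neg_mul, Finset.sum_neg_distrib]
      rw [h1]; ring
  -- pigeonhole
  obtain ⟨mm, hmm, hinf⟩ : ∃ mm ∈ S ×ˢ S, mm.1 ≠ mm.2 ∧ ∀ N : ℕ, ∃ p > N, p.Prime ∧
      ∃ c : Bool × Fin (D + 1) → ZMod p, c ≠ 0 ∧
        ∀ n, ∑ j, c j * ((frW q (if j.1 then mm.1 else mm.2) j.2 n : ℤ) : ZMod p) = 0 := by
    by_contra hcon
    push Not at hcon
    choose! N hN using hcon
    obtain ⟨p, hpN, hp⟩ := Nat.exists_infinite_primes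
      ((γ' (m0, k0)).natAbs + 1 + ∑ mm ∈ S ×ˢ S, (N mm + 1))
    obtain ⟨mm, hmm, hne, c, hc0, hc⟩ := hmodp p hp (by omega)
    have h1 : N mm + 1 ≤ ∑ mm ∈ S ×ˢ S, (N mm + 1) :=
      Finset.single_le_sum (f := fun mm => N mm + 1) (fun _ _ => Nat.zero_le _) hmm
    obtain ⟨n, hn⟩ := hN mm hmm hne p (by omega) hp c hc0
    exact hn (hc n)
  obtain ⟨hne, hinf⟩ := hinf
  obtain ⟨c, hc0, hc⟩ := fr_lift
    (fun (j : Bool × Fin (D + 1)) n => frW q (if j.1 then mm.1 else mm.2) j.2 n) hinf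
  let a : ℝ[X] := ∑ k ∈ Finset.range (D + 1),
    C ((if hk : k < D + 1 then c (true, ⟨k, hk⟩) else 0 : ℚ) : ℝ) * X ^ k
  let b : ℝ[X] := ∑ k ∈ Finset.range (D + 1),
    C ((if hk : k < D + 1 then - c (false, ⟨k, hk⟩) else 0 : ℚ) : ℝ) * X ^ k
  have hcoef : ∀ (g : ℕ → ℝ) (k : ℕ), k < D + 1 →
      (∑ k ∈ Finset.range (D + 1), C (g k) * X ^ k : ℝ[X]).coeff k = g k := by
    intro g k hk
    simp only [finsetSum_coeff, coeff_C_mul, coeff_X_pow]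
    rw [Finset.sum_eq_single_of_mem k (Finset.mem_range.2 hk) (by intro b _ hb; simp [hb.symm])]
    simp
  have hrel : (a : PowerSeries ℝ) * ∏ i, (PowerSeries.mk fun n => (q i n : ℝ)) ^ mm.1 i =
      (b : PowerSeries ℝ) * ∏ i, (PowerSeries.mk fun n => (q i n : ℝ)) ^ mm.2 i := by
    ext n
    simp only [a, b]
    rw [fr_flat q mm.1 n D ℝ, fr_flat q mm.2 n D ℝ, ← Fin.sum_univ_eq_sum_range
      (fun k => ((if hk : k < D + 1 then c (true, ⟨k, hk⟩) else 0 : ℚ) : ℝ) * (frW q mm.1 k n : ℝ)),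
      ← Fin.sum_univ_eq_sum_range (fun k =>
        ((if hk : k < D + 1 then - c (false, ⟨k, hk⟩) else 0 : ℚ) : ℝ) * (frW q mm.2 k n : ℝ))]
    have h1 := congrArg (fun x : ℚ => (x : ℝ)) (hc n)
    simp only [Fintype.sum_prod_type, Fintype.sum_bool, if_true, Bool.false_eq_true, if_false] at h1
    push_cast at h1
    simp only [Fin.is_lt, dif_pos, Fin.eta]
    push_cast
    simp only [neg_mul, Finset.sum_neg_distrib]
    linarith
  have hprod : ∀ m : ι → ℕ, ∏ i, (PowerSeries.mk fun n => (q i n : ℝ)) ^ m i ≠ 0 := fun m =>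
    Finset.prod_ne_zero_iff.2 fun i _ => pow_ne_zero _ (fun h0 => by
      have := congrArg (PowerSeries.coeff 0) h0
      simp [hq0] at this)
  have hor : ¬ (a = 0 ∧ b = 0) := by
    rintro ⟨ha, hb⟩
    apply hc0
    ext ⟨t, k⟩
    rcases t with _ | _
    · have := hcoef (fun k => ((if hk : k < D + 1 then - c (false, ⟨k, hk⟩) else 0 : ℚ) : ℝ)) k k.2
      change b.coeff k = _ at this
      rw [hb] at this
      have hk := k.2
      simp only [hk, dif_pos, coeff_zero, Fin.eta] at this
      have h2 : (-c (false, k) : ℚ) = 0 := by exact_mod_cast this.symm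
      simpa using h2
    · have := hcoef (fun k => ((if hk : k < D + 1 then c (true, ⟨k, hk⟩) else 0 : ℚ) : ℝ)) k k.2
      change a.coeff k = _ at this
      rw [ha] at this
      have hk := k.2
      simp only [hk, dif_pos, coeff_zero, Fin.eta] at this
      have h2 : (c (true, k) : ℚ) = 0 := by exact_mod_cast this.symm
      simpa using h2
  refine ⟨mm.1, mm.2, hne, a, b, ?_, ?_, hrel⟩
  · intro ha
    apply hor
    refine ⟨ha, ?_⟩
    rw [ha, Polynomial.coe_zero, zero_mul, eq_comm, mul_eq_zero] at hrel
    rcases hrel with h | h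
    · simpa using h
    · exact absurd h (hprod _)
  · intro hb
    apply hor
    refine ⟨?_, hb⟩
    rw [hb, Polynomial.coe_zero, zero_mul, mul_eq_zero] at hrel
    rcases hrel with h | h
    · simpa using h
    · exact absurd h (hprod _)

end PartA

section PartC
open Filter Topology

lemma fr_binom (n : ℕ) (x y : ℝ) :
    HasSum (fun k : ℕ => (n.choose k : ℝ) * x ^ (n - k) * y ^ k) ((x + y) ^ n) := by
  rw [add_comm x y, add_pow]
  have : ∑ m ∈ Finset.range (n + 1), y ^ m * x ^ (n - m) * (n.choose m : ℝ) =
      ∑ m ∈ Finset.range (n + 1), (n.choose m : ℝ) * x ^ (n - m) * y ^ m :=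
    Finset.sum_congr rfl fun _ _ => by ring
  rw [this]
  apply hasSum_sum_of_ne_finset_zero
  intro k hk
  rw [Nat.choose_eq_zero_of_lt (by simpa using hk)]
  simp

lemma fr_taylor_aux (q : ℕ → ℝ) (hq : ∀ n, 0 ≤ q n) (x y : ℝ) (hx : 0 ≤ x)
    (hs : Summable fun n => q n * (x + |y|) ^ n) :
    Summable (fun z : ℕ × ℕ => q z.1 * ((z.1.choose z.2 : ℝ) * x ^ (z.1 - z.2) * y ^ z.2)) := by
  rw [← summable_norm_iff]
  have he : ∀ z : ℕ × ℕ, ‖q z.1 * ((z.1.choose z.2 : ℝ) * x ^ (z.1 - z.2) * y ^ z.2)‖ =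
      q z.1 * ((z.1.choose z.2 : ℝ) * x ^ (z.1 - z.2) * |y| ^ z.2) := by
    intro z
    rw [norm_mul, norm_mul, norm_mul, norm_pow, norm_pow, Real.norm_of_nonneg (hq _),
      Real.norm_of_nonneg hx, Real.norm_eq_abs y, Real.norm_of_nonneg (Nat.cast_nonneg _)]
  simp only [he]
  rw [summable_prod_of_nonneg]
  · refine ⟨fun n => ((fr_binom n x |y|).mul_left (q n)).summable, ?_⟩
    convert hs using 2 with n
    exact ((fr_binom n x |y|).mul_left (q n)).tsum_eq
  · intro z
    have := hq z.1
    simp only [Pi.zero_apply]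
    positivity

lemma fr_taylor (q : ℕ → ℝ) (hq : ∀ n, 0 ≤ q n) (x y : ℝ) (hx : 0 ≤ x)
    (hs : Summable fun n => q n * (x + |y|) ^ n) :
    HasSum (fun k => y ^ k • ∑' n, q n * ((n.choose k : ℝ) * x ^ (n - k)))
      (∑' n, q n * (x + y) ^ n) := by
  have h := fr_taylor_aux q hq x y hx hs
  have h1 := h.hasSum.prod_fiberwise (fun n => (fr_binom n x y).mul_left (q n))
  rw [h1.tsum_eq]
  have h2 := h.prod_symm
  have h3 : ∑' z : ℕ × ℕ, q z.1 * ((z.1.choose z.2 : ℝ) * x ^ (z.1 - z.2) * y ^ z.2) =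
      ∑' z : ℕ × ℕ, q z.swap.1 * ((z.swap.1.choose z.swap.2 : ℝ) * x ^ (z.swap.1 - z.swap.2) * y ^ z.swap.2) :=
    ((Equiv.prodComm ℕ ℕ).tsum_eq _).symm
  rw [h3]
  refine h2.hasSum.prod_fiberwise (fun k => ?_)
  have h4 := (h2.prod_factor k).hasSum
  have h5 : y ^ k • ∑' n, q n * ((n.choose k : ℝ) * x ^ (n - k)) =
      ∑' n, q n * ((n.choose k : ℝ) * x ^ (n - k) * y ^ k) := by
    rw [smul_eq_mul, ← tsum_mul_left]
    refine tsum_congr fun n => ?_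
    ring
  rw [h5]
  exact h4

lemma fr_pringsheim (q : ℕ → ℝ) (hq : ∀ n, 0 ≤ q n) (ρ : ℝ) (hρ : 0 < ρ)
    (hs : ∀ x, 0 ≤ x → x < ρ → Summable fun n => q n * x ^ n)
    (g : ℝ → ℝ) (hg : AnalyticAt ℝ g ρ)
    (heq : ∀ᶠ x in 𝓝[<] ρ, g x = ∑' n, q n * x ^ n) :
    ∃ y > ρ, Summable fun n => q n * y ^ n := by
  obtain ⟨P, r, hr⟩ := hg
  obtain ⟨l, hl, hlx⟩ := (mem_nhdsLT_iff_exists_Ioo_subset).1 heq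
  obtain ⟨ε, hε0, hεr⟩ : ∃ ε : ℝ, 0 < ε ∧ ENNReal.ofReal ε ≤ r := by
    by_cases hrt : r = ⊤
    · exact ⟨1, one_pos, by rw [hrt]; exact le_top⟩
    · exact ⟨r.toReal, ENNReal.toReal_pos hr.r_pos.ne' hrt, by rw [ENNReal.ofReal_toReal hrt]⟩
  obtain ⟨δ, hδ0, hδ⟩ : ∃ δ : ℝ, 0 < δ ∧ δ < ρ ∧ δ < ρ - l ∧ 4 * δ < ε := by
    have hl' : l < ρ := hl
    refine ⟨min (ρ / 2) (min ((ρ - l) / 2) (ε / 8)), by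
      refine lt_min (by linarith) (lt_min (by linarith) (by linarith)), ?_, ?_, ?_⟩
    · exact (min_le_left _ _).trans_lt (by linarith)
    · exact ((min_le_right _ _).trans (min_le_left _ _)).trans_lt (by linarith)
    · have := (min_le_right (ρ / 2) _).trans (min_le_right ((ρ - l) / 2) (ε / 8))
      linarith
  obtain ⟨hδρ, hδl, hδε⟩ := hδ
  set x0 := ρ - δ with hx0
  have hx0' : 0 < x0 := by linarith
  -- Taylor expansion of the sum at x0
  let c : ℕ → ℝ := fun k => ∑' n, q n * ((n.choose k : ℝ) * x0 ^ (n - k))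
  have hF : HasFPowerSeriesAt (fun x => ∑' n, q n * x ^ n) (FormalMultilinearSeries.ofScalars ℝ c) x0 := by
    rw [hasFPowerSeriesAt_iff]
    have : ∀ᶠ y : ℝ in 𝓝 0, |y| < δ := by
      have := (continuous_abs (G := ℝ)).tendsto 0
      rw [abs_zero] at this
      exact this.eventually (gt_mem_nhds hδ0)
    filter_upwards [this] with y hy
    simp only [FormalMultilinearSeries.coeff_ofScalars]
    exact fr_taylor q hq x0 y hx0'.le (hs _ (by positivity) (by linarith))
  have hnn : (‖-δ‖₊ : ENNReal) = ENNReal.ofReal δ := by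
    rw [nnnorm_neg, ENNReal.ofReal, ← Real.toNNReal_eq_nnnorm_of_nonneg hδ0.le]
  have hch := hr.changeOrigin (y := -δ) (by
    rw [hnn]
    exact lt_of_lt_of_le ((ENNReal.ofReal_lt_ofReal_iff hε0).2 (by linarith)) hεr)
  rw [← sub_eq_add_neg, ← hx0, hnn] at hch
  have huniq := hF.eq_formalMultilinearSeries_of_eventually hch.hasFPowerSeriesAt (by
    have : Set.Ioo l ρ ∈ 𝓝 x0 := Ioo_mem_nhds (by linarith) (by linarith)
    filter_upwards [this] with x hx
    exact (hlx hx).symm)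
  have hsum := hch.hasSum (y := 2 * δ) (by
    rw [Metric.mem_eball, edist_dist, dist_zero_right, Real.norm_of_nonneg (by positivity)]
    rw [lt_tsub_iff_right, ← ENNReal.ofReal_add (by positivity) (by positivity)]
    exact lt_of_lt_of_le ((ENNReal.ofReal_lt_ofReal_iff hε0).2 (by linarith)) hεr)
  rw [← huniq] at hsum
  have hsum2 : Summable fun k => c k * (2 * δ) ^ k := by
    refine hsum.summable.congr fun k => ?_
    simp [FormalMultilinearSeries.coeff_ofScalars, mul_comm]
  refine ⟨x0 + 2 * δ, by linarith, ?_⟩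
  have hfac : ∀ k : ℕ, Summable fun n => q n * ((n.choose k : ℝ) * x0 ^ (n - k)) := by
    intro k
    have h := (fr_taylor_aux q hq x0 (δ / 2) hx0'.le
      (hs _ (by positivity) (by rw [abs_of_pos (by linarith)]; linarith))).prod_symm.prod_factor k
    have h2 := h.mul_right (((δ / 2) ^ k)⁻¹)
    refine h2.congr fun n => ?_
    have : (δ / 2) ^ k ≠ 0 := by positivity
    simp only [Prod.fst_swap, Prod.snd_swap]
    rw [mul_assoc (q n), mul_assoc (_ * _), mul_inv_cancel₀ this, mul_one]
  have hbig : Summable (fun z : ℕ × ℕ => q z.2 * ((z.2.choose z.1 : ℝ) * x0 ^ (z.2 - z.1) * (2 * δ) ^ z.1)) := by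
    rw [summable_prod_of_nonneg]
    · have he : ∀ k n : ℕ, q n * ((n.choose k : ℝ) * x0 ^ (n - k) * (2 * δ) ^ k) =
          q n * ((n.choose k : ℝ) * x0 ^ (n - k)) * (2 * δ) ^ k := fun k n => by ring
      simp only [he]
      refine ⟨fun k => (hfac k).mul_right _, ?_⟩
      refine hsum2.congr fun k => ?_
      rw [tsum_mul_right]
    · intro z
      have := hq z.2
      simp only [Pi.zero_apply]
      positivity
  have h5 := hbig.prod_symm.prod
  refine h5.congr fun n => ?_
  exact (((fr_binom n x0 (2 * δ)).mul_left (q n)).tsum_eq)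

lemma fr_logbound (q : ℕ → ℝ) (hq : ∀ n, 0 ≤ q n) (hq0 : q 0 = 1) (ρ : ℝ) (hρ : 0 < ρ) (K : ℝ)
    (hK : ∀ n : ℕ, 1 ≤ n → q n * ρ ^ n ≤ K / n) (x : ℝ) (hx : 0 ≤ x) (hxρ : x < ρ) :
    (Summable fun n => q n * x ^ n) ∧ 1 ≤ ∑' n, q n * x ^ n ∧
      ∑' n, q n * x ^ n ≤ 1 - K * Real.log (1 - x / ρ) := by
  have hlog := Real.hasSum_pow_div_log_of_abs_lt_one (x := x / ρ)
    (by rw [abs_of_nonneg (by positivity), div_lt_one hρ]; exact hxρ)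
  have hle : ∀ n : ℕ, q (n + 1) * x ^ (n + 1) ≤ K * ((x / ρ) ^ (n + 1) / ((n : ℝ) + 1)) := by
    intro n
    have h1 := hK (n + 1) (by omega)
    have h2 : q (n + 1) * x ^ (n + 1) = q (n + 1) * ρ ^ (n + 1) * (x / ρ) ^ (n + 1) := by
      rw [mul_assoc, ← mul_pow, mul_div_cancel₀ _ hρ.ne']
    rw [h2]
    calc _ ≤ K / ((n + 1 : ℕ) : ℝ) * (x / ρ) ^ (n + 1) := by gcongr
      _ = _ := by push_cast; ring
  have hnn : ∀ n : ℕ, 0 ≤ q n * x ^ n := fun n => by have := hq n; positivity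
  have hs1 : Summable fun n => q (n + 1) * x ^ (n + 1) :=
    Summable.of_nonneg_of_le (fun n => hnn _) hle (hlog.mul_left K).summable
  have hs : Summable fun n => q n * x ^ n := (summable_nat_add_iff 1).1 hs1
  have heq := hs.tsum_eq_zero_add
  rw [hq0] at heq
  refine ⟨hs, ?_, ?_⟩
  · rw [heq]
    have : 0 ≤ ∑' n, q (n + 1) * x ^ (n + 1) := tsum_nonneg (fun n => hnn (n + 1))
    simp; exact this
  · rw [heq]
    have := hs1.tsum_le_tsum hle (hlog.mul_left K).summable
    rw [(hlog.mul_left K).tsum_eq] at this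
    simp; linarith

lemma fr_core (q : ℕ → ℝ) (hq : ∀ n, 0 ≤ q n) (hq0 : q 0 = 1) (ρ : ℝ) (hρ : 0 < ρ) (K : ℝ)
    (hK : ∀ n : ℕ, 1 ≤ n → q n * ρ ^ n ≤ K / n)
    (hdiv : ∀ y > ρ, ¬ Summable fun n => q n * y ^ n)
    (U V : ℝ → ℝ) (hU : AnalyticAt ℝ U ρ) (hV : AnalyticAt ℝ V ρ)
    (hU0 : ∀ᶠ x in 𝓝[<] ρ, U x ≠ 0) (k : ℕ) (hk : k ≠ 0)
    (heq : ∀ᶠ x in 𝓝[<] ρ, U x * (∑' n, q n * x ^ n) ^ k = V x) : False := by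
  set F : ℝ → ℝ := fun x => ∑' n, q n * x ^ n with hFdef
  have hIoo : ∀ᶠ x in 𝓝[<] ρ, 0 < x ∧ x < ρ := by
    filter_upwards [Ioo_mem_nhdsLT hρ] with x hx using hx
  have hF1 : ∀ᶠ x in 𝓝[<] ρ, 1 ≤ F x := by
    filter_upwards [hIoo] with x hx
    exact (fr_logbound q hq hq0 ρ hρ K hK x hx.1.le hx.2).2.1
  have hF2 : ∀ᶠ x in 𝓝[<] ρ, F x ≤ 1 - K * Real.log (1 - x / ρ) := by
    filter_upwards [hIoo] with x hx
    exact (fr_logbound q hq hq0 ρ hρ K hK x hx.1.le hx.2).2.2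
  have hle := nhdsWithin_le_nhds (a := ρ) (s := Set.Iio ρ)
  obtain ⟨α, U1, hU1, hU1n, hUe⟩ := hU.exists_eventuallyEq_pow_smul_nonzero_iff.2 (by
    intro h
    obtain ⟨x, h1, h2⟩ := ((Filter.Eventually.filter_mono hle h).and hU0).exists
    exact h2 h1)
  obtain ⟨β, V1, hV1, hV1n, hVe⟩ := hV.exists_eventuallyEq_pow_smul_nonzero_iff.2 (by
    intro h
    obtain ⟨x, h1, h2, h3, h4⟩ := ((Filter.Eventually.filter_mono hle h).and (hU0.and (heq.and hF1))).exists
    rw [h1] at h3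
    exact mul_ne_zero h2 (pow_ne_zero _ (by linarith : F x ≠ 0)) h3)
  have hU1e : ∀ᶠ x in 𝓝 ρ, U1 x ≠ 0 := hU1.continuousAt.eventually_ne hU1n
  have key : ∀ᶠ x in 𝓝[<] ρ, (x - ρ) ^ α * F x ^ k = (x - ρ) ^ β * (V1 x / U1 x) := by
    filter_upwards [hle hUe, hle hVe, hle hU1e, heq] with x h1 h2 h3 h4
    rw [h1, h2] at h4
    simp only [smul_eq_mul] at h4
    field_simp
    linarith
  have hW : AnalyticAt ℝ (fun x => V1 x / U1 x) ρ := hV1.div hU1 hU1n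
  rcases lt_or_ge β α with hlt | hge
  · -- pole: contradicts logarithmic growth
    have key2 : ∀ᶠ x in 𝓝[<] ρ, (x - ρ) ^ (α - β) * F x ^ k = V1 x / U1 x := by
      filter_upwards [key, hIoo] with x h1 h2
      have h3 : (x - ρ) ^ β ≠ 0 := pow_ne_zero _ (by linarith [h2.2])
      apply mul_left_cancel₀ h3
      rw [← h1, ← mul_assoc, ← pow_add, Nat.add_sub_cancel' hlt.le]
    have hlim : Tendsto (fun x => (x - ρ) ^ (α - β) * F x ^ k) (𝓝[<] ρ) (𝓝 (V1 ρ / U1 ρ)) :=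
      (hW.continuousAt.tendsto.mono_left hle).congr' (key2.mono fun x hx => hx.symm)
    have hu : Tendsto (fun x : ℝ => 1 - x / ρ) (𝓝[<] ρ) (𝓝[>] 0) := by
      rw [tendsto_nhdsWithin_iff]
      constructor
      · have : ContinuousAt (fun x : ℝ => 1 - x / ρ) ρ := by fun_prop
        have h := this.tendsto.mono_left hle
        simpa [hρ.ne'] using h
      · filter_upwards [hIoo] with x hx
        have := (div_lt_one hρ).2 hx.2
        simp only [Set.mem_Ioi]; linarith
    have hzero : Tendsto (fun x => (x - ρ) ^ (α - β) * F x ^ k) (𝓝[<] ρ) (𝓝 0) := by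
      have hr : (0 : ℝ) < 1 / k := by positivity
      have h1 : Tendsto (fun u : ℝ => u ^ (1 / k : ℝ) - K * (Real.log u * u ^ (1 / k : ℝ))) (𝓝[>] 0) (𝓝 0) := by
        have ha := tendsto_log_mul_rpow_nhdsGT_zero hr
        have hb : Tendsto (fun u : ℝ => u ^ (1 / k : ℝ)) (𝓝[>] 0) (𝓝 0) := by
          have := (Real.continuousAt_rpow_const 0 (1 / k : ℝ) (Or.inr hr.le)).tendsto
          rw [Real.zero_rpow hr.ne'] at this
          exact this.mono_left nhdsWithin_le_nhds
        simpa using hb.sub (ha.const_mul K)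
      have h2 := ((h1.comp hu).pow k)
      rw [zero_pow hk] at h2
      have h3 : Tendsto (fun x : ℝ => ρ * |x - ρ| ^ (α - β - 1)) (𝓝[<] ρ) (𝓝 (ρ * |ρ - ρ| ^ (α - β - 1))) := by
        have : ContinuousAt (fun x : ℝ => ρ * |x - ρ| ^ (α - β - 1)) ρ := by fun_prop
        exact this.tendsto.mono_left hle
      have h4 := h3.mul h2
      rw [mul_zero] at h4
      rw [tendsto_zero_iff_abs_tendsto_zero]
      refine tendsto_of_tendsto_of_tendsto_of_le_of_le' tendsto_const_nhds h4
        (Eventually.of_forall fun x => abs_nonneg _) ?_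
      filter_upwards [hIoo, hF1, hF2] with x hx hx1 hx2
      have hux : 0 < 1 - x / ρ := by have := (div_lt_one hρ).2 hx.2; linarith
      simp only [Function.comp_apply]
      rw [abs_mul, abs_pow, abs_pow, abs_of_nonneg (by linarith : 0 ≤ F x)]
      have e1 : |x - ρ| = ρ * (1 - x / ρ) := by
        rw [abs_of_neg (by linarith [hx.2])]; field_simp; ring
      have e2 : ((1 - x / ρ) ^ (1 / k : ℝ)) ^ k = 1 - x / ρ := by
        rw [← Real.rpow_natCast, ← Real.rpow_mul hux.le, one_div_mul_cancel (by exact_mod_cast hk),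
          Real.rpow_one]
      have e3 : ((1 - x / ρ) ^ (1 / k : ℝ) - K * (Real.log (1 - x / ρ) * (1 - x / ρ) ^ (1 / k : ℝ))) ^ k
          = (1 - x / ρ) * (1 - K * Real.log (1 - x / ρ)) ^ k := by
        have : ((1 - x / ρ) ^ (1 / k : ℝ) - K * (Real.log (1 - x / ρ) * (1 - x / ρ) ^ (1 / k : ℝ)))
          = (1 - x / ρ) ^ (1 / k : ℝ) * (1 - K * Real.log (1 - x / ρ)) := by ring
        rw [this, mul_pow, e2]
      rw [e3]
      have e4 : |x - ρ| ^ (α - β) = |x - ρ| ^ (α - β - 1) * |x - ρ| := by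
        rw [← pow_succ]; congr 1; omega
      rw [e4]
      calc |x - ρ| ^ (α - β - 1) * |x - ρ| * F x ^ k
          ≤ |x - ρ| ^ (α - β - 1) * |x - ρ| * (1 - K * Real.log (1 - x / ρ)) ^ k := by
            gcongr
        _ = |x - ρ| ^ (α - β - 1) * (ρ * (1 - x / ρ)) * (1 - K * Real.log (1 - x / ρ)) ^ k := by
            rw [e1]
        _ = _ := by ring
    exact div_ne_zero hV1n hU1n (tendsto_nhds_unique hlim hzero)
  · set W : ℝ → ℝ := fun x => (x - ρ) ^ (β - α) * (V1 x / U1 x) with hWdef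
    have hWa : AnalyticAt ℝ W ρ :=
      ((analyticAt_id.sub analyticAt_const).pow _).mul hW
    have key2 : ∀ᶠ x in 𝓝[<] ρ, F x ^ k = W x := by
      filter_upwards [key, hIoo] with x h1 h2
      have h3 : (x - ρ) ^ α ≠ 0 := pow_ne_zero _ (by linarith [h2.2])
      apply mul_left_cancel₀ h3
      rw [h1, hWdef, ← mul_assoc, ← pow_add, Nat.add_sub_cancel' hge]
    have hWρ : 1 ≤ W ρ := by
      refine ge_of_tendsto (hWa.continuousAt.tendsto.mono_left hle) ?_
      filter_upwards [key2, hF1] with x h1 h2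
      rw [← h1]
      exact one_le_pow₀ h2
    have hga : AnalyticAt ℝ (fun x => Real.exp (Real.log (W x) * (1 / k : ℝ))) ρ :=
      ((hWa.log (by linarith)).mul analyticAt_const).rexp
    obtain ⟨y, hy, hsy⟩ := fr_pringsheim q hq ρ hρ
      (fun x h1 h2 => (fr_logbound q hq hq0 ρ hρ K hK x h1 h2).1) _ hga (by
        filter_upwards [key2, hF1] with x h1 h2
        rw [← h1, Real.log_pow, mul_comm (k : ℝ), mul_assoc, mul_one_div_cancel (by exact_mod_cast hk),
          mul_one, Real.exp_log (by linarith)])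
    exact hdiv y hy hsy
end PartC

section PartD
open Filter Topology

def frEv (x : ℝ) (G : PowerSeries ℝ) (y : ℝ) : Prop :=
  (Summable fun n => ‖PowerSeries.coeff n G * x ^ n‖) ∧ ∑' n, PowerSeries.coeff n G * x ^ n = y

lemma frEv_mul {x : ℝ} {G H : PowerSeries ℝ} {y z : ℝ} (hG : frEv x G y) (hH : frEv x H z) :
    frEv x (G * H) (y * z) := by
  have key : ∀ n, PowerSeries.coeff n (G * H) * x ^ n =
      ∑ kl ∈ Finset.HasAntidiagonal.antidiagonal n, (PowerSeries.coeff kl.1 G * x ^ kl.1) * (PowerSeries.coeff kl.2 H * x ^ kl.2) := by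
    intro n
    rw [PowerSeries.coeff_mul, Finset.sum_mul]
    refine Finset.sum_congr rfl fun kl hkl => ?_
    rw [← Finset.HasAntidiagonal.mem_antidiagonal.1 hkl, pow_add]
    ring
  have hs := summable_norm_sum_mul_antidiagonal_of_summable_norm
    (f := fun n => PowerSeries.coeff n G * x ^ n) (g := fun n => PowerSeries.coeff n H * x ^ n) hG.1 hH.1
  have ht := tsum_mul_tsum_eq_tsum_sum_antidiagonal_of_summable_norm
    (f := fun n => PowerSeries.coeff n G * x ^ n) (g := fun n => PowerSeries.coeff n H * x ^ n) hG.1 hH.1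
  constructor
  · exact hs.congr fun n => by rw [key n]
  · rw [tsum_congr key, ← ht, hG.2, hH.2]

lemma frEv_poly (x : ℝ) (a : Polynomial ℝ) : frEv x (a : PowerSeries ℝ) (a.eval x) := by
  have h0 : ∀ n ∉ a.support, a.coeff n * x ^ n = 0 := by
    intro n hn
    rw [Polynomial.notMem_support_iff.1 hn, zero_mul]
  constructor
  · simp only [Polynomial.coeff_coe]
    refine summable_of_ne_finset_zero (s := a.support) fun n hn => ?_
    rw [h0 n hn, norm_zero]
  · simp only [Polynomial.coeff_coe]
    rw [tsum_eq_sum h0, Polynomial.eval_eq_sum]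
    rfl

lemma frEv_one (x : ℝ) : frEv x 1 1 := by
  have := frEv_poly x 1
  simpa using this

lemma frEv_pow {x : ℝ} {G : PowerSeries ℝ} {y : ℝ} (hG : frEv x G y) (k : ℕ) :
    frEv x (G ^ k) (y ^ k) := by
  induction k with
  | zero => simpa using frEv_one x
  | succ k ih => rw [pow_succ, pow_succ]; exact frEv_mul ih hG

lemma frEv_prod {ι : Type*} (s : Finset ι) {x : ℝ} (G : ι → PowerSeries ℝ) (y : ι → ℝ)
    (h : ∀ i ∈ s, frEv x (G i) (y i)) : frEv x (∏ i ∈ s, G i) (∏ i ∈ s, y i) := by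
  classical
  induction s using Finset.induction_on with
  | empty => simpa using frEv_one x
  | insert i s hi ih =>
    rw [Finset.prod_insert hi, Finset.prod_insert hi]
    exact frEv_mul (h i (Finset.mem_insert_self _ _)) (ih fun j hj => h j (Finset.mem_insert_of_mem hj))

lemma fr_ser_analytic (q : ℕ → ℝ) (hq : ∀ n, 0 ≤ q n) (ρ : ℝ)
    (hs : ∀ x, 0 ≤ x → x < ρ → Summable fun n => q n * x ^ n) (x0 : ℝ) (hx0 : 0 < x0) (hxρ : x0 < ρ) :
    AnalyticAt ℝ (fun x => ∑' n, q n * x ^ n) x0 := by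
  have hF : HasFPowerSeriesAt (fun x => ∑' n, q n * x ^ n) (FormalMultilinearSeries.ofScalars ℝ
      (fun k => ∑' n, q n * ((n.choose k : ℝ) * x0 ^ (n - k)))) x0 := by
    rw [hasFPowerSeriesAt_iff]
    have : ∀ᶠ y : ℝ in 𝓝 0, |y| < ρ - x0 := by
      have := (continuous_abs (G := ℝ)).tendsto 0
      rw [abs_zero] at this
      exact this.eventually (gt_mem_nhds (by linarith))
    filter_upwards [this] with y hy
    simp only [FormalMultilinearSeries.coeff_ofScalars]
    exact fr_taylor q hq x0 y hx0.le (hs _ (by positivity) (by linarith))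
  exact hF.analyticAt

lemma fr_asm {ι : Type*} [Fintype ι] (q : ι → ℕ → ℝ) (hq : ∀ i n, 0 ≤ q i n)
    (hq0 : ∀ i, q i 0 = 1) (ρ : ι → ℝ) (hρ : ∀ i, 0 < ρ i) (K : ι → ℝ)
    (hK : ∀ i, ∀ n : ℕ, 1 ≤ n → q i n * ρ i ^ n ≤ K i / n)
    (hdiv : ∀ i, ∀ y > ρ i, ¬ Summable fun n => q i n * y ^ n)
    (μ ν : ι → ℕ) (i : ι) (hμ : μ i ≠ 0) (hν : ν i = 0)
    (hj : ∀ j, j ≠ i → μ j ≠ 0 ∨ ν j ≠ 0 → ρ i < ρ j)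
    (a b : Polynomial ℝ) (ha : a ≠ 0)
    (hrel : (a : PowerSeries ℝ) * ∏ i, (PowerSeries.mk (q i)) ^ μ i =
      (b : PowerSeries ℝ) * ∏ i, (PowerSeries.mk (q i)) ^ ν i) : False := by
  classical
  have hlog := fun j x => fr_logbound (q j) (hq j) (hq0 j) (ρ j) (hρ j) (K j) (hK j) x
  let F : ι → ℝ → ℝ := fun j x => ∑' n, q j n * x ^ n
  have hev : ∀ j x, 0 ≤ x → x < ρ j → frEv x (PowerSeries.mk (q j)) (F j x) := by
    intro j x h1 h2
    constructor
    · simp only [PowerSeries.coeff_mk]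
      exact (hlog j x h1 h2).1.norm
    · simp only [PowerSeries.coeff_mk]; rfl
  have hevp : ∀ (k : ℕ) j x, 0 ≤ x → (k ≠ 0 → x < ρ j) →
      frEv x (PowerSeries.mk (q j) ^ k) (F j x ^ k) := by
    intro k j x h1 h2
    by_cases hk : k = 0
    · subst hk; simpa using frEv_one x
    · exact frEv_pow (hev j x h1 (h2 hk)) k
  have han : ∀ (k : ℕ) j, (k ≠ 0 → ρ i < ρ j) → AnalyticAt ℝ (fun x => F j x ^ k) (ρ i) := by
    intro k j h2
    by_cases hk : k = 0
    · subst hk; simpa using analyticAt_const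
    · exact (fr_ser_analytic (q j) (hq j) (ρ j) (fun x h1 h2 => (hlog j x h1 h2).1) (ρ i) (hρ i) (h2 hk)).pow k
  have hIoo : ∀ᶠ x in 𝓝[<] ρ i, 0 < x ∧ x < ρ i := by
    filter_upwards [Ioo_mem_nhdsLT (hρ i)] with x hx using hx
  have hpoly : ∀ c : Polynomial ℝ, AnalyticAt ℝ (fun x => c.eval x) (ρ i) := fun c => by
    simpa using AnalyticAt.aeval_polynomial (analyticAt_id (𝕜 := ℝ) (z := ρ i)) c
  refine fr_core (q i) (hq i) (hq0 i) (ρ i) (hρ i) (K i) (hK i) (hdiv i)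
    (fun x => a.eval x * ∏ j ∈ Finset.univ.erase i, F j x ^ μ j)
    (fun x => b.eval x * ∏ j, F j x ^ ν j) ?_ ?_ ?_ (μ i) hμ ?_
  · refine (hpoly a).mul ?_
    refine Finset.analyticAt_fun_prod _ fun j hj' => han _ _ fun h => ?_
    exact hj j (Finset.ne_of_mem_erase hj') (Or.inl h)
  · refine (hpoly b).mul ?_
    refine Finset.analyticAt_fun_prod _ fun j _ => han _ _ fun h => ?_
    exact hj j (fun h' => h (h' ▸ hν)) (Or.inr h)
  · have hroot : ∀ᶠ x in 𝓝[<] ρ i, a.eval x ≠ 0 := by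
      have h1 : ∀ᶠ x in 𝓝[≠] ρ i, a.eval x ≠ 0 := by
        have hfin : {x : ℝ | a.eval x = 0}.Finite := by
          refine (a.roots.toFinset.finite_toSet).subset fun x hx => ?_
          simpa [ha] using hx
        have h2 := (hfin.subset (Set.sdiff_subset (t := {ρ i}))).isClosed.isOpen_compl.mem_nhds
          (x := ρ i) (by simp)
        filter_upwards [nhdsWithin_le_nhds h2, self_mem_nhdsWithin] with x h3 h4 h5
        exact h3 ⟨h5, h4⟩
      exact h1.filter_mono (nhdsWithin_mono _ fun x hx => ne_of_lt hx)
    filter_upwards [hroot, hIoo] with x h1 h2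
    refine mul_ne_zero h1 (Finset.prod_ne_zero_iff.2 fun j hj' => ?_)
    by_cases h : μ j = 0
    · rw [h]; simp
    · have := hj j (Finset.ne_of_mem_erase hj') (Or.inl h)
      have := (hlog j x h2.1.le (by linarith [h2.2])).2.1
      exact pow_ne_zero _ (by show (∑' n, q j n * x ^ n) ≠ 0; linarith)
  · filter_upwards [hIoo] with x hx
    have h1 := frEv_mul (frEv_poly x a) (frEv_prod Finset.univ (fun j => PowerSeries.mk (q j) ^ μ j)
      (fun j => F j x ^ μ j) fun j _ => hevp _ _ _ hx.1.le fun h => by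
        by_cases hji : j = i
        · rw [hji]; exact hx.2
        · exact hx.2.trans (hj j hji (Or.inl h)))
    have h2 := frEv_mul (frEv_poly x b) (frEv_prod Finset.univ (fun j => PowerSeries.mk (q j) ^ ν j)
      (fun j => F j x ^ ν j) fun j _ => hevp _ _ _ hx.1.le fun h => by
        by_cases hji : j = i
        · rw [hji]; exact hx.2
        · exact hx.2.trans (hj j hji (Or.inr h)))
    rw [hrel] at h1
    have h3 := h1.2.symm.trans h2.2
    rw [← Finset.mul_prod_erase Finset.univ _ (Finset.mem_univ i)] at h3
    rw [← h3]
    show _ * _ * F i x ^ μ i = _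
    ring

lemma fr_analytic {ι : Type*} [Fintype ι] (q : ι → ℕ → ℝ) (hq : ∀ i n, 0 ≤ q i n)
    (hq0 : ∀ i, q i 0 = 1) (ρ : ι → ℝ) (hρ : ∀ i, 0 < ρ i) (hinj : Function.Injective ρ) (K : ι → ℝ)
    (hK : ∀ i, ∀ n : ℕ, 1 ≤ n → q i n * ρ i ^ n ≤ K i / n)
    (hdiv : ∀ i, ∀ y > ρ i, ¬ Summable fun n => q i n * y ^ n)
    (m m' : ι → ℕ) (hm : m ≠ m')
    (a b : Polynomial ℝ) (ha : a ≠ 0) (hb : b ≠ 0)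
    (hrel : (a : PowerSeries ℝ) * ∏ i, (PowerSeries.mk (q i)) ^ m i =
      (b : PowerSeries ℝ) * ∏ i, (PowerSeries.mk (q i)) ^ m' i) : False := by
  classical
  have hne : ∀ i, PowerSeries.mk (q i) ≠ 0 := by
    intro i h
    have := congrArg (PowerSeries.coeff 0) h
    rw [PowerSeries.coeff_mk, hq0] at this
    simp at this
  have hrel2 : (a : PowerSeries ℝ) * ∏ i, (PowerSeries.mk (q i)) ^ (m i - m' i) =
      (b : PowerSeries ℝ) * ∏ i, (PowerSeries.mk (q i)) ^ (m' i - m i) := by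
    have h0 : ∏ i, (PowerSeries.mk (q i)) ^ min (m i) (m' i) ≠ 0 :=
      Finset.prod_ne_zero_iff.2 fun i _ => pow_ne_zero _ (hne i)
    apply mul_right_cancel₀ h0
    rw [mul_assoc, mul_assoc, ← Finset.prod_mul_distrib, ← Finset.prod_mul_distrib]
    simp only [← pow_add]
    have e1 : ∀ i, m i - m' i + min (m i) (m' i) = m i := fun i => by omega
    have e2 : ∀ i, m' i - m i + min (m i) (m' i) = m' i := fun i => by omega
    simp only [e1, e2]
    exact hrel
  obtain ⟨i, hi, hmin⟩ := Finset.exists_min_image (Finset.univ.filter fun i => m i ≠ m' i) ρ (by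
    obtain ⟨i, hi⟩ := Function.ne_iff.1 hm
    exact ⟨i, by simpa using hi⟩)
  simp only [Finset.mem_filter, Finset.mem_univ, true_and] at hi hmin
  have hj : ∀ j, j ≠ i → m j ≠ m' j → ρ i < ρ j := fun j h1 h2 =>
    lt_of_le_of_ne (hmin j h2) fun h => h1 (hinj h).symm
  rcases lt_or_gt_of_ne hi with h | h
  · exact fr_asm q hq hq0 ρ hρ K hK hdiv _ _ i (by omega) (by omega)
      (fun j h1 h2 => hj j h1 (by omega)) b a hb hrel2.symm
  · exact fr_asm q hq hq0 ρ hρ K hK hdiv _ _ i (by omega) (by omega)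
      (fun j h1 h2 => hj j h1 (by omega)) a b ha hrel2

end PartD

section PartE
open Filter Topology

lemma fr_sum_eq {κ κ' : Type*} [Fintype κ] [Fintype κ'] (e : κ → ℕ) (f : κ' → ℕ) (QZ : ℕ → ℤ)
    (hQ : ∀ n, (QZ n : ℚ) =
      (∏ k, (Nat.factorial (e k * n) : ℚ)) / ∏ k, (Nat.factorial (f k * n) : ℚ))
    (h0 : QZ 0 = 1)
    (hl : ∀ p : ℕ, p.Prime → ∀ a n : ℕ, a < p → QZ (a + n * p) ≡ QZ a * QZ n [ZMOD (p : ℤ)]) :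
    ∑ k, e k = ∑ k, f k := by
  have hmul : ∀ n, (QZ n).natAbs * ∏ k, Nat.factorial (f k * n) = ∏ k, Nat.factorial (e k * n) := by
    intro n
    have h1 := hQ n
    have hne : (∏ k, (Nat.factorial (f k * n) : ℚ)) ≠ 0 :=
      Finset.prod_ne_zero_iff.2 fun k _ => by exact_mod_cast Nat.factorial_ne_zero _
    rw [eq_div_iff hne] at h1
    have h2 : QZ n * ((∏ k, Nat.factorial (f k * n) : ℕ) : ℤ) = ((∏ k, Nat.factorial (e k * n) : ℕ) : ℤ) := by
      exact_mod_cast h1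
    have h3 := congrArg Int.natAbs h2
    rwa [Int.natAbs_mul, Int.natAbs_natCast, Int.natAbs_natCast] at h3
  obtain ⟨p, hpgt, hp⟩ := Nat.exists_infinite_primes (∑ k, e k + ∑ k, f k + 1)
  have : Fact p.Prime := ⟨hp⟩
  have he : ∀ k, e k < p := fun k => by
    have := Finset.single_le_sum (f := e) (fun _ _ => Nat.zero_le _) (Finset.mem_univ k)
    omega
  have hf : ∀ k, f k < p := fun k => by
    have := Finset.single_le_sum (f := f) (fun _ _ => Nat.zero_le _) (Finset.mem_univ k)
    omega
  have hnd1 : ¬ p ∣ (QZ 1).natAbs := by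
    intro h
    have h2 : p ∣ ∏ k, Nat.factorial (e k * 1) := (hmul 1) ▸ h.mul_right _
    obtain ⟨k, _, hk⟩ := (hp.prime.dvd_finsetProd_iff _).1 h2
    rw [hp.dvd_factorial, mul_one] at hk
    exact absurd (he k) (by omega)
  have hnd : ¬ p ∣ (QZ p).natAbs := by
    intro h
    apply hnd1
    have h1 := hl p hp 0 1 hp.pos
    rw [h0, one_mul, zero_add, one_mul] at h1
    rw [← Int.natCast_dvd] at h ⊢
    exact h1.dvd_iff.1 h
  have hval : ∀ d : ℕ, d < p → (Nat.factorial (d * p)).factorization p = d := by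
    intro d hd
    rw [Nat.factorization_def _ hp, mul_comm, padicValNat_factorial_mul,
      padicValNat.eq_zero_of_not_dvd, zero_add]
    rw [hp.dvd_factorial]; omega
  have h := congrArg (fun N : ℕ => N.factorization p) (hmul p)
  have hQne : (QZ p).natAbs ≠ 0 := fun h => hnd (h ▸ dvd_zero _)
  rw [Nat.factorization_mul hQne (Finset.prod_ne_zero_iff.2 fun k _ => Nat.factorial_ne_zero _),
    Nat.factorization_prod (fun k _ => Nat.factorial_ne_zero _),
    Nat.factorization_prod (fun k _ => Nat.factorial_ne_zero _)] at h
  simp only [Finsupp.add_apply, Finsupp.finsetSum_apply, hval _ (he _), hval _ (hf _),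
    Nat.factorization_eq_zero_of_not_dvd hnd, zero_add] at h
  exact h.symm

noncomputable def frT (n : ℕ) : ℝ := (n / Real.exp 1) ^ n

lemma frT_pos {n : ℕ} (hn : 1 ≤ n) : 0 < frT n := by
  have : (0 : ℝ) < n := by exact_mod_cast hn
  unfold frT; positivity

lemma fr_fact_bound (d : ℕ) (hd : 0 < d) : ∃ A B : ℝ, 0 < A ∧ 0 < B ∧ ∀ n : ℕ, 1 ≤ n →
    A * (√n * ((d : ℝ) ^ d) ^ n * frT n ^ d) ≤ (Nat.factorial (d * n) : ℝ) ∧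
    (Nat.factorial (d * n) : ℝ) ≤ B * (√n * ((d : ℝ) ^ d) ^ n * frT n ^ d) := by
  have hd' : (0 : ℝ) < d := by exact_mod_cast hd
  refine ⟨√Real.pi * √(2 * d), Stirling.stirlingSeq 1 * √(2 * d), by positivity, ?_, ?_⟩
  · have := Stirling.stirlingSeq'_pos 0
    simp only [zero_add] at this
    positivity
  intro n hn
  have hn' : (0 : ℝ) < n := by exact_mod_cast hn
  have hT := frT_pos hn
  have hdn : d * n ≠ 0 := by positivity
  have hfac : (Nat.factorial (d * n) : ℝ) = Stirling.stirlingSeq (d * n) * √(2 * d) *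
      (√n * ((d : ℝ) ^ d) ^ n * frT n ^ d) := by
    have h1 : √(2 * d) * √(n : ℝ) = √(2 * ((d * n : ℕ) : ℝ)) := by
      rw [← Real.sqrt_mul (by positivity)]; push_cast; ring_nf
    have h2 : ((d : ℝ) ^ d) ^ n * frT n ^ d = (((d * n : ℕ) : ℝ) / Real.exp 1) ^ (d * n) := by
      unfold frT
      rw [← pow_mul, ← pow_mul, mul_comm n d, ← mul_pow]
      push_cast
      rw [mul_div_assoc]
    rw [Stirling.stirlingSeq, mul_assoc, mul_assoc (√(n : ℝ)), h2, ← mul_assoc (√(2 * (d : ℝ))), h1,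
      div_mul_cancel₀]
    positivity
  rw [hfac]
  have hlow := Stirling.sqrt_pi_le_stirlingSeq hdn
  have hup : Stirling.stirlingSeq (d * n) ≤ Stirling.stirlingSeq 1 := by
    have := Stirling.stirlingSeq'_antitone (Nat.zero_le (d * n - 1))
    simp only [Function.comp_apply, Nat.succ_eq_add_one, zero_add] at this
    rwa [Nat.sub_add_cancel (by omega)] at this
  constructor <;> gcongr

lemma fr_prod_bound {κ : Type*} [Fintype κ] (d : κ → ℕ) (hd : ∀ k, 0 < d k) :
    ∃ A B : ℝ, 0 < A ∧ 0 < B ∧ ∀ n : ℕ, 1 ≤ n →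
    A * (√n ^ Fintype.card κ * (∏ k, (d k : ℝ) ^ d k) ^ n * frT n ^ (∑ k, d k)) ≤
      (∏ k, (Nat.factorial (d k * n) : ℝ)) ∧
    (∏ k, (Nat.factorial (d k * n) : ℝ)) ≤
      B * (√n ^ Fintype.card κ * (∏ k, (d k : ℝ) ^ d k) ^ n * frT n ^ (∑ k, d k)) := by
  choose A B hA hB h using fun k => fr_fact_bound (d k) (hd k)
  refine ⟨∏ k, A k, ∏ k, B k, Finset.prod_pos fun k _ => hA k, Finset.prod_pos fun k _ => hB k, ?_⟩
  intro n hn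
  have hT := frT_pos hn
  have key : √(n : ℝ) ^ Fintype.card κ * (∏ k, (d k : ℝ) ^ d k) ^ n * frT n ^ (∑ k, d k) =
      ∏ k, (√n * ((d k : ℝ) ^ d k) ^ n * frT n ^ d k) := by
    rw [Finset.prod_mul_distrib, Finset.prod_mul_distrib, Finset.prod_const, Finset.prod_pow,
      Finset.prod_pow_eq_pow_sum, Finset.card_univ]
  rw [key, ← Finset.prod_mul_distrib, ← Finset.prod_mul_distrib]
  constructor
  · refine Finset.prod_le_prod (fun k _ => ?_) fun k _ => (h k n hn).1
    have := hA k
    positivity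
  · exact Finset.prod_le_prod (fun k _ => by positivity) fun k _ => (h k n hn).2

lemma fr_ratio_bound {κ κ' : Type*} [Fintype κ] [Fintype κ'] (e : κ → ℕ) (f : κ' → ℕ)
    (he : ∀ k, 0 < e k) (hf : ∀ k, 0 < f k) (hcard : Fintype.card κ + 2 ≤ Fintype.card κ')
    (hsum : ∑ k, e k = ∑ k, f k) (C : ℝ)
    (hC : C = (∏ k, (e k : ℝ) ^ (e k)) / ∏ k, (f k : ℝ) ^ (f k)) (q : ℕ → ℝ)
    (hq : ∀ n, q n = (∏ k, (Nat.factorial (e k * n) : ℝ)) / ∏ k, (Nat.factorial (f k * n) : ℝ)) :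
    0 < C ∧ (∃ K : ℝ, ∀ n : ℕ, 1 ≤ n → q n * C⁻¹ ^ n ≤ K / n) ∧
      ∀ y > C⁻¹, ¬ Summable fun n => q n * y ^ n := by
  obtain ⟨A, B, hA, hB, hE⟩ := fr_prod_bound e he
  obtain ⟨A', B', hA', hB', hF⟩ := fr_prod_bound f hf
  have hPe : 0 < ∏ k, (e k : ℝ) ^ (e k) := Finset.prod_pos fun k _ => by
    have : (0 : ℝ) < e k := by exact_mod_cast he k
    positivity
  have hPf : 0 < ∏ k, (f k : ℝ) ^ (f k) := Finset.prod_pos fun k _ => by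
    have : (0 : ℝ) < f k := by exact_mod_cast hf k
    positivity
  set Pe := ∏ k, (e k : ℝ) ^ (e k)
  set Pf := ∏ k, (f k : ℝ) ^ (f k)
  set u := Fintype.card κ
  set v := Fintype.card κ'
  have hC0 : 0 < C := by rw [hC]; positivity
  have hCn : ∀ n : ℕ, C⁻¹ ^ n = Pf ^ n / Pe ^ n := fun n => by rw [hC, inv_div, div_pow]
  have hDpos : ∀ n : ℕ, 0 < ∏ k, (Nat.factorial (f k * n) : ℝ) := fun n =>
    Finset.prod_pos fun k _ => by exact_mod_cast Nat.factorial_pos _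
  refine ⟨hC0, ⟨B / A', fun n hn => ?_⟩, fun y hy hs => ?_⟩
  · have hn' : (0 : ℝ) < n := by exact_mod_cast hn
    have hn1 : (1 : ℝ) ≤ n := by exact_mod_cast hn
    have hT := frT_pos hn
    have hsq : 1 ≤ √(n : ℝ) := Real.one_le_sqrt.2 hn1
    have hD := hDpos n
    have h3 : √(n : ℝ) ^ u * n ≤ √(n : ℝ) ^ v := by
      calc √(n : ℝ) ^ u * n = √(n : ℝ) ^ (u + 2) := by rw [pow_add, Real.sq_sqrt hn'.le]
        _ ≤ _ := pow_le_pow_right₀ hsq hcard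
    have hE1 := (hE n hn).2
    have hF1 := (hF n hn).1
    rw [hsum] at hE1
    rw [hq, hCn, div_mul_div_comm, div_div, div_le_div_iff₀ (by positivity) (by positivity)]
    set E := ∏ k, (Nat.factorial (e k * n) : ℝ)
    set D := ∏ k, (Nat.factorial (f k * n) : ℝ)
    set S := ∑ k, f k
    calc E * Pf ^ n * (A' * n) ≤ (B * (√n ^ u * Pe ^ n * frT n ^ S)) * Pf ^ n * (A' * n) := by gcongr
      _ = B * Pe ^ n * (A' * ((√n ^ u * n) * Pf ^ n * frT n ^ S)) := by ring
      _ ≤ B * Pe ^ n * (A' * (√n ^ v * Pf ^ n * frT n ^ S)) := by gcongr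
      _ ≤ B * Pe ^ n * D := by gcongr
      _ = B * (D * Pe ^ n) := by ring
  · have hy0 : 0 < y := lt_trans (by positivity) hy
    have hCy : 1 < C * y := by
      have := mul_lt_mul_of_pos_left hy hC0
      rwa [mul_inv_cancel₀ hC0.ne'] at this
    have ht := hs.tendsto_atTop_zero.mul (tendsto_pow_const_div_const_pow_of_one_lt v hCy)
    rw [mul_zero] at ht
    have hge : A / B' ≤ 0 := by
      refine ge_of_tendsto ht ?_
      filter_upwards [eventually_ge_atTop 1] with n hn
      have hn' : (0 : ℝ) < n := by exact_mod_cast hn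
      have hn1 : (1 : ℝ) ≤ n := by exact_mod_cast hn
      have hT := frT_pos hn
      have hsq : 1 ≤ √(n : ℝ) := Real.one_le_sqrt.2 hn1
      have hsq2 : √(n : ℝ) ≤ n := Real.sqrt_le_iff.2 ⟨hn'.le, by nlinarith⟩
      have hD := hDpos n
      have hE1 := (hE n hn).1
      have hF1 := (hF n hn).2
      rw [hsum] at hE1
      have e1 : q n * y ^ n * ((n : ℝ) ^ v / (C * y) ^ n) = q n * n ^ v * C⁻¹ ^ n := by
        rw [mul_pow, inv_pow]
        field_simp
      rw [e1, hq, hCn, div_mul_eq_mul_div, div_mul_div_comm, div_le_div_iff₀ hB' (by positivity)]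
      set E := ∏ k, (Nat.factorial (e k * n) : ℝ)
      set D := ∏ k, (Nat.factorial (f k * n) : ℝ)
      set S := ∑ k, f k
      have h1 : (1 : ℝ) ≤ √(n : ℝ) ^ u := one_le_pow₀ hsq
      calc A * (D * Pe ^ n) ≤ A * ((B' * (√n ^ v * Pf ^ n * frT n ^ S)) * Pe ^ n) := by gcongr
        _ ≤ A * ((B' * ((n : ℝ) ^ v * Pf ^ n * frT n ^ S)) * Pe ^ n) := by gcongr
        _ = (A * (1 * Pe ^ n * frT n ^ S)) * n ^ v * Pf ^ n * B' := by ring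
        _ ≤ (A * (√n ^ u * Pe ^ n * frT n ^ S)) * n ^ v * Pf ^ n * B' := by gcongr
        _ ≤ E * n ^ v * Pf ^ n * B' := by gcongr
    have : 0 < A / B' := by positivity
    linarith

end PartE


/-- Let `e_i`, `f_i` (for `1 ≤ i ≤ s`) be disjoint tuples of positive
integers with `v_i − u_i ≥ 2`, pairwise distinct constants
`C_{e_i,f_i} = ∏ e^e / ∏ f^f`, and integer-valued factorial ratio sequences
`Q_{e_i,f_i}(n) = ∏(e_{i,k}n)!/∏(f_{i,k}n)!` satisfying the `p`-Lucas property for all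
primes `p`. Then the generating series `F_{e_i,f_i}(z) = ∑ Q_{e_i,f_i}(n) zⁿ` are
algebraically independent over `ℂ(z)`. -/
theorem factorial_ratio_series_algebraically_independent
    (s : ℕ) (hs : 0 < s) (u v : Fin s → ℕ)
    (e : (i : Fin s) → Fin (u i) → ℕ) (f : (i : Fin s) → Fin (v i) → ℕ)
    (hepos : ∀ i k, 0 < e i k) (hfpos : ∀ i k, 0 < f i k)
    (hdisj : ∀ i k l, e i k ≠ f i l)
    (hvu : ∀ i, u i + 2 ≤ v i)
    (C : Fin s → ℚ)
    (hC : C = fun i => (∏ k, (e i k : ℚ) ^ (e i k)) / ∏ k, (f i k : ℚ) ^ (f i k))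
    (hCinj : Function.Injective C)
    (Q : Fin s → ℕ → ℚ)
    (hQ : Q = fun i n =>
      (∏ k, (Nat.factorial (e i k * n) : ℚ)) / ∏ k, (Nat.factorial (f i k * n) : ℚ))
    (hlucas : ∀ i, ∃ QZ : ℕ → ℤ, (∀ n, (QZ n : ℚ) = Q i n) ∧ QZ 0 = 1 ∧
      ∀ p : ℕ, p.Prime → ∀ a n : ℕ, a < p →
        QZ (a + n * p) ≡ QZ a * QZ n [ZMOD (p : ℤ)]) :
    AlgebraicIndependent (Polynomial ℂ)
      (fun i : Fin s => PowerSeries.mk fun n => ((Q i n : ℚ) : ℂ)) := by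
  subst hC hQ
  choose QZ hQZ hQZ0 hQl using hlucas
  by_contra hdep
  have hfun : (fun i : Fin s => (PowerSeries.mk fun n =>
      ((((∏ k, (Nat.factorial (e i k * n) : ℚ)) / ∏ k, (Nat.factorial (f i k * n) : ℚ) : ℚ)) : ℂ))) =
      fun i => PowerSeries.mk fun n => (QZ i n : ℂ) := by
    funext i
    congr 1
    funext n
    have h := hQZ i n
    simp only at h
    rw [← h]
    simp
  have hdep2 : ¬ AlgebraicIndependent (Polynomial ℂ)
      (fun i : Fin s => PowerSeries.mk fun n => (QZ i n : ℂ)) := by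
    rw [← hfun]
    exact hdep
  obtain ⟨m, m', hm, a, b, ha, hb, hrel⟩ := fr_arith QZ hQZ0 hQl hdep2
  have hqR : ∀ i n, (QZ i n : ℝ) =
      (∏ k, (Nat.factorial (e i k * n) : ℝ)) / ∏ k, (Nat.factorial (f i k * n) : ℝ) := by
    intro i n
    have h := congrArg (fun t : ℚ => (t : ℝ)) (hQZ i n)
    simp only at h
    push_cast at h
    exact h
  let D : Fin s → ℝ := fun i => (∏ k, (e i k : ℝ) ^ (e i k)) / ∏ k, (f i k : ℝ) ^ (f i k)
  have hD : ∀ i, D i = ((((∏ k, (e i k : ℚ) ^ (e i k)) / ∏ k, (f i k : ℚ) ^ (f i k)) : ℚ) : ℝ) := by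
    intro i
    push_cast
    rfl
  have hb1 := fun i => fr_ratio_bound (e i) (f i) (hepos i) (hfpos i) (by simpa using hvu i)
    (fr_sum_eq (e i) (f i) (QZ i) (hQZ i) (hQZ0 i) (hQl i)) (D i) rfl (fun n => (QZ i n : ℝ)) (hqR i)
  choose hC0 hK hdiv using hb1
  choose K hK using hK
  refine fr_analytic (fun i n => (QZ i n : ℝ)) (fun i n => ?_) (fun i => by simp [hQZ0 i])
    (fun i => (D i)⁻¹) (fun i => inv_pos.2 (hC0 i)) (fun i j hij => ?_) K hK hdiv m m' hm a b ha hb hrel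
  · simp only [hqR]
    positivity
  · have h := inv_injective hij
    rw [hD, hD] at h
    exact hCinj (Rat.cast_injective h)
end

section
/- Let ℱ be the union of the three families of power series: {Σ_{n≥0} (Σ_{k=0}^n C(n,k)^r) z^n : r ≥ 3}, {Σ_{n≥0} (Σ_{k=0}^n C(n,k)^r C(n+k,k)^r) z^n : r ≥ 2}, and {Σ_{n≥0} (Σ_{k=0}^n C(n,k)^{2r} C(n+k,k)^r) z^n : r ≥ 1}. Then all elements of ℱ are algebraically independent over ℂ(z): every finite subset of ℱ consists of algebraically independent functions over ℂ(z). -/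
/-- Index of the three families: exponents `r ≥ 3`, `r ≥ 2`, `r ≥ 1` respectively. -/
def FamIdx : Type := {r : ℕ // 3 ≤ r} ⊕ {r : ℕ // 2 ≤ r} ⊕ {r : ℕ // 1 ≤ r}

/-- The union `ℱ` of the three families
`∑ₙ (∑_{k=0}^n C(n,k)^r) zⁿ` (`r ≥ 3`),
`∑ₙ (∑_{k=0}^n C(n,k)^r C(n+k,k)^r) zⁿ` (`r ≥ 2`), and
`∑ₙ (∑_{k=0}^n C(n,k)^{2r} C(n+k,k)^r) zⁿ` (`r ≥ 1`). -/
noncomputable def famSeries : FamIdx → PowerSeries ℂ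
  | .inl r => PowerSeries.mk fun n =>
      ∑ k ∈ Finset.range (n + 1), (n.choose k : ℂ) ^ (r : ℕ)
  | .inr (.inl r) => PowerSeries.mk fun n =>
      ∑ k ∈ Finset.range (n + 1),
        (n.choose k : ℂ) ^ (r : ℕ) * ((n + k).choose k : ℂ) ^ (r : ℕ)
  | .inr (.inr r) => PowerSeries.mk fun n =>
      ∑ k ∈ Finset.range (n + 1),
        (n.choose k : ℂ) ^ (2 * (r : ℕ)) * ((n + k).choose k : ℂ) ^ (r : ℕ)


def TT (a b n : ℕ) : ℕ := ∑ k ∈ Finset.range (n + 1), n.choose k ^ a * (n + k).choose k ^ b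

theorem TT_zero (a b : ℕ) : TT a b 0 = 1 := by simp [TT]

theorem TT_ext (a b n N : ℕ) (ha : 1 ≤ a) (h : n + 1 ≤ N) :
    TT a b n = ∑ k ∈ Finset.range N, n.choose k ^ a * (n + k).choose k ^ b := by
  unfold TT
  apply Finset.sum_subset
  · intro x hx; simp at *; omega
  · intro x _ hx
    simp only [Finset.mem_range, not_lt] at hx
    rw [Nat.choose_eq_zero_of_lt (by omega), zero_pow (by omega), zero_mul]

theorem sum_range_block {M : Type*} [AddCommMonoid M] (g : ℕ → M) (N p : ℕ) :
    ∑ k ∈ Finset.range (N * p), g k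
      = ∑ i ∈ Finset.range N, ∑ j ∈ Finset.range p, g (i * p + j) := by
  induction N with
  | zero => simp
  | succ N ih => rw [Nat.succ_mul, Finset.sum_range_add, ih, Finset.sum_range_succ]

theorem choose_lucas (p : ℕ) [Fact p.Prime] (n m i j : ℕ) (hm : m < p) (hj : j < p) :
    ((n * p + m).choose (i * p + j) : ZMod p) = (n.choose i : ZMod p) * (m.choose j : ZMod p) := by
  have h := (ZMod.natCast_eq_natCast_iff _ _ _).2
    (Choose.choose_modEq_choose_mod_mul_choose_div_nat (n := n * p + m) (k := i * p + j) (p := p))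
  have hp : 0 < p := by omega
  rw [h]
  have e1 : ∀ a b : ℕ, b < p → (a * p + b) % p = b := fun a b hb => by
    rw [Nat.mul_add_mod_self_right, Nat.mod_eq_of_lt hb]
  have e2 : ∀ a b : ℕ, b < p → (a * p + b) / p = a := fun a b hb => by
    rw [mul_comm, Nat.mul_add_div hp, Nat.div_eq_of_lt hb, add_zero]
  rw [e1 _ _ hm, e1 _ _ hj, e2 _ _ hm, e2 _ _ hj]
  push_cast; ring

theorem choose_lucas2 (p : ℕ) [Fact p.Prime] (n m i j : ℕ) (hm : m < p) (hj : j < p) :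
    ((n * p + m + (i * p + j)).choose (i * p + j) : ZMod p)
      = ((n + i).choose i : ZMod p) * ((m + j).choose j : ZMod p) := by
  by_cases h : m + j < p
  · rw [← choose_lucas p (n + i) (m + j) i j h hj]
    congr 2; ring
  · have e1 : n * p + m + (i * p + j) = (n + i + 1) * p + (m + j - p) := by
      zify [not_lt.1 h]; ring
    have e2 : m + j = 1 * p + (m + j - p) := by omega
    rw [e1, choose_lucas p _ _ i j (by omega) hj]
    have e3 : ((m + j).choose j : ZMod p) = 0 := by
      have := choose_lucas p 1 (m + j - p) 0 j (by omega) hj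
      rw [← e2] at this
      rw [zero_mul, zero_add] at this
      rw [this, Nat.choose_eq_zero_of_lt (n := m + j - p) (by omega)]; simp
    rw [e3, Nat.choose_eq_zero_of_lt (n := m + j - p) (by omega)]; simp

theorem TT_lucas (a b : ℕ) (ha : 1 ≤ a) (p : ℕ) [Fact p.Prime] (n m : ℕ) (hm : m < p) :
    (TT a b (n * p + m) : ZMod p) = TT a b n * TT a b m := by
  rw [TT_ext a b (n * p + m) ((n + 1) * p) ha (by rw [Nat.succ_mul]; omega), sum_range_block,
    TT_ext a b m p ha (by omega), TT]
  push_cast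
  rw [Finset.sum_mul_sum]
  refine Finset.sum_congr rfl fun i _ => Finset.sum_congr rfl fun j hj => ?_
  rw [choose_lucas p _ _ _ _ hm (Finset.mem_range.1 hj),
    choose_lucas2 p _ _ _ _ hm (Finset.mem_range.1 hj)]
  ring

section Helpers
open PowerSeries


section mon
variable {ι R : Type*} [CommRing R]
def mon (f : ι → R) (α : ι →₀ ℕ) : R := α.prod fun i k => f i ^ k

theorem mon_add (f : ι → R) (α β : ι →₀ ℕ) : mon f (α + β) = mon f α * mon f β := by
  classical
  exact Finsupp.prod_add_index' (by simp) (by intros; rw [pow_add])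

theorem mon_mul (f g : ι → R) (α : ι →₀ ℕ) :
    mon (fun i => f i * g i) α = mon f α * mon g α := by
  unfold mon; rw [← Finsupp.prod_mul]; simp only [mul_pow]

theorem mon_pow (f : ι → R) (n : ℕ) (α : ι →₀ ℕ) :
    mon (fun i => f i ^ n) α = mon f α ^ n := by
  unfold mon Finsupp.prod; rw [← Finset.prod_pow]; simp only [← pow_mul, mul_comm]

theorem mon_map {S : Type*} [CommRing S] (φ : R →+* S) (f : ι → R) (α : ι →₀ ℕ) :
    φ (mon f α) = mon (fun i => φ (f i)) α := by
  unfold mon Finsupp.prod; simp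

theorem mon_ne_zero [IsDomain R] (f : ι → R) (hf : ∀ i, f i ≠ 0) (α : ι →₀ ℕ) : mon f α ≠ 0 := by
  unfold mon Finsupp.prod
  exact Finset.prod_ne_zero_iff.2 fun i _ => pow_ne_zero _ (hf i)
end mon

theorem natDegree_mon {ι K : Type*} [Field K] (A : ι → Polynomial K) (d : ℕ)
    (h : ∀ i, (A i).natDegree ≤ d) (α : ι →₀ ℕ) : (mon A α).natDegree ≤ α.degree * d := by
  unfold mon Finsupp.prod
  refine (Polynomial.natDegree_prod_le _ _).trans ?_
  rw [Finsupp.degree_apply, Finset.sum_mul]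
  refine Finset.sum_le_sum fun i _ => ?_
  exact Polynomial.natDegree_pow_le.trans (Nat.mul_le_mul_left _ (h i))

theorem root_unity (p : ℕ) [hp : Fact p.Prime] (x y : (ZMod p)⟦X⟧) (hx : x ≠ 0) (hy : y ≠ 0)
    (h : x ^ (p - 1) = y ^ (p - 1)) : ∃ ζ : ZMod p, ζ ≠ 0 ∧ PowerSeries.C ζ * x = y := by
  classical
  have hpp : p - 1 + 1 = p := Nat.sub_add_cancel hp.1.one_le
  have hinj : Function.Injective fun ζ : ZMod p => PowerSeries.C ζ * x := by
    intro a b hab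
    exact PowerSeries.C_injective (mul_right_cancel₀ hx hab)
  let s : Finset (ZMod p)⟦X⟧ := Finset.univ.image fun ζ : ZMod p => PowerSeries.C ζ * x
  have hs : s.card = p := by
    rw [Finset.card_image_of_injective _ hinj, Finset.card_univ, ZMod.card]
  let Q : Polynomial (ZMod p)⟦X⟧ :=
    Polynomial.X ^ p - Polynomial.C (x ^ (p - 1)) * Polynomial.X
  have hQd : (Polynomial.C (x ^ (p - 1)) * Polynomial.X : Polynomial (ZMod p)⟦X⟧).degree < p := by
    refine (Polynomial.degree_C_mul_X_le _).trans_lt ?_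
    exact_mod_cast hp.1.one_lt
  have hQm : Q.Monic := (Polynomial.monic_X_pow p).sub_of_left (by rwa [Polynomial.degree_X_pow])
  have hQn : Q.natDegree ≤ p := by
    refine (Polynomial.natDegree_sub_le _ _).trans ?_
    rw [Polynomial.natDegree_X_pow]
    refine max_le le_rfl (Polynomial.natDegree_le_of_degree_le hQd.le)
  have hev : ∀ z : (ZMod p)⟦X⟧, z ^ p = x ^ (p - 1) * z → Q.eval z = 0 := by
    intro z hz
    simp only [Q, Polynomial.eval_sub, Polynomial.eval_pow, Polynomial.eval_X,
      Polynomial.eval_mul, Polynomial.eval_C, hz, sub_self]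
  have hpow : ∀ z : (ZMod p)⟦X⟧, z ^ p = z ^ (p - 1) * z := fun z => by rw [← pow_succ, hpp]
  by_cases hys : y ∈ s
  · obtain ⟨ζ, -, hζ⟩ := Finset.mem_image.1 hys
    refine ⟨ζ, ?_, hζ⟩
    rintro rfl
    apply hy; rw [← hζ]; simp
  · exfalso
    apply hQm.ne_zero
    apply Polynomial.eq_zero_of_natDegree_lt_card_of_eval_eq_zero' Q (insert y s)
    · intro z hz
      rcases Finset.mem_insert.1 hz with rfl | hz
      · apply hev; rw [h, hpow]
      · obtain ⟨ζ, -, rfl⟩ := Finset.mem_image.1 hz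
        apply hev
        rw [mul_pow, ← map_pow, ZMod.pow_card, hpow x]; ring
    · rw [Finset.card_insert_of_notMem hys, hs]; omega

theorem kummer_step {ι : Type*} (p : ℕ) [hp : Fact p.Prime] (f : ι → (ZMod p)⟦X⟧)
    (hf : ∀ i, f i ≠ 0) (A : ι → Polynomial (ZMod p))
    (hA : ∀ i, f i ^ p * (A i : (ZMod p)⟦X⟧) = f i) (hdeg : ∀ i, (A i).natDegree ≤ p - 1)
    (α β : ι →₀ ℕ) (a b : Polynomial (ZMod p)) (ha : a ≠ 0) (hb : b ≠ 0)
    (hab : a ^ (p - 1) * mon A β = b ^ (p - 1) * mon A α) :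
    ∃ U V : Polynomial (ZMod p), U ≠ 0 ∧ V ≠ 0 ∧ U.natDegree ≤ α.degree ∧ V.natDegree ≤ β.degree ∧
      (U : (ZMod p)⟦X⟧) * mon f α = (V : (ZMod p)⟦X⟧) * mon f β := by
  classical
  have hp1 : 0 < p - 1 := Nat.sub_pos_of_lt hp.1.one_lt
  obtain ⟨g, U, V, hg, rfl, rfl, hco⟩ : ∃ g U V, g ≠ 0 ∧ a = g * U ∧ b = g * V ∧ IsCoprime U V := by
    have hg : GCDMonoid.gcd a b ≠ 0 := gcd_ne_zero_of_right hb
    refine ⟨GCDMonoid.gcd a b, a / GCDMonoid.gcd a b, b / GCDMonoid.gcd a b, hg, ?_, ?_, ?_⟩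
    · rw [EuclideanDomain.mul_div_cancel' hg (gcd_dvd_left a b)]
    · rw [EuclideanDomain.mul_div_cancel' hg (gcd_dvd_right a b)]
    · exact isCoprime_div_gcd_div_gcd hb
  have hU : U ≠ 0 := right_ne_zero_of_mul ha
  have hV : V ≠ 0 := right_ne_zero_of_mul hb
  have hA0 : ∀ i, A i ≠ 0 := by
    intro i h
    have := hA i
    rw [h, Polynomial.coe_zero, mul_zero] at this
    exact hf i this.symm
  have e : U ^ (p - 1) * mon A β = V ^ (p - 1) * mon A α := by
    have hgp : g ^ (p - 1) ≠ 0 := pow_ne_zero _ hg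
    apply mul_left_cancel₀ hgp
    rw [mul_pow, mul_pow] at hab
    linear_combination hab
  have key : ∀ (U V : Polynomial (ZMod p)) (α β : ι →₀ ℕ), IsCoprime U V →
      U ^ (p - 1) * mon A β = V ^ (p - 1) * mon A α → U.natDegree ≤ α.degree := by
    intro U V α β hco e
    have : U ^ (p - 1) ∣ mon A α :=
      (IsCoprime.pow hco).dvd_of_dvd_mul_left (Dvd.intro _ e)
    have h2 := Polynomial.natDegree_le_of_dvd this (mon_ne_zero A hA0 α)
    rw [Polynomial.natDegree_pow, mul_comm] at h2
    exact Nat.le_of_mul_le_mul_right (h2.trans (natDegree_mon A _ hdeg α)) hp1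
  have hu := key U V α β hco e
  have hv := key V U β α hco.symm e.symm
  have hfA : ∀ i, f i ^ (p - 1) * (A i : (ZMod p)⟦X⟧) = 1 := by
    intro i
    apply mul_left_cancel₀ (hf i)
    rw [← mul_assoc, ← pow_succ', Nat.sub_add_cancel hp.1.one_le, hA, mul_one]
  have hfm : ∀ α, mon f α ^ (p - 1) * ((mon A α : Polynomial (ZMod p)) : (ZMod p)⟦X⟧) = 1 := by
    intro α
    have : ((mon A α : Polynomial (ZMod p)) : (ZMod p)⟦X⟧)
      = mon (fun i => (A i : (ZMod p)⟦X⟧)) α := mon_map (Polynomial.coeToPowerSeries.ringHom) A α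
    rw [this, ← mon_pow, ← mon_mul]
    simp only [hfA]
    unfold mon; simp
  have e' : (U : (ZMod p)⟦X⟧) ^ (p - 1) * ((mon A β : Polynomial (ZMod p)) : (ZMod p)⟦X⟧) = 
     (V : (ZMod p)⟦X⟧) ^ (p - 1) * ((mon A α : Polynomial (ZMod p)) : (ZMod p)⟦X⟧) := by
    exact_mod_cast congrArg (fun q : Polynomial (ZMod p) => (q : (ZMod p)⟦X⟧)) e
  have hfin : ((U : (ZMod p)⟦X⟧) * mon f α) ^ (p - 1) = ((V : (ZMod p)⟦X⟧) * mon f β) ^ (p - 1) := by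
    rw [mul_pow, mul_pow]
    linear_combination (mon f α ^ (p - 1) * mon f β ^ (p - 1)) * e' 
      - (U : (ZMod p)⟦X⟧) ^ (p - 1) * mon f α ^ (p - 1) * hfm β
      + (V : (ZMod p)⟦X⟧) ^ (p - 1) * mon f β ^ (p - 1) * hfm α
  have hU' : (U : (ZMod p)⟦X⟧) ≠ 0 := by simpa using hU
  have hV' : (V : (ZMod p)⟦X⟧) ≠ 0 := by simpa using hV
  obtain ⟨ζ, hζ, hz⟩ := root_unity p _ _ (mul_ne_zero hU' (mon_ne_zero f hf α))
    (mul_ne_zero hV' (mon_ne_zero f hf β)) hfin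
  refine ⟨Polynomial.C ζ * U, V, mul_ne_zero (by simpa using hζ) hU, hV, ?_, hv, ?_⟩
  · rw [Polynomial.natDegree_C_mul hζ]; exact hu
  · rw [← hz]; push_cast; ring

theorem kummer {ι : Type*} (p : ℕ) [hp : Fact p.Prime] (f : ι → (ZMod p)⟦X⟧)
    (hf : ∀ i, f i ≠ 0) (A : ι → Polynomial (ZMod p))
    (hA : ∀ i, f i ^ p * (A i : (ZMod p)⟦X⟧) = f i) (hdeg : ∀ i, (A i).natDegree ≤ p - 1)
    (S : Finset (ι →₀ ℕ)) : ∀ (c : (ι →₀ ℕ) → Polynomial (ZMod p)), S.Nonempty → 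
    (∀ α ∈ S, c α ≠ 0) → 
    ∑ α ∈ S, (c α : (ZMod p)⟦X⟧) * mon f α = 0 → 
    ∃ α ∈ S, ∃ β ∈ S, α ≠ β ∧ ∃ U V : Polynomial (ZMod p), U ≠ 0 ∧ V ≠ 0 ∧
      U.natDegree ≤ α.degree ∧ V.natDegree ≤ β.degree ∧
      (U : (ZMod p)⟦X⟧) * mon f α = (V : (ZMod p)⟦X⟧) * mon f β := by
  classical
  induction S using Finset.strongInduction with
  | H S ih =>
  intro c hS hc hrel
  obtain ⟨M, hM⟩ : ∃ M : ι →₀ ℕ, ∀ α ∈ S, α ≤ M := 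
    ⟨S.sum id, fun α hα => Finset.single_le_sum (f := id) (fun _ _ => bot_le) hα⟩
  have hA0 : ∀ i, A i ≠ 0 := by
    intro i h
    have := hA i
    rw [h, Polynomial.coe_zero, mul_zero] at this
    exact hf i this.symm
  let c' : (ι →₀ ℕ) → Polynomial (ZMod p) := fun α => c α ^ p * mon A (M - α)
  have hcoe : ∀ α, ((mon A α : Polynomial (ZMod p)) : (ZMod p)⟦X⟧)
      = mon (fun i => (A i : (ZMod p)⟦X⟧)) α :=
    fun α => mon_map (Polynomial.coeToPowerSeries.ringHom) A α
  have hrel' : ∑ α ∈ S, (c' α : (ZMod p)⟦X⟧) * mon f α = 0 := by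
    have h1 : (∑ α ∈ S, (c α : (ZMod p)⟦X⟧) * mon f α) ^ p = 
        ∑ α ∈ S, ((c α : (ZMod p)⟦X⟧) * mon f α) ^ p := by
      have : CharP (ZMod p)⟦X⟧ p := 
        charP_of_injective_ringHom (f := (PowerSeries.C : ZMod p →+* _)) 
          PowerSeries.C_injective p
      exact sum_pow_char p _ _
    rw [hrel, zero_pow hp.1.ne_zero] at h1
    have h2 : ∑ α ∈ S, (c' α : (ZMod p)⟦X⟧) * mon f α = 
      (∑ α ∈ S, ((c α : (ZMod p)⟦X⟧) * mon f α) ^ p) * mon (fun i => (A i : (ZMod p)⟦X⟧)) M := by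
      rw [Finset.sum_mul]
      refine Finset.sum_congr rfl fun α hα => ?_
      have h3 : mon f α = mon f α ^ p * mon (fun i => (A i : (ZMod p)⟦X⟧)) α := by
        rw [← mon_pow, ← mon_mul]; simp only [hA]
      have h4 : mon (fun i => (A i : (ZMod p)⟦X⟧)) M = mon (fun i => (A i : (ZMod p)⟦X⟧)) (M - α)
          * mon (fun i => (A i : (ZMod p)⟦X⟧)) α := by
        rw [← mon_add, tsub_add_cancel_of_le (hM α hα)]
      rw [h4]
      simp only [c', Polynomial.coe_mul, Polynomial.coe_pow, hcoe]
      conv_lhs => rw [h3]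
      ring
    rw [h2, ← h1, zero_mul]
  by_cases hall : ∀ α ∈ S, ∀ β ∈ S, c' β * c α = c β * c' α
  · -- proportional
    obtain ⟨α, hα⟩ := hS
    have : ∃ β ∈ S, α ≠ β := by
      by_contra hcon
      push Not at hcon
      have : S = {α} := by
        ext β; simp only [Finset.mem_singleton]
        exact ⟨fun h => (hcon β h).symm, fun h => h ▸ hα⟩
      rw [this, Finset.sum_singleton] at hrel
      rcases mul_eq_zero.1 hrel with h | h
      · exact hc α hα (by simpa using h)
      · exact mon_ne_zero f hf α h
    obtain ⟨β, hβ, hne⟩ := this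
    refine ⟨α, hα, β, hβ, hne, kummer_step p f hf A hA hdeg α β (c α) (c β) (hc α hα) (hc β hβ) ?_⟩
    have h := hall α hα β hβ
    have hMm := mon_ne_zero A hA0 M
    have hpp : ∀ x : Polynomial (ZMod p), x ^ p = x ^ (p - 1) * x := fun x => by
      rw [← pow_succ, Nat.sub_add_cancel hp.1.one_le]
    have e1 : mon A M = mon A (M - α) * mon A α := by
        rw [← mon_add, tsub_add_cancel_of_le (hM α hα)]
    have e2 : mon A M = mon A (M - β) * mon A β := by
        rw [← mon_add, tsub_add_cancel_of_le (hM β hβ)]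
    apply mul_left_cancel₀ (mul_ne_zero hMm (mul_ne_zero (hc α hα) (hc β hβ)))
    simp only [c', hpp] at h
    linear_combination (- mon A α * mon A β) * h + (c α * c β * c α ^ (p - 1) * mon A β) * e1 
      - (c α * c β * c β ^ (p - 1) * mon A α) * e2
  · push Not at hall
    obtain ⟨α₀, hα₀, β, hβ, hne⟩ := hall
    let d : (ι →₀ ℕ) → Polynomial (ZMod p) := fun α => c' β * c α - c β * c' α
    have hd : ∑ α ∈ S, (d α : (ZMod p)⟦X⟧) * mon f α = 0 := by
      have : ∀ α, (d α : (ZMod p)⟦X⟧) * mon f α = (c' β : (ZMod p)⟦X⟧) * ((c α : (ZMod p)⟦X⟧) * mon f α)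
        - (c β : (ZMod p)⟦X⟧) * ((c' α : (ZMod p)⟦X⟧) * mon f α) := by
        intro α; simp only [d]; push_cast; ring
      simp only [this]
      rw [Finset.sum_sub_distrib, ← Finset.mul_sum, ← Finset.mul_sum, hrel, hrel']; simp
    have hT := ih (S.filter fun α => d α ≠ 0) ?_ d ?_ ?_ ?_
    · obtain ⟨a, ha, b, hb, h⟩ := hT
      exact ⟨a, (Finset.mem_filter.1 ha).1, b, (Finset.mem_filter.1 hb).1, h⟩
    · rw [Finset.filter_ssubset]
      exact ⟨β, hβ, by simp [d, mul_comm]⟩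
    · exact ⟨α₀, by simp only [Finset.mem_filter, d]; exact ⟨hα₀, sub_ne_zero.2 hne⟩⟩
    · intro α hα; exact (Finset.mem_filter.1 hα).2
    · rw [← hd]
      apply Finset.sum_subset (Finset.filter_subset _ _)
      intro x hx hx'
      have : d x = 0 := by
        by_contra h; exact hx' (Finset.mem_filter.2 ⟨hx, h⟩)
      simp [this]


theorem frob_expand (p : ℕ) [hp : Fact p.Prime] (f : (ZMod p)⟦X⟧) :
    f ^ p = PowerSeries.expand p hp.1.ne_zero f := by
  have h := MvPowerSeries.map_frobenius_expand (R := ZMod p) (σ := Unit) p hp.1.ne_zero (f := f)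
  rw [ZMod.frobenius_zmod] at h
  have e : (MvPowerSeries.map (RingHom.id (ZMod p))) (MvPowerSeries.expand p hp.1.ne_zero f)
    = MvPowerSeries.expand p hp.1.ne_zero f := by
    ext; simp
  rw [e] at h
  exact h.symm

theorem lucas_frob (p : ℕ) [hp : Fact p.Prime] (s : ℕ → ZMod p)
    (h : ∀ n m, m < p → s (n * p + m) = s n * s m) :
    (PowerSeries.mk s) ^ p * ((PowerSeries.trunc p (PowerSeries.mk s) : Polynomial (ZMod p)) :
      (ZMod p)⟦X⟧) = PowerSeries.mk s := by
  rw [frob_expand]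
  ext N
  rw [PowerSeries.coeff_mul, Finset.sum_eq_single (p * (N / p), N % p)]
  · rw [PowerSeries.coeff_expand_mul, Polynomial.coeff_coe, PowerSeries.coeff_trunc,
      if_pos (Nat.mod_lt _ hp.1.pos)]
    simp only [PowerSeries.coeff_mk]
    rw [← h _ _ (Nat.mod_lt _ hp.1.pos), mul_comm, Nat.div_add_mod]
  · rintro ⟨i, j⟩ hij hne
    replace hij := Finset.HasAntidiagonal.mem_antidiagonal.1 hij; dsimp only at hij
    simp only [Polynomial.coeff_coe, PowerSeries.coeff_trunc, PowerSeries.coeff_expand]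
    split_ifs with h1 h2
    · exfalso
      obtain ⟨k, rfl⟩ := h1
      apply hne
      have : N / p = k := by
        rw [← hij, Nat.mul_add_div hp.1.pos, Nat.div_eq_of_lt h2, add_zero]
      have h3 : N % p = j := by
        rw [← hij, Nat.mul_add_mod, Nat.mod_eq_of_lt h2]
      rw [this, h3]
    all_goals simp
  · intro hh
    exact absurd (Finset.HasAntidiagonal.mem_antidiagonal.2 (Nat.div_add_mod N p)) hh

theorem int_mult {κ : Type*} [Fintype κ] (v : κ → ℚ) :
    ∃ b : ℤ, b ≠ 0 ∧ ∃ w : κ → ℤ, ∀ k, (w k : ℚ) = b * v k := by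
  classical
  obtain ⟨b, hb⟩ := IsLocalization.exist_integer_multiples_of_finset (nonZeroDivisors ℤ)
    (Finset.univ.image v)
  have : ∀ k, ∃ w : ℤ, (w : ℚ) = (b : ℤ) * v k := by
    intro k
    obtain ⟨w, hw⟩ := hb (v k) (Finset.mem_image_of_mem _ (Finset.mem_univ _))
    refine ⟨w, ?_⟩
    simpa using hw
  choose w hw using this
  exact ⟨b, nonZeroDivisors.coe_ne_zero b, w, hw⟩

theorem lin_lift {κ : Type*} [Fintype κ] (row : ℕ → κ → ℤ) (Ps : Set ℕ) (hinf : Ps.Infinite)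
    (hPs : ∀ p ∈ Ps, p.Prime ∧ ∃ u : κ → ZMod p, u ≠ 0 ∧ ∀ n, ∑ k, (row n k : ZMod p) * u k = 0) :
    ∃ u : κ → ℤ, u ≠ 0 ∧ ∀ n, ∑ k, row n k * u k = 0 := by
  classical
  let W : Submodule ℚ (κ → ℚ) := Submodule.span ℚ (Set.range fun n k => (row n k : ℚ))
  by_cases hW : W = ⊤
  · exfalso
    have key : ∀ v ∈ W, ∃ d : ℤ, d ≠ 0 ∧ ∃ w : κ → ℤ, (∀ k, (w k : ℚ) = d * v k) ∧
        ∀ (p : ℕ) (u : κ → ZMod p), (∀ n, ∑ k, (row n k : ZMod p) * u k = 0) →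
          ∑ k, (w k : ZMod p) * u k = 0 := by
      intro v hv
      induction hv using Submodule.span_induction with
      | mem x hx =>
        obtain ⟨n, rfl⟩ := hx
        exact ⟨1, one_ne_zero, row n, by simp, fun p u h => h n⟩
      | zero => exact ⟨1, one_ne_zero, 0, by simp, by simp⟩
      | add x y _ _ hx hy =>
        obtain ⟨d1, h1, w1, e1, g1⟩ := hx
        obtain ⟨d2, h2, w2, e2, g2⟩ := hy
        refine ⟨d1 * d2, mul_ne_zero h1 h2, fun k => d2 * w1 k + d1 * w2 k, ?_, ?_⟩
        · intro k; push_cast; rw [e1, e2, Pi.add_apply]; ring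
        · intro p u h
          push_cast
          have : ∀ k, ((d2 : ZMod p) * w1 k + d1 * w2 k) * u k
            = d2 * (w1 k * u k) + d1 * (w2 k * u k) := fun k => by ring
          simp only [this, Finset.sum_add_distrib, ← Finset.mul_sum, g1 p u h, g2 p u h]
          simp
      | smul q x _ hx =>
        obtain ⟨d1, h1, w1, e1, g1⟩ := hx
        refine ⟨d1 * q.den, mul_ne_zero h1 (by exact_mod_cast q.den_ne_zero),
          fun k => q.num * w1 k, ?_, ?_⟩
        · intro k; push_cast; rw [e1, Pi.smul_apply, smul_eq_mul]
          have := Rat.mul_den_eq_num q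
          rw [← this]; ring
        · intro p u h
          push_cast
          simp only [mul_assoc, ← Finset.mul_sum, g1 p u h, mul_zero]
    have key2 : ∀ k : κ, ∃ d : ℤ, d ≠ 0 ∧ ∀ (p : ℕ) (u : κ → ZMod p),
        (∀ n, ∑ k, (row n k : ZMod p) * u k = 0) → (d : ZMod p) * u k = 0 := by
      intro k
      obtain ⟨d, hd, w, hw, hg⟩ := key (Pi.single k 1) (by rw [hW]; trivial)
      refine ⟨d, hd, fun p u h => ?_⟩
      have h' := hg p u h
      have hw' : ∀ j, w j = if j = k then d else 0 := by
        intro j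
        have := hw j
        rw [Pi.single_apply] at this
        split_ifs at this ⊢ with hj
        · exact_mod_cast (by simpa using this)
        · exact_mod_cast (by simpa using this)
      simpa [hw'] using h'
    choose d hd hdu using key2
    obtain ⟨p, hp, hlt⟩ := hinf.exists_gt (∑ k, (d k).natAbs)
    obtain ⟨hprime, u, hu, hrow⟩ := hPs p hp
    apply hu
    funext k
    have := Fact.mk hprime
    rcases mul_eq_zero.1 (hdu k p u hrow) with h | h
    · exfalso
      rw [ZMod.intCast_zmod_eq_zero_iff_dvd] at h
      have h2 := Int.natCast_dvd.1 h
      have h3 := Nat.le_of_dvd (Int.natAbs_pos.2 (hd k)) h2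
      have h4 := Finset.single_le_sum (f := fun k => (d k).natAbs) (fun _ _ => Nat.zero_le _)
        (Finset.mem_univ k)
      omega
    · exact h
  · obtain ⟨φ, hφ, hle⟩ := Submodule.exists_le_ker_of_lt_top W (lt_top_iff_ne_top.2 hW)
    obtain ⟨b, hb, w, hw⟩ := int_mult (fun k => φ (Pi.single k 1))
    refine ⟨w, ?_, ?_⟩
    · intro h0
      apply hφ
      apply LinearMap.pi_ext'
      intro k
      ext
      have := hw k
      rw [h0] at this
      simp only [Pi.zero_apply, Int.cast_zero, zero_eq_mul, Int.cast_eq_zero, hb, false_or] at this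
      simpa using this
    · intro n
      have h1 : φ (fun k => (row n k : ℚ)) = 0 :=
        hle (Submodule.subset_span ⟨n, rfl⟩)
      rw [LinearMap.pi_apply_eq_sum_univ φ] at h1
      have h2 : ((∑ k, row n k * w k : ℤ) : ℚ) = 0 := by
        push_cast
        simp only [hw]
        have h3 : ∀ k, (row n k : ℚ) * (b * φ (Pi.single k 1))
          = b * ((row n k : ℚ) • φ (fun j => if k = j then 1 else 0)) := by
          intro k
          have : (Pi.single k (1 : ℚ) : κ → ℚ) = fun j => if k = j then 1 else 0 := by
            funext j; simp [Pi.single_apply, eq_comm]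
          rw [this, smul_eq_mul]; ring
        simp only [h3]
        rw [← Finset.mul_sum, h1, mul_zero]
      exact_mod_cast h2

theorem lift_rel (F G : ℤ⟦X⟧) (D : ℕ) (Ps : Set ℕ) (hinf : Ps.Infinite)
    (hPs : ∀ p ∈ Ps, p.Prime ∧ ∃ U V : Polynomial (ZMod p), U ≠ 0 ∧ U.natDegree ≤ D ∧
      V.natDegree ≤ D ∧ (U : (ZMod p)⟦X⟧) * PowerSeries.map (Int.castRingHom (ZMod p)) F
        = (V : (ZMod p)⟦X⟧) * PowerSeries.map (Int.castRingHom (ZMod p)) G) :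
    ∃ U V : Polynomial ℤ, (U ≠ 0 ∨ V ≠ 0) ∧ (U : ℤ⟦X⟧) * F = (V : ℤ⟦X⟧) * G := by
  classical
  have hsum : ∀ {R : Type} [CommRing R] (U : Polynomial R) (F : R⟦X⟧) (n : ℕ), U.natDegree ≤ D →
      PowerSeries.coeff n ((U : R⟦X⟧) * F) =
        ∑ i : Fin (D + 1), PowerSeries.coeff n ((PowerSeries.X : R⟦X⟧) ^ (i : ℕ) * F)
          * U.coeff i := by
    intro R _ U F n hU
    have : (U : R⟦X⟧) = ∑ i : Fin (D + 1), PowerSeries.C (U.coeff i) * PowerSeries.X ^ (i : ℕ) := by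
      conv_lhs => rw [Polynomial.as_sum_range' U (D + 1) (by omega)]
      rw [← Fin.sum_univ_eq_sum_range (fun i => Polynomial.monomial i (U.coeff i))]
      rw [← Polynomial.coeToPowerSeries.ringHom_apply, map_sum]
      refine Finset.sum_congr rfl fun i _ => ?_
      rw [Polynomial.coeToPowerSeries.ringHom_apply, ← Polynomial.C_mul_X_pow_eq_monomial]
      simp
    rw [this, Finset.sum_mul, map_sum]
    refine Finset.sum_congr rfl fun i _ => ?_
    rw [mul_assoc, PowerSeries.coeff_C_mul, mul_comm]
  obtain ⟨u, hu, hrow⟩ := lin_lift (κ := Fin (D + 1) ⊕ Fin (D + 1))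
    (fun n => Sum.elim (fun i => PowerSeries.coeff n ((PowerSeries.X : ℤ⟦X⟧) ^ (i : ℕ) * F))
      (fun i => - PowerSeries.coeff n ((PowerSeries.X : ℤ⟦X⟧) ^ (i : ℕ) * G))) Ps hinf (by
      intro p hp
      obtain ⟨hpr, U, V, hU, hUd, hVd, hUV⟩ := hPs p hp
      refine ⟨hpr, Sum.elim (fun i => U.coeff i) (fun i => V.coeff i), ?_, ?_⟩
      · intro h
        apply hU
        ext i
        by_cases hi : i < D + 1
        · have := congrFun h (Sum.inl ⟨i, hi⟩)
          simpa using this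
        · rw [Polynomial.coeff_eq_zero_of_natDegree_lt (by omega)]; simp
      · intro n
        have h := congrArg (PowerSeries.coeff n) hUV
        rw [hsum _ _ _ hUd, hsum _ _ _ hVd] at h
        have hm : ∀ (F : ℤ⟦X⟧) (i : ℕ), PowerSeries.coeff n ((PowerSeries.X : (ZMod p)⟦X⟧) ^ i
          * PowerSeries.map (Int.castRingHom (ZMod p)) F) = 
            ((PowerSeries.coeff n ((PowerSeries.X : ℤ⟦X⟧) ^ i * F) : ℤ) : ZMod p) := by
          intro F i
          have : (PowerSeries.X : (ZMod p)⟦X⟧) ^ i * PowerSeries.map (Int.castRingHom (ZMod p)) F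
            = PowerSeries.map (Int.castRingHom (ZMod p)) (PowerSeries.X ^ i * F) := by simp
          rw [this, PowerSeries.coeff_map]; rfl
        simp only [hm] at h
        rw [Fintype.sum_sum_type]
        simp only [Sum.elim_inl, Sum.elim_inr, Int.cast_neg, neg_mul, Finset.sum_neg_distrib]
        rw [h]; ring)
  let U : Polynomial ℤ := ∑ i : Fin (D + 1), Polynomial.monomial (i : ℕ) (u (Sum.inl i))
  let V : Polynomial ℤ := ∑ i : Fin (D + 1), Polynomial.monomial (i : ℕ) (u (Sum.inr i))
  have hco : ∀ (w : Fin (D + 1) → ℤ) (j : Fin (D + 1)),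
      (∑ i : Fin (D + 1), Polynomial.monomial (i : ℕ) (w i)).coeff j = w j := by
    intro w j
    rw [Polynomial.finsetSum_coeff, Finset.sum_eq_single j]
    · simp
    · intro b _ hb
      rw [Polynomial.coeff_monomial, if_neg]
      intro h; exact hb (Fin.ext h)
    · simp
  have hdg : ∀ (w : Fin (D + 1) → ℤ),
      (∑ i : Fin (D + 1), Polynomial.monomial (i : ℕ) (w i)).natDegree ≤ D := by
    intro w
    apply Polynomial.natDegree_sum_le_of_forall_le
    intro i _
    exact (Polynomial.natDegree_monomial_le _).trans (by omega)
  refine ⟨U, V, ?_, ?_⟩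
  · by_contra hcon
    push Not at hcon
    apply hu
    funext k
    rcases k with i | i
    · rw [← hco (fun i => u (Sum.inl i)) i]; change U.coeff i = 0; rw [hcon.1]; simp
    · rw [← hco (fun i => u (Sum.inr i)) i]; change V.coeff i = 0; rw [hcon.2]; simp
  · ext n
    rw [hsum _ _ _ (hdg _), hsum _ _ _ (hdg _)]
    have h := hrow n
    rw [Fintype.sum_sum_type] at h
    simp only [Sum.elim_inl, Sum.elim_inr, neg_mul, Finset.sum_neg_distrib] at h
    simp only [hco]
    linarith


theorem descend {ι : Type*} (f : ι → ℤ⟦X⟧) (P : MvPolynomial ι (Polynomial ℂ)) (hP : P ≠ 0)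
    (h : MvPolynomial.aeval (fun i => PowerSeries.map (Int.castRingHom ℂ) (f i)) P = 0) :
    ∃ (S : Finset (ι →₀ ℕ)) (c : (ι →₀ ℕ) → Polynomial ℤ), (∃ α ∈ S, c α ≠ 0) ∧
      ∑ α ∈ S, (c α : ℤ⟦X⟧) * mon f α = 0 := by
  classical
  have hn : ∀ n, ∑ α ∈ P.support, ∑ x ∈ Finset.HasAntidiagonal.antidiagonal n,
      (P.coeff α).coeff x.1 * ((PowerSeries.coeff x.2 (mon f α) : ℤ) : ℂ) = 0 := by
    intro n
    have h1 := congrArg (PowerSeries.coeff n) h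
    rw [MvPolynomial.aeval_def, MvPolynomial.eval₂_eq, map_sum, map_zero] at h1
    rw [← h1]
    refine Finset.sum_congr rfl fun α _ => ?_
    have h2 : (∏ i ∈ α.support, PowerSeries.map (Int.castRingHom ℂ) (f i) ^ α i)
      = PowerSeries.map (Int.castRingHom ℂ) (mon f α) := by
      rw [mon_map]; rfl
    rw [h2]
    change _ = PowerSeries.coeff n (((P.coeff α : Polynomial ℂ) : ℂ⟦X⟧) * _)
    rw [PowerSeries.coeff_mul]
    refine Finset.sum_congr rfl fun x _ => ?_
    rw [Polynomial.coeff_coe, PowerSeries.coeff_map]; rfl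
  obtain ⟨α₀, hα₀⟩ := MvPolynomial.ne_zero_iff.1 hP
  obtain ⟨i₀, hi₀⟩ : ∃ i, (P.coeff α₀).coeff i ≠ 0 := by
    by_contra hcon; push Not at hcon
    exact hα₀ (Polynomial.ext (by simpa using hcon))
  obtain ⟨L, hL⟩ : ∃ L : Module.Dual ℚ ℂ, L ((P.coeff α₀).coeff i₀) ≠ 0 := by
    by_contra hcon; push Not at hcon
    exact hi₀ ((Module.forall_dual_apply_eq_zero_iff ℚ _).1 hcon)
  let T : Finset ℚ := P.support.biUnion fun α =>
    (P.coeff α).support.image fun i => L ((P.coeff α).coeff i)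
  obtain ⟨b, hb⟩ := IsLocalization.exist_integer_multiples_of_finset (nonZeroDivisors ℤ) T
  have hb0 : (b : ℤ) ≠ 0 := nonZeroDivisors.coe_ne_zero b
  let g : ℂ → ℤ := fun z => (((b : ℤ) : ℚ) * L z).num
  have g0 : g 0 = 0 := by simp [g]
  have hg : ∀ α ∈ P.support, ∀ i, ((g ((P.coeff α).coeff i) : ℤ) : ℚ)
      = (b : ℤ) * L ((P.coeff α).coeff i) := by
    intro α hα i
    by_cases hi : (P.coeff α).coeff i = 0
    · rw [hi, g0]; simp
    · obtain ⟨w, hw⟩ := hb (L ((P.coeff α).coeff i)) (Finset.mem_biUnion.2 ⟨α, hα,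
        Finset.mem_image_of_mem _ (Polynomial.mem_support_iff.2 hi)⟩)
      have hw' : ((b : ℤ) : ℚ) * L ((P.coeff α).coeff i) = (w : ℚ) := by simpa using hw.symm
      simp only [g]
      rw [hw']; simp
  let c : (ι →₀ ℕ) → Polynomial ℤ := fun α =>
    ∑ i ∈ (P.coeff α).support, Polynomial.monomial i (g ((P.coeff α).coeff i))
  have hc : ∀ α i, (c α).coeff i = g ((P.coeff α).coeff i) := by
    intro α i
    simp only [c, Polynomial.finsetSum_coeff, Polynomial.coeff_monomial]
    rw [Finset.sum_ite_eq']
    split_ifs with hi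
    · rfl
    · rw [Polynomial.notMem_support_iff.1 hi, g0]
  have hα₀' : α₀ ∈ P.support := MvPolynomial.mem_support_iff.2 hα₀
  refine ⟨P.support, c, ⟨α₀, hα₀', ?_⟩, ?_⟩
  · intro h0
    have h1 := hc α₀ i₀
    rw [h0, Polynomial.coeff_zero] at h1
    have h2 := hg α₀ hα₀' i₀
    rw [← h1] at h2
    have : ((b : ℤ) : ℚ) ≠ 0 := by exact_mod_cast hb0
    exact mul_ne_zero this hL (by rw [← h2]; simp)
  · ext n
    rw [map_sum, map_zero]
    have h1 : ((∑ α ∈ P.support, PowerSeries.coeff n ((c α : ℤ⟦X⟧) * mon f α) : ℤ) : ℚ)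
        = (b : ℤ) * L (∑ α ∈ P.support, ∑ x ∈ Finset.HasAntidiagonal.antidiagonal n,
      (P.coeff α).coeff x.1 * ((PowerSeries.coeff x.2 (mon f α) : ℤ) : ℂ)) := by
      rw [map_sum, Finset.mul_sum]
      push_cast
      refine Finset.sum_congr rfl fun α hα => ?_
      rw [map_sum, Finset.mul_sum, PowerSeries.coeff_mul]
      push_cast
      refine Finset.sum_congr rfl fun x _ => ?_
      rw [hc, hg α hα]
      have : (P.coeff α).coeff x.1 * ((PowerSeries.coeff x.2 (mon f α) : ℤ) : ℂ) =
        (PowerSeries.coeff x.2 (mon f α) : ℤ) • (P.coeff α).coeff x.1 := by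
        rw [zsmul_eq_mul, mul_comm]
      rw [this, map_zsmul, zsmul_eq_mul]; ring
    rw [hn n, map_zero, mul_zero] at h1
    exact_mod_cast h1

theorem alg_main {ι : Type*} (s : ι → ℕ → ℕ) (h0 : ∀ i, s i 0 = 1)
    (hl : ∀ (i : ι) (p : ℕ) [Fact p.Prime] (n m : ℕ), m < p →
      ((s i (n * p + m) : ℕ) : ZMod p) = s i n * s i m)
    (P : MvPolynomial ι (Polynomial ℂ)) (hP : P ≠ 0)
    (h : MvPolynomial.aeval (fun i => PowerSeries.mk fun n => (s i n : ℂ)) P = 0) :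
    ∃ α β : ι →₀ ℕ, α ≠ β ∧ ∃ U V : Polynomial ℤ, U ≠ 0 ∧ V ≠ 0 ∧
      (U : ℤ⟦X⟧) * mon (fun i => PowerSeries.mk fun n => (s i n : ℤ)) α
        = (V : ℤ⟦X⟧) * mon (fun i => PowerSeries.mk fun n => (s i n : ℤ)) β := by
  classical
  set f : ι → ℤ⟦X⟧ := fun i => PowerSeries.mk fun n => (s i n : ℤ) with hf
  have hf0 : ∀ i, f i ≠ 0 := by
    intro i hi
    have := congrArg (PowerSeries.coeff 0) hi
    simp [hf, h0] at this
  obtain ⟨S, c, ⟨α₀, hα₀, hc₀⟩, hrel⟩ := descend f P hP (by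
    rw [← h]; congr 2)
  obtain ⟨i₀, hi₀⟩ : ∃ i, (c α₀).coeff i ≠ 0 := by
    by_contra hcon; push Not at hcon
    exact hc₀ (Polynomial.ext (by simpa using hcon))
  have hp : ∀ p : ℕ, p.Prime → ((c α₀).coeff i₀).natAbs < p → ∃ α ∈ S, ∃ β ∈ S, α ≠ β ∧
      ∃ U V : Polynomial (ZMod p), U ≠ 0 ∧ V ≠ 0 ∧
      U.natDegree ≤ α.degree ∧ V.natDegree ≤ β.degree ∧
      (U : (ZMod p)⟦X⟧) * PowerSeries.map (Int.castRingHom (ZMod p)) (mon f α) =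
        (V : (ZMod p)⟦X⟧) * PowerSeries.map (Int.castRingHom (ZMod p)) (mon f β) := by
    intro p hpp hlt
    have := Fact.mk hpp
    have hfm : ∀ i, PowerSeries.map (Int.castRingHom (ZMod p)) (f i)
      = PowerSeries.mk fun n => (s i n : ZMod p) := by
      intro i; ext n; simp [hf]
    let c' : (ι →₀ ℕ) → Polynomial (ZMod p) := fun α => (c α).map (Int.castRingHom (ZMod p))
    have hk := kummer p (fun i => PowerSeries.map (Int.castRingHom (ZMod p)) (f i)) (by
        intro i hi
        have := congrArg (PowerSeries.coeff 0) hi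
        simp [hf, h0] at this)
      (fun i => PowerSeries.trunc p (PowerSeries.map (Int.castRingHom (ZMod p)) (f i)))
      (by intro i; rw [hfm i]; exact lucas_frob p _ (hl i p)) (by
        intro i
        have h1 := PowerSeries.natDegree_trunc_lt
          (PowerSeries.map (Int.castRingHom (ZMod p)) (f i)) (p - 1)
        rw [Nat.sub_add_cancel hpp.one_le] at h1
        omega) (S.filter fun α => c' α ≠ 0) c' ?_ ?_ ?_
    · obtain ⟨α, hα, β, hβ, hne, U, V, hU, hV, hUd, hVd, hUV⟩ := hk
      refine ⟨α, (Finset.mem_filter.1 hα).1, β, (Finset.mem_filter.1 hβ).1, hne, U, V, hU, hV,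
        hUd, hVd, ?_⟩
      rw [mon_map, mon_map]; exact hUV
    · refine ⟨α₀, Finset.mem_filter.2 ⟨hα₀, ?_⟩⟩
      intro h1
      have h2 := congrArg (fun q => Polynomial.coeff q i₀) h1
      simp only [c', Polynomial.coeff_map, Polynomial.coeff_zero, eq_intCast] at h2
      rw [ZMod.intCast_zmod_eq_zero_iff_dvd] at h2
      have h3 := Nat.le_of_dvd (Int.natAbs_pos.2 hi₀) (Int.natCast_dvd.1 h2)
      omega
    · intro α hα; exact (Finset.mem_filter.1 hα).2
    · have h1 := congrArg (PowerSeries.map (Int.castRingHom (ZMod p))) hrel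
      rw [map_sum, map_zero] at h1
      rw [← h1]
      have h2 : ∀ α, PowerSeries.map (Int.castRingHom (ZMod p)) ((c α : ℤ⟦X⟧) * mon f α)
        = (c' α : (ZMod p)⟦X⟧) *
          mon (fun i => PowerSeries.map (Int.castRingHom (ZMod p)) (f i)) α := by
        intro α
        rw [map_mul, mon_map, ← Polynomial.polynomial_map_coe]
      simp only [h2]
      apply Finset.sum_subset (Finset.filter_subset _ _)
      intro x hx hx'
      have : c' x = 0 := by
        by_contra h; exact hx' (Finset.mem_filter.2 ⟨hx, h⟩)
      simp [this]
  let Q : Set ℕ := {p | p.Prime ∧ ((c α₀).coeff i₀).natAbs < p}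
  have hQ : Q.Infinite := by
    rw [Set.infinite_iff_exists_gt]
    intro N
    obtain ⟨p, hp1, hp2⟩ := Nat.exists_infinite_primes (N + ((c α₀).coeff i₀).natAbs + 1)
    exact ⟨p, ⟨hp2, by omega⟩, by omega⟩
  let R : (ι →₀ ℕ) × (ι →₀ ℕ) → Set ℕ := fun x => {p | p.Prime ∧ x.1 ≠ x.2 ∧
      ∃ U V : Polynomial (ZMod p), U ≠ 0 ∧ V ≠ 0 ∧
      U.natDegree ≤ x.1.degree ∧ V.natDegree ≤ x.2.degree ∧
      (U : (ZMod p)⟦X⟧) * PowerSeries.map (Int.castRingHom (ZMod p)) (mon f x.1) =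
        (V : (ZMod p)⟦X⟧) * PowerSeries.map (Int.castRingHom (ZMod p)) (mon f x.2)}
  obtain ⟨x, hx⟩ : ∃ x, (R x).Infinite := by
    by_contra hcon
    push Not at hcon
    apply hQ
    refine Set.Finite.subset (Set.Finite.biUnion (S ×ˢ S).finite_toSet (t := R)
      (fun x _ => by simpa using hcon x)) ?_
    intro p ⟨hpp, hlt⟩
    obtain ⟨α, hα, β, hβ, hne, hh⟩ := hp p hpp hlt
    exact Set.mem_biUnion (x := (α, β)) (by simp [hα, hβ]) ⟨hpp, hne, hh⟩
  obtain ⟨p₀, hp₀⟩ := hx.nonempty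
  obtain ⟨U, V, hUV, hrelUV⟩ := lift_rel (mon f x.1) (mon f x.2) (x.1.degree + x.2.degree) (R x) hx (by
    intro p ⟨hpp, _, U, V, hU, hV, hUd, hVd, hh⟩
    exact ⟨hpp, U, V, hU, by omega, by omega, hh⟩)
  have hU : U ≠ 0 := by
    rintro rfl
    simp only [Polynomial.coe_zero, zero_mul, ne_eq, not_true_eq_false, false_or] at hrelUV hUV
    rcases mul_eq_zero.1 hrelUV.symm with h | h
    · exact hUV (by simpa using h)
    · exact mon_ne_zero f hf0 _ h
  have hV : V ≠ 0 := by
    rintro rfl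
    simp only [Polynomial.coe_zero, zero_mul] at hrelUV
    rcases mul_eq_zero.1 hrelUV with h | h
    · exact hU (by simpa using h)
    · exact mon_ne_zero f hf0 _ h
  exact ⟨x.1, x.2, hp₀.2.1, U, V, hU, hV, hrelUV⟩

open Filter Topology in
theorem shift_sum (t : ℕ → ℝ) (ht : ∀ n, 0 ≤ t n) (x₀ y : ℝ) (hx : 0 ≤ x₀)
    (hs : Summable fun n => t n * y ^ n) (h : ℝ) (hh : x₀ + |h| ≤ y) :
    (∀ k, Summable fun n => t n * (n.choose k : ℝ) * x₀ ^ (n - k) * h ^ k) ∧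
    HasSum (fun k => (∑' n, t n * (n.choose k : ℝ) * x₀ ^ (n - k)) * h ^ k)
      (∑' n, t n * (x₀ + h) ^ n) := by
  let u : ℕ × ℕ → ℝ := fun z => t z.1 * (z.1.choose z.2 : ℝ) * x₀ ^ (z.1 - z.2) * h ^ z.2
  have hfin : ∀ (g : ℝ) (n : ℕ), HasSum (fun k => t n * (n.choose k : ℝ) * x₀ ^ (n - k) * g ^ k)
      (t n * (x₀ + g) ^ n) := by
    intro g n
    have h1 : t n * (x₀ + g) ^ n = ∑ k ∈ Finset.range (n + 1),
        t n * (n.choose k : ℝ) * x₀ ^ (n - k) * g ^ k := by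
      rw [add_comm, add_pow, Finset.mul_sum]
      refine Finset.sum_congr rfl fun k _ => by ring
    rw [h1]
    apply hasSum_sum_of_ne_finset_zero
    intro k hk
    rw [Finset.mem_range, not_lt] at hk
    rw [Nat.choose_eq_zero_of_lt (by omega)]; simp
  have hnorm : ∀ z, ‖u z‖ = t z.1 * (z.1.choose z.2 : ℝ) * x₀ ^ (z.1 - z.2) * |h| ^ z.2 := by
    intro z
    simp only [u, norm_mul, Real.norm_eq_abs, norm_pow, abs_of_nonneg (ht _), abs_of_nonneg hx,
      Nat.abs_cast]
  have hsum : Summable u := by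
    apply Summable.of_norm
    rw [summable_prod_of_nonneg (fun _ => norm_nonneg _)]
    constructor
    · intro n
      simp only [hnorm]
      exact (hfin |h| n).summable
    · simp only [hnorm]
      have : ∀ n, ∑' k, t n * (n.choose k : ℝ) * x₀ ^ (n - k) * |h| ^ k = t n * (x₀ + |h|) ^ n :=
        fun n => (hfin |h| n).tsum_eq
      simp only [this]
      refine Summable.of_nonneg_of_le (fun n => by have := ht n; positivity) (fun n => ?_) hs
      gcongr
      exact ht n
  have hsum' : Summable (u ∘ Prod.swap) := (Equiv.prodComm ℕ ℕ).summable_iff.2 hsum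
  have hk : ∀ k, Summable fun n => t n * (n.choose k : ℝ) * x₀ ^ (n - k) * h ^ k :=
    fun k => hsum'.prod_factor k
  refine ⟨hk, ?_⟩
  have h1 : HasSum u (∑' n, t n * (x₀ + h) ^ n) := by
    have h2 := hsum.hasSum
    have h3 : HasSum (fun n => t n * (x₀ + h) ^ n) (∑' z, u z) :=
      h2.prod_fiberwise (fun n => hfin h n)
    rwa [h3.tsum_eq]
  have h4 : HasSum (u ∘ Prod.swap) (∑' n, t n * (x₀ + h) ^ n) :=
    (Equiv.prodComm ℕ ℕ).hasSum_iff.2 h1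
  refine h4.prod_fiberwise (fun k => ?_)
  have h5 := (hk k).hasSum
  rw [tsum_mul_right] at h5
  exact h5

theorem shift_series (t : ℕ → ℝ) (ht : ∀ n, 0 ≤ t n) (x₀ y : ℝ) (hx : 0 ≤ x₀) (hy : x₀ < y)
    (hs : Summable fun n => t n * y ^ n) :
    HasFPowerSeriesAt (fun x => ∑' n, t n * x ^ n)
      (FormalMultilinearSeries.ofScalars ℝ
        (fun k => ∑' n, t n * (n.choose k : ℝ) * x₀ ^ (n - k))) x₀ := by
  set b : ℕ → ℝ := fun k => ∑' n, t n * (n.choose k : ℝ) * x₀ ^ (n - k) with hb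
  have hb0 : ∀ k, 0 ≤ b k := fun k => tsum_nonneg fun n => by have := ht n; positivity
  refine ⟨ENNReal.ofReal (y - x₀), ?_⟩
  have hr : 0 ≤ y - x₀ := by linarith
  refine ⟨?_, ?_, ?_⟩
  · have : Summable fun n => ‖FormalMultilinearSeries.ofScalars ℝ b n‖ * ((y - x₀).toNNReal : ℝ) ^ n := by
      have h1 := (shift_sum t ht x₀ y hx hs (y - x₀) (by rw [abs_of_nonneg hr]; linarith)).2.summable
      refine h1.congr fun n => ?_
      rw [FormalMultilinearSeries.ofScalars_norm, Real.norm_of_nonneg (hb0 n),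
        Real.coe_toNNReal _ hr]
    exact FormalMultilinearSeries.le_radius_of_summable_norm _ this
  · exact ENNReal.ofReal_pos.2 (by linarith)
  · intro h hh
    have hh' : |h| < y - x₀ := by
      simpa [Metric.eball_ofReal, Real.norm_eq_abs] using hh
    have h1 := (shift_sum t ht x₀ y hx hs h (by linarith)).2
    have e : (fun n => (FormalMultilinearSeries.ofScalars ℝ b n) fun _ => h) =
        fun k => b k * h ^ k := by
      funext k
      simp [smul_eq_mul, mul_comm]
    rw [e]
    exact h1

theorem shift_analytic (t : ℕ → ℝ) (ht : ∀ n, 0 ≤ t n) (x₀ y : ℝ) (hx : 0 ≤ x₀) (hy : x₀ < y)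
    (hs : Summable fun n => t n * y ^ n) :
    AnalyticAt ℝ (fun x => ∑' n, t n * x ^ n) x₀ := (shift_series t ht x₀ y hx hy hs).analyticAt

open Filter Topology in
theorem pringsheim (t : ℕ → ℝ) (ht : ∀ n, 0 ≤ t n) (ρ : ℝ) (hρ : 0 < ρ)
    (hs : ∀ y, 0 ≤ y → y < ρ → Summable fun n => t n * y ^ n) (E : ℝ → ℝ) (hE : AnalyticAt ℝ E ρ)
    (hEF : ∀ᶠ x in 𝓝[<] ρ, ∑' n, t n * x ^ n = E x) :
    ∃ y, ρ < y ∧ Summable fun n => t n * y ^ n := by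
  obtain ⟨p, r, hp⟩ := hE
  obtain ⟨r', hr'0, hr'⟩ : ∃ r' : ℝ, 0 < r' ∧ ENNReal.ofReal r' ≤ r := by
    rcases eq_or_ne r ⊤ with h | h
    · exact ⟨1, one_pos, by rw [h]; exact le_top⟩
    · refine ⟨r.toReal, ENNReal.toReal_pos hp.r_pos.ne' h, ?_⟩
      rw [ENNReal.ofReal_toReal h]
  replace hp := hp.mono (ENNReal.ofReal_pos.2 hr'0) hr'
  obtain ⟨l, hl, hl'⟩ := (mem_nhdsLT_iff_exists_Ioo_subset' hρ).1 hEF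
  -- choose the new centre
  obtain ⟨x₀, hx0, hx1⟩ : ∃ x₀, max (max l 0) (ρ - r' / 4) < x₀ ∧ x₀ < ρ :=
    exists_between (max_lt (max_lt hl hρ) (by linarith))
  have hx0l : l < x₀ := lt_of_le_of_lt ((le_max_left _ _).trans (le_max_left _ _)) hx0
  have hx00 : 0 < x₀ := lt_of_le_of_lt ((le_max_right _ _).trans (le_max_left _ _)) hx0
  have hx0r : ρ - r' / 4 < x₀ := lt_of_le_of_lt (le_max_right _ _) hx0
  have hlt : (‖x₀ - ρ‖₊ : ENNReal) < ENNReal.ofReal r' := by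
    rw [← ENNReal.ofReal_coe_nnreal, coe_nnnorm, Real.norm_eq_abs, abs_sub_comm,
      abs_of_pos (by linarith)]
    exact (ENNReal.ofReal_lt_ofReal_iff hr'0).2 (by linarith)
  have hp2 := hp.changeOrigin hlt
  rw [add_sub_cancel] at hp2
  obtain ⟨y, hy1, hy2⟩ := exists_between hx1
  have hF := shift_series t ht x₀ y hx00.le hy1 (hs y (by linarith) hy2)
  set b : ℕ → ℝ := fun k => ∑' n, t n * (n.choose k : ℝ) * x₀ ^ (n - k) with hb
  have hb0 : ∀ k, 0 ≤ b k := fun k => tsum_nonneg fun n => by have := ht n; positivity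
  have hF' : HasFPowerSeriesAt E (FormalMultilinearSeries.ofScalars ℝ b) x₀ := by
    refine hF.congr ?_
    filter_upwards [Ioo_mem_nhds hx0l hx1] with x hx using hl' hx
  have heq := hF'.eq_formalMultilinearSeries hp2.hasFPowerSeriesAt
  set s : ℝ := 2 * (ρ - x₀) with hsdef
  have hs0 : 0 ≤ s := by linarith
  have hsum : Summable fun k => b k * s ^ k := by
    have h1 : (s.toNNReal : ENNReal) < (FormalMultilinearSeries.ofScalars ℝ b).radius := by
      rw [heq]
      refine lt_of_lt_of_le ?_ hp2.r_le
      have e : (‖x₀ - ρ‖₊ : ENNReal) = ENNReal.ofReal (ρ - x₀) := by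
        rw [← ENNReal.ofReal_coe_nnreal, coe_nnnorm, Real.norm_eq_abs, abs_sub_comm,
          abs_of_pos (by linarith)]
      rw [e, ← ENNReal.ofReal_sub _ (by linarith)]
      change ENNReal.ofReal s < _
      exact (ENNReal.ofReal_lt_ofReal_iff (by linarith)).2 (by linarith)
    have h2 := FormalMultilinearSeries.summable_norm_mul_pow _ h1
    refine h2.congr fun n => ?_
    rw [FormalMultilinearSeries.ofScalars_norm, Real.norm_of_nonneg (hb0 n),
        Real.coe_toNNReal _ hs0]
  refine ⟨x₀ + s, by linarith, ?_⟩
  have hk : ∀ k, Summable fun n => t n * (n.choose k : ℝ) * x₀ ^ (n - k) := by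
    intro k
    have h1 := (shift_sum t ht x₀ y hx00.le (hs y (by linarith) hy2) (y - x₀)
      (by rw [abs_of_pos (by linarith)]; linarith)).1 k
    exact (summable_mul_right_iff (pow_ne_zero k (by linarith))).1 h1
  refine summable_of_sum_range_le (c := ∑' k, b k * s ^ k) (fun n => ?_) (fun N => ?_)
  · have := ht n; positivity
  · have h1 : ∑ n ∈ Finset.range N, t n * (x₀ + s) ^ n = ∑ k ∈ Finset.range N,
        (∑ n ∈ Finset.range N, t n * (n.choose k : ℝ) * x₀ ^ (n - k)) * s ^ k := by
      simp only [Finset.sum_mul]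
      rw [Finset.sum_comm]
      refine Finset.sum_congr rfl fun n hn => ?_
      rw [add_comm, add_pow, Finset.mul_sum]
      rw [Finset.mem_range] at hn
      have : ∑ k ∈ Finset.range N, t n * (n.choose k : ℝ) * x₀ ^ (n - k) * s ^ k
        = ∑ k ∈ Finset.range (n + 1), t n * (n.choose k : ℝ) * x₀ ^ (n - k) * s ^ k := by
        symm
        apply Finset.sum_subset
        · intro z hz; simp at *; omega
        · intro z _ hz
          simp only [Finset.mem_range, not_lt] at hz
          rw [Nat.choose_eq_zero_of_lt (by omega)]; simp
      rw [this]
      refine Finset.sum_congr rfl fun k _ => by ring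
    rw [h1]
    refine le_trans (Finset.sum_le_sum fun k _ => ?_)
      (hsum.sum_le_tsum (Finset.range N) (fun k _ => by have := hb0 k; positivity))
    gcongr
    exact (hk k).sum_le_tsum (Finset.range N) (fun n _ => by have := ht n; positivity)

theorem summ_of_bound (t : ℕ → ℝ) (ht : ∀ n, 0 ≤ t n) (ρ : ℝ) (hρ : 0 < ρ) (C : ℝ)
    (hC : ∀ n : ℕ, 1 ≤ n → t n * ρ ^ n ≤ C / n) (y : ℝ) (hy : 0 ≤ y) (hy' : y < ρ) :
    Summable fun n => t n * y ^ n := by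
  have hC0 : 0 ≤ C := by
    have := hC 1 le_rfl
    have h1 := ht 1
    have : 0 ≤ t 1 * ρ ^ 1 := by positivity
    simp at *; linarith
  have hb : ∀ n, t n * ρ ^ n ≤ C + t 0 := by
    intro n
    rcases Nat.eq_zero_or_pos n with h | h
    · subst h; simp; exact hC0
    · refine (hC n h).trans ?_
      have h1 : (1 : ℝ) ≤ n := by exact_mod_cast h
      have := div_le_self hC0 h1
      linarith [ht 0]
  have hg : Summable fun n : ℕ => (C + t 0) * (y / ρ) ^ n :=
    (summable_geometric_of_lt_one (by positivity) ((div_lt_one hρ).2 hy')).mul_left _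
  refine Summable.of_nonneg_of_le (fun n => by have := ht n; positivity) (fun n => ?_) hg
  have e : t n * y ^ n = t n * ρ ^ n * (y / ρ) ^ n := by
    rw [div_pow]; field_simp
  rw [e]
  gcongr
  exact hb n

theorem F_ge_one (t : ℕ → ℝ) (ht : ∀ n, 0 ≤ t n) (h0 : t 0 = 1) (y : ℝ) (hy : 0 ≤ y)
    (hs : Summable fun n => t n * y ^ n) : 1 ≤ ∑' n, t n * y ^ n := by
  have := hs.sum_le_tsum {0} (fun n _ => by have := ht n; positivity)
  simpa [h0] using this

theorem F_le_log (t : ℕ → ℝ) (ht : ∀ n, 0 ≤ t n) (h0 : t 0 = 1) (ρ : ℝ) (hρ : 0 < ρ) (C : ℝ)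
    (hC : ∀ n : ℕ, 1 ≤ n → t n * ρ ^ n ≤ C / n) (y : ℝ) (hy : 0 ≤ y) (hy' : y < ρ) :
    ∑' n, t n * y ^ n ≤ 1 + C * (-Real.log (1 - y / ρ)) := by
  have hs := summ_of_bound t ht ρ hρ C hC y hy hy'
  rw [hs.tsum_eq_zero_add]
  have h1 : |y / ρ| < 1 := by
    rw [abs_of_nonneg (by positivity)]; exact (div_lt_one hρ).2 hy'
  have h2 := (Real.hasSum_pow_div_log_of_abs_lt_one h1).mul_left C
  have h3 := (summable_nat_add_iff 1).2 hs
  have h4 := hasSum_le (fun n => ?_) h3.hasSum h2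
  · simp only [h0, pow_zero, mul_one]
    linarith
  have h5 := hC (n + 1) (by omega)
  have e : t (n+1) * y ^ (n+1) = t (n+1) * ρ ^ (n+1) * (y / ρ) ^ (n+1) := by
    rw [div_pow]; field_simp
  rw [e]
  calc _ ≤ C / ((n+1 : ℕ) : ℝ) * (y / ρ) ^ (n+1) := by gcongr
    _ = _ := by push_cast; ring

open Filter Topology in
theorem F_pow_tendsto (t : ℕ → ℝ) (ht : ∀ n, 0 ≤ t n) (h0 : t 0 = 1) (ρ : ℝ) (hρ : 0 < ρ) (C : ℝ)
    (hC : ∀ n : ℕ, 1 ≤ n → t n * ρ ^ n ≤ C / n) (a : ℕ) (ha : 1 ≤ a) :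
    Tendsto (fun x => (∑' n, t n * x ^ n) ^ a * (x - ρ)) (𝓝[<] ρ) (𝓝 0) := by
  have ha' : (0 : ℝ) < 1 / a := by
    have : (0 : ℝ) < a := by exact_mod_cast ha
    positivity
  have hw : Tendsto (fun x => 1 - x / ρ) (𝓝[<] ρ) (𝓝[>] 0) := by
    rw [tendsto_nhdsWithin_iff]
    constructor
    · have : ContinuousAt (fun x => 1 - x / ρ) ρ := by fun_prop (disch := exact hρ.ne')
      have := this.tendsto
      simp only [div_self hρ.ne', sub_self] at this
      exact this.mono_left nhdsWithin_le_nhds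
    · filter_upwards [self_mem_nhdsWithin] with x hx
      have : x / ρ < 1 := (div_lt_one hρ).2 hx
      simp; exact this
  have h1 : Tendsto (fun w : ℝ => ((1 + C * (-Real.log w)) * w ^ (1 / a : ℝ)) ^ a * ρ)
      (𝓝[>] 0) (𝓝 0) := by
    have h2 := tendsto_log_mul_rpow_nhdsGT_zero ha'
    have h3 : Tendsto (fun w : ℝ => w ^ (1 / a : ℝ)) (𝓝[>] 0) (𝓝 0) := by
      have := (Real.continuousAt_rpow_const 0 (1 / a : ℝ) (Or.inr ha'.le)).tendsto
      rw [Real.zero_rpow ha'.ne'] at this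
      exact this.mono_left nhdsWithin_le_nhds
    have h4 := (((h3.sub (h2.const_mul C)).pow a).mul_const ρ)
    simp only [mul_zero, sub_zero] at h4
    rw [zero_pow (by omega), zero_mul] at h4
    refine h4.congr fun w => by ring
  have h2 := h1.comp hw
  refine squeeze_zero_norm' ?_ h2
  filter_upwards [Ioo_mem_nhdsLT hρ] with x hx
  have hx1 := F_le_log t ht h0 ρ hρ C hC x hx.1.le hx.2
  have hx2 := F_ge_one t ht h0 x hx.1.le (summ_of_bound t ht ρ hρ C hC x hx.1.le hx.2)
  have hw0 : 0 ≤ 1 - x / ρ := by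
    have := (div_lt_one hρ).2 hx.2; linarith
  rw [norm_mul, norm_pow, Real.norm_of_nonneg (by linarith), Real.norm_eq_abs,
    abs_sub_comm, abs_of_pos (by linarith [hx.2])]
  simp only [Function.comp]
  rw [mul_pow, ← Real.rpow_natCast (_ ^ _), ← Real.rpow_mul hw0, one_div_mul_cancel
    (by exact_mod_cast (by omega : a ≠ 0)), Real.rpow_one, mul_assoc]
  have : (1 - x / ρ) * ρ = ρ - x := by field_simp
  rw [this]
  have := hx.2
  gcongr

open Filter Topology in
theorem core (t : ℕ → ℝ) (ht : ∀ n, 0 ≤ t n) (h0 : t 0 = 1) (ρ : ℝ) (hρ : 0 < ρ) (C : ℝ)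
    (hC : ∀ n : ℕ, 1 ≤ n → t n * ρ ^ n ≤ C / n) (a : ℕ) (ha : 1 ≤ a)
    (U V : Polynomial ℝ) (hU : U ≠ 0) (hV : V ≠ 0) (G H : ℝ → ℝ) (hG : AnalyticAt ℝ G ρ)
    (hH : AnalyticAt ℝ H ρ) (hG0 : G ρ ≠ 0) (hH0 : H ρ ≠ 0)
    (h : ∀ x, 0 < x → x < ρ → U.eval x * ((∑' n, t n * x ^ n) ^ a * G x) = V.eval x * H x) :
    ∃ y, ρ < y ∧ Summable fun n => t n * y ^ n := by
  set F : ℝ → ℝ := fun x => ∑' n, t n * x ^ n with hF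
  have hge : ∀ x, 0 < x → x < ρ → 1 ≤ F x := fun x hx hx' =>
    F_ge_one t ht h0 x hx.le (summ_of_bound t ht ρ hρ C hC x hx.le hx')
  obtain ⟨u, hu, hu'⟩ := Polynomial.exists_eq_pow_rootMultiplicity_mul_and_not_dvd U hU ρ
  obtain ⟨v, hv, hv'⟩ := Polynomial.exists_eq_pow_rootMultiplicity_mul_and_not_dvd V hV ρ
  rw [Polynomial.dvd_iff_isRoot] at hu' hv'
  generalize Polynomial.rootMultiplicity ρ U = m at hu
  generalize Polynomial.rootMultiplicity ρ V = l at hv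
  let q : ℝ → ℝ := fun x => v.eval x * H x / (u.eval x * G x)
  have hpu : ∀ w : Polynomial ℝ, AnalyticAt ℝ (fun x => w.eval x) ρ := fun w =>
    AnalyticOnNhd.eval_polynomial w ρ (Set.mem_univ _)
  have hq : AnalyticAt ℝ q ρ := ((hpu v).mul hH).div ((hpu u).mul hG) (mul_ne_zero hu' hG0)
  have hq0 : q ρ ≠ 0 := div_ne_zero (mul_ne_zero hv' hH0) (mul_ne_zero hu' hG0)
  have hne : ∀ᶠ x in 𝓝[<] ρ, u.eval x * G x ≠ 0 :=
    (((hpu u).mul hG).continuousAt.eventually_ne (mul_ne_zero hu' hG0)).filter_mono nhdsWithin_le_nhds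
  have hrel : ∀ᶠ x in 𝓝[<] ρ, F x ^ a * (x - ρ) ^ m = q x * (x - ρ) ^ l := by
    filter_upwards [hne, Ioo_mem_nhdsLT hρ] with x hx hx'
    have h1 := h x hx'.1 hx'.2
    rw [hu, hv] at h1
    simp only [Polynomial.eval_mul, Polynomial.eval_pow, Polynomial.eval_sub, Polynomial.eval_X,
      Polynomial.eval_C] at h1
    simp only [q]
    rw [div_mul_eq_mul_div, eq_div_iff hx]
    linear_combination h1
  have hqt : Tendsto q (𝓝[<] ρ) (𝓝 (q ρ)) := hq.continuousAt.tendsto.mono_left nhdsWithin_le_nhds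
  have hxt : ∀ k : ℕ, 1 ≤ k → Tendsto (fun x : ℝ => (x - ρ) ^ k) (𝓝[<] ρ) (𝓝 0) := by
    intro k hk
    have : ContinuousAt (fun x : ℝ => (x - ρ) ^ k) ρ := by fun_prop
    have := this.tendsto
    rw [sub_self, zero_pow (by omega)] at this
    exact this.mono_left nhdsWithin_le_nhds
  have hlt : ∀ᶠ x in 𝓝[<] ρ, x - ρ ≠ 0 := by
    filter_upwards [self_mem_nhdsWithin] with x hx
    exact sub_ne_zero.2 (ne_of_lt hx)
  rcases lt_trichotomy m l with hml | hml | hml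
  · exfalso
    have h1 : Tendsto (fun x => F x ^ a) (𝓝[<] ρ) (𝓝 0) := by
      have := hqt.mul (hxt (l - m) (by omega))
      rw [mul_zero] at this
      refine this.congr' ?_
      filter_upwards [hrel, hlt] with x hx hx'
      have e : l = (l - m) + m := by omega
      rw [e, pow_add, ← mul_assoc] at hx
      exact (mul_right_cancel₀ (pow_ne_zero _ hx') hx).symm
    have h2 : (1 : ℝ) ≤ 0 := by
      refine ge_of_tendsto h1 ?_
      filter_upwards [Ioo_mem_nhdsLT hρ] with x hx
      exact one_le_pow₀ (hge x hx.1 hx.2)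
    linarith
  · subst hml
    have hrel' : ∀ᶠ x in 𝓝[<] ρ, F x ^ a = q x := by
      filter_upwards [hrel, hlt] with x hx hx'
      exact mul_right_cancel₀ (pow_ne_zero _ hx') hx
    have hq1 : 1 ≤ q ρ := by
      refine ge_of_tendsto hqt ?_
      filter_upwards [Ioo_mem_nhdsLT hρ, hrel'] with x hx hx'
      rw [← hx']
      exact one_le_pow₀ (hge x hx.1 hx.2)
    refine pringsheim t ht ρ hρ (summ_of_bound t ht ρ hρ C hC)
      (fun x => Real.exp (Real.log (q x) / a)) ?_ ?_
    · exact ((hq.log (by linarith)).div_const).rexp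
    · filter_upwards [Ioo_mem_nhdsLT hρ, hrel'] with x hx hx'
      have ha0 : (a : ℝ) ≠ 0 := by exact_mod_cast (by omega : a ≠ 0)
      rw [← hx', Real.log_pow, mul_div_cancel_left₀ _ ha0, Real.exp_log]
      linarith [hge x hx.1 hx.2]
  · exfalso
    have h1 := F_pow_tendsto t ht h0 ρ hρ C hC a ha
    have h2 : Tendsto (fun x : ℝ => (x - ρ) ^ (m - l - 1)) (𝓝[<] ρ) (𝓝 ((ρ - ρ) ^ (m - l - 1))) := by
      have : ContinuousAt (fun x : ℝ => (x - ρ) ^ (m - l - 1)) ρ := by fun_prop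
      exact this.tendsto.mono_left nhdsWithin_le_nhds
    have h3 := h1.mul h2
    rw [zero_mul] at h3
    have h4 : Tendsto q (𝓝[<] ρ) (𝓝 0) := by
      refine h3.congr' ?_
      filter_upwards [hrel, hlt] with x hx hx'
      have e : m = (1 + (m - l - 1)) + l := by omega
      rw [e, pow_add, ← mul_assoc] at hx
      rw [← mul_right_cancel₀ (pow_ne_zero _ hx') hx]
      simp only [hF]
      ring
    exact hq0 (tendsto_nhds_unique hqt h4)

def HasEv (φ : ℝ⟦X⟧) (x v : ℝ) : Prop :=
  (Summable fun n => ‖coeff n φ * x ^ n‖) ∧ ∑' n, coeff n φ * x ^ n = v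

theorem HasEv.mul {φ ψ : ℝ⟦X⟧} {x v w : ℝ} (h : HasEv φ x v) (h' : HasEv ψ x w) :
    HasEv (φ * ψ) x (v * w) := by
  have e : ∀ n, coeff n (φ * ψ) * x ^ n = ∑ kl ∈ Finset.HasAntidiagonal.antidiagonal n,
      (coeff kl.1 φ * x ^ kl.1) * (coeff kl.2 ψ * x ^ kl.2) := by
    intro n
    rw [coeff_mul, Finset.sum_mul]
    refine Finset.sum_congr rfl fun kl hkl => ?_
    rw [Finset.HasAntidiagonal.mem_antidiagonal] at hkl
    rw [← hkl, pow_add]; ring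
  have s1 := summable_norm_sum_mul_antidiagonal_of_summable_norm
    (f := fun n => coeff n φ * x ^ n) (g := fun n => coeff n ψ * x ^ n) h.1 h'.1
  have s2 := tsum_mul_tsum_eq_tsum_sum_antidiagonal_of_summable_norm
    (f := fun n => coeff n φ * x ^ n) (g := fun n => coeff n ψ * x ^ n) h.1 h'.1
  rw [h.2, h'.2] at s2
  constructor
  · refine s1.congr fun n => ?_
    rw [e]
  · rw [s2]
    exact tsum_congr e

theorem HasEv.poly (U : Polynomial ℝ) (x : ℝ) : HasEv (U : ℝ⟦X⟧) x (U.eval x) := by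
  have h0 : ∀ n ∉ Finset.range (U.natDegree + 1), coeff n (U : ℝ⟦X⟧) * x ^ n = 0 := by
    intro n hn
    rw [Finset.mem_range, not_lt] at hn
    rw [Polynomial.coeff_coe, Polynomial.coeff_eq_zero_of_natDegree_lt (by omega), zero_mul]
  constructor
  · apply summable_of_ne_finset_zero (s := Finset.range (U.natDegree + 1))
    intro n hn
    rw [h0 n hn, norm_zero]
  · rw [tsum_eq_sum h0, Polynomial.eval_eq_sum_range]
    simp

theorem HasEv.one (x : ℝ) : HasEv (1 : ℝ⟦X⟧) x 1 := by
  have := HasEv.poly 1 x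
  simpa using this

theorem HasEv.pow {φ : ℝ⟦X⟧} {x v : ℝ} (h : HasEv φ x v) (k : ℕ) : HasEv (φ ^ k) x (v ^ k) := by
  induction k with
  | zero => simpa using HasEv.one x
  | succ k ih => rw [pow_succ, pow_succ]; exact ih.mul h

theorem HasEv.mon {ι : Type*} (f : ι → ℝ⟦X⟧) (x : ℝ) (v : ι → ℝ) (α : ι →₀ ℕ)
    (h : ∀ i ∈ α.support, HasEv (f i) x (v i)) :
    HasEv (mon f α) x (∏ i ∈ α.support, v i ^ α i) := by
  classical
  unfold _root_.mon Finsupp.prod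
  generalize α.support = s at h
  induction s using Finset.induction_on with
  | empty => simpa using HasEv.one x
  | insert a s ha ih =>
    rw [Finset.prod_insert ha, Finset.prod_insert ha]
    exact ((h a (Finset.mem_insert_self _ _)).pow _).mul
      (ih fun i hi => h i (Finset.mem_insert_of_mem hi))

theorem analytic_half {ι : Type*} [DecidableEq ι] (t : ι → ℕ → ℝ) (ht : ∀ i n, 0 ≤ t i n) (h0 : ∀ i, t i 0 = 1)
    (ρ : ι → ℝ) (hρ : ∀ i, 0 < ρ i) (hinj : Function.Injective ρ) (C : ι → ℝ)
    (hC : ∀ i n, 1 ≤ n → t i n * ρ i ^ n ≤ C i / n)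
    (hns : ∀ i y, ρ i < y → ¬ Summable fun n => t i n * y ^ n)
    (α β : ι →₀ ℕ) (U V : Polynomial ℝ) (hU : U ≠ 0) (hV : V ≠ 0)
    (h : (U : ℝ⟦X⟧) * mon (fun i => PowerSeries.mk (t i)) α =
      (V : ℝ⟦X⟧) * mon (fun i => PowerSeries.mk (t i)) β)
    (i : ι) (hα : α i ≠ 0) (hβ : β i = 0)
    (hmin : ∀ j ∈ α.support ∪ β.support, ρ i ≤ ρ j) : False := by
  have hlt : ∀ j ∈ α.support ∪ β.support, j ≠ i → ρ i < ρ j := fun j hj hji =>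
    lt_of_le_of_ne (hmin j hj) fun h => hji (hinj h).symm
  let F : ι → ℝ → ℝ := fun j x => ∑' n, t j n * x ^ n
  have hsum : ∀ j x, 0 ≤ x → x < ρ j → Summable fun n => t j n * x ^ n := fun j x hx hx' =>
    summ_of_bound (t j) (ht j) (ρ j) (hρ j) (C j) (hC j) x hx hx'
  have hev : ∀ j x, 0 ≤ x → x < ρ j → HasEv (PowerSeries.mk (t j)) x (F j x) := by
    intro j x hx hx'
    constructor
    · simp only [coeff_mk]; exact (hsum j x hx hx').norm
    · simp only [coeff_mk]; rfl
  have han : ∀ j ∈ α.support ∪ β.support, j ≠ i → AnalyticAt ℝ (F j) (ρ i) ∧ F j (ρ i) ≠ 0 := by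
    intro j hj hji
    obtain ⟨y, hy, hy'⟩ := exists_between (hlt j hj hji)
    refine ⟨shift_analytic (t j) (ht j) (ρ i) y (hρ i).le hy
      (hsum j y ((hρ i).le.trans hy.le) hy'), ?_⟩
    have := F_ge_one (t j) (ht j) (h0 j) (ρ i) (hρ i).le (hsum j _ (hρ i).le (hlt j hj hji))
    exact (lt_of_lt_of_le one_pos this).ne'
  have hiα : i ∈ α.support := Finsupp.mem_support_iff.2 hα
  have hα' : ∀ j ∈ α.support.erase i, j ∈ α.support ∪ β.support ∧ j ≠ i := fun j hj =>
    ⟨Finset.mem_union_left _ (Finset.mem_of_mem_erase hj), Finset.ne_of_mem_erase hj⟩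
  have hβ' : ∀ j ∈ β.support, j ∈ α.support ∪ β.support ∧ j ≠ i := fun j hj =>
    ⟨Finset.mem_union_right _ hj, fun e => Finsupp.mem_support_iff.1 hj (e ▸ hβ)⟩
  obtain ⟨y, hy, hy'⟩ := core (t i) (ht i) (h0 i) (ρ i) (hρ i) (C i) (hC i) (α i) (by omega)
    U V hU hV (fun x => ∏ j ∈ α.support.erase i, F j x ^ α j)
    (fun x => ∏ j ∈ β.support, F j x ^ β j)
    (Finset.analyticAt_fun_prod _ fun j hj => (han j (hα' j hj).1 (hα' j hj).2).1.fun_pow _)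
    (Finset.analyticAt_fun_prod _ fun j hj => (han j (hβ' j hj).1 (hβ' j hj).2).1.fun_pow _)
    (Finset.prod_ne_zero_iff.2 fun j hj => pow_ne_zero _ (han j (hα' j hj).1 (hα' j hj).2).2)
    (Finset.prod_ne_zero_iff.2 fun j hj => pow_ne_zero _ (han j (hβ' j hj).1 (hβ' j hj).2).2)
    (by
      intro x hx hx'
      have e1 := (HasEv.poly U x).mul (HasEv.mon _ x (fun j => F j x) α
        fun j hj => hev j x hx.le (hx'.trans_le (hmin j (Finset.mem_union_left _ hj))))
      have e2 := (HasEv.poly V x).mul (HasEv.mon _ x (fun j => F j x) β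
        fun j hj => hev j x hx.le (hx'.trans_le (hmin j (Finset.mem_union_right _ hj))))
      rw [← Finset.mul_prod_erase _ _ hiα] at e1
      rw [h] at e1
      exact e1.2.symm.trans e2.2)
  exact hns i y hy hy'

theorem analytic_main {ι : Type*} (s : ι → ℕ → ℕ) (h0 : ∀ i, s i 0 = 1)
    (ρ : ι → ℝ) (hρ : ∀ i, 0 < ρ i) (hinj : Function.Injective ρ) (C : ι → ℝ)
    (hC : ∀ i n, 1 ≤ n → (s i n : ℝ) * ρ i ^ n ≤ C i / n)
    (hns : ∀ i y, ρ i < y → ¬ Summable fun n => (s i n : ℝ) * y ^ n)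
    (α β : ι →₀ ℕ) (hne : α ≠ β) (U V : Polynomial ℤ) (hU : U ≠ 0) (hV : V ≠ 0)
    (h : (U : ℤ⟦X⟧) * mon (fun i => PowerSeries.mk fun n => (s i n : ℤ)) α =
      (V : ℤ⟦X⟧) * mon (fun i => PowerSeries.mk fun n => (s i n : ℤ)) β) : False := by
  classical
  set f : ι → ℤ⟦X⟧ := fun i => PowerSeries.mk fun n => (s i n : ℤ) with hf
  have hfne : ∀ i, f i ≠ 0 := by
    intro i hi
    have : coeff 0 (f i) = 1 := by simp [hf, h0]
    rw [hi] at this; simp at this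
  have hα : α = (α - β) + α ⊓ β := by
    ext i; simp only [Finsupp.add_apply, Finsupp.tsub_apply, Finsupp.inf_apply]
    omega
  have hβ : β = (β - α) + α ⊓ β := by
    ext i; simp only [Finsupp.add_apply, Finsupp.tsub_apply, Finsupp.inf_apply]
    omega
  have h' : (U : ℤ⟦X⟧) * mon f (α - β) = (V : ℤ⟦X⟧) * mon f (β - α) := by
    have eα : mon f α = mon f (α - β) * mon f (α ⊓ β) := by rw [← mon_add, ← hα]
    have eβ : mon f β = mon f (β - α) * mon f (α ⊓ β) := by rw [← mon_add, ← hβ]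
    rw [eα, eβ, ← mul_assoc, ← mul_assoc] at h
    exact mul_right_cancel₀ (mon_ne_zero f hfne _) h
  let φ : ℤ →+* ℝ := Int.castRingHom ℝ
  have hφ : Function.Injective φ := Int.cast_injective
  have hU' : U.map φ ≠ 0 := (Polynomial.map_ne_zero_iff hφ).2 hU
  have hV' : V.map φ ≠ 0 := (Polynomial.map_ne_zero_iff hφ).2 hV
  have hfm : (fun i => PowerSeries.map φ (f i)) = fun i => PowerSeries.mk fun n => (s i n : ℝ) := by
    funext i; ext n; simp [hf, φ]
  have h2 : ((U.map φ : Polynomial ℝ) : ℝ⟦X⟧) *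
      mon (fun i => PowerSeries.mk fun n => (s i n : ℝ)) (α - β) =
      ((V.map φ : Polynomial ℝ) : ℝ⟦X⟧) *
      mon (fun i => PowerSeries.mk fun n => (s i n : ℝ)) (β - α) := by
    have := congrArg (PowerSeries.map φ) h'
    rw [map_mul, map_mul, mon_map, mon_map, hfm] at this
    rw [← Polynomial.polynomial_map_coe, ← Polynomial.polynomial_map_coe] at this
    exact this
  have hnon : ((α - β).support ∪ (β - α).support).Nonempty := by
    by_contra hc
    rw [Finset.not_nonempty_iff_eq_empty, Finset.union_eq_empty] at hc
    apply hne
    rw [Finsupp.support_eq_empty, Finsupp.support_eq_empty] at hc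
    ext i
    have h1 := DFunLike.congr_fun hc.1 i
    have h2 := DFunLike.congr_fun hc.2 i
    simp only [Finsupp.tsub_apply, Finsupp.coe_zero, Pi.zero_apply] at h1 h2
    omega
  obtain ⟨i, hi, hmin⟩ := Finset.exists_min_image _ ρ hnon
  have hdis : (α - β) i = 0 ∨ (β - α) i = 0 := by
    simp only [Finsupp.tsub_apply]; omega
  rw [Finset.mem_union, Finsupp.mem_support_iff, Finsupp.mem_support_iff] at hi
  have key := analytic_half (fun i n => (s i n : ℝ)) (fun i n => Nat.cast_nonneg _)
    (fun i => by simp [h0]) ρ hρ hinj C hC hns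
  by_cases hi0 : (α - β) i = 0
  · have hi1 : (β - α) i ≠ 0 := by tauto
    exact key (β - α) (α - β) _ _ hV' hU' h2.symm i hi1 hi0 (by rwa [Finset.union_comm])
  · exact key (α - β) (β - α) _ _ hU' hV' h2 i hi0 (by tauto) hmin

theorem central_sq_le (m : ℕ) : m.centralBinom ^ 2 * (2 * m + 1) ≤ 4 ^ (2 * m) := by
  induction m with
  | zero => simp
  | succ m ih =>
    have h1 := Nat.succ_mul_centralBinom_succ m
    have h2 : (m + 1) ^ 2 * ((m + 1).centralBinom ^ 2 * (2 * (m + 1) + 1)) ≤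
        (m + 1) ^ 2 * 4 ^ (2 * (m + 1)) := by
      calc (m + 1) ^ 2 * ((m + 1).centralBinom ^ 2 * (2 * (m + 1) + 1))
          = ((m + 1) * (m + 1).centralBinom) ^ 2 * (2 * m + 3) := by ring
        _ = (m.centralBinom ^ 2 * (2 * m + 1)) * (4 * ((2 * m + 1) * (2 * m + 3))) := by
            rw [h1]; ring
        _ ≤ 4 ^ (2 * m) * (4 * ((2 * m + 1) * (2 * m + 3))) := Nat.mul_le_mul_right _ ih
        _ ≤ 4 ^ (2 * m) * (16 * (m + 1) ^ 2) := by
            apply Nat.mul_le_mul_left; nlinarith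
        _ = _ := by rw [mul_add, pow_add]; ring
    exact Nat.le_of_mul_le_mul_left h2 (by positivity)

theorem choose_sq_le (N k : ℕ) : N.choose k ^ 2 * (N + 1) ≤ 4 ^ N := by
  rcases Nat.even_or_odd' N with ⟨m, rfl | rfl⟩
  · have h1 := Nat.choose_le_centralBinom k m
    calc _ ≤ m.centralBinom ^ 2 * (2 * m + 1) := by gcongr
      _ ≤ _ := central_sq_le m
  · have h1 := Nat.choose_le_middle k (2 * m + 1)
    have e : (2 * m + 1) / 2 = m := by omega
    rw [e] at h1
    have h2 : 2 * (2 * m + 1).choose m = (m + 1).centralBinom := by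
      rw [Nat.centralBinom_eq_two_mul_choose]
      have : 2 * (m + 1) = (2 * m + 1) + 1 := by ring
      rw [this, Nat.choose_succ_succ]
      have := Nat.choose_symm_half m
      simp only [Nat.succ_eq_add_one]
      omega
    have h3 := central_sq_le (m + 1)
    rw [← h2] at h3
    have h4 : 4 ^ (2 * (m + 1)) = 4 * 4 ^ (2 * m + 1) := by rw [mul_add, pow_add, pow_succ]; ring
    rw [h4] at h3
    calc _ ≤ (2 * m + 1).choose m ^ 2 * (2 * (m + 1) + 1) := by gcongr; omega
      _ ≤ _ := by nlinarith

theorem inv_moment (n : ℕ) (l u : ℝ) (hl : 0 < l) (hu : 0 ≤ u) (h : l + u = 1) :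
    ∑ N ∈ Finset.range (n + 1), (n.choose N : ℝ) * l ^ N * u ^ (n - N) / (N + 1) ≤
      1 / ((n + 1) * l) := by
  have h1 : (1 : ℝ) = ∑ N ∈ Finset.range (n + 2), l ^ N * u ^ (n + 1 - N) * ((n+1).choose N : ℝ) := by
    rw [← add_pow, h, one_pow]
  rw [Finset.sum_range_succ'] at h1
  have h2 : ∑ N ∈ Finset.range (n + 1), (n.choose N : ℝ) * l ^ N * u ^ (n - N) / (N + 1) =
      (∑ N ∈ Finset.range (n + 1), l ^ (N+1) * u ^ (n + 1 - (N+1)) * ((n+1).choose (N+1) : ℝ)) /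
        ((n + 1) * l) := by
    rw [Finset.sum_div]
    refine Finset.sum_congr rfl fun N _ => ?_
    have e : ((n + 1 : ℕ) : ℝ) * n.choose N = (n + 1).choose (N + 1) * ((N + 1 : ℕ) : ℝ) := by
      exact_mod_cast Nat.add_one_mul_choose_eq n N
    push_cast at e
    rw [Nat.add_sub_add_right, div_eq_div_iff (by positivity) (by positivity)]
    linear_combination l ^ N * u ^ (n - N) * l * e
  rw [h2]
  gcongr
  have : 0 ≤ l ^ 0 * u ^ (n + 1 - 0) * ((n+1).choose 0 : ℝ) := by positivity
  linarith

theorem mix_id (n j : ℕ) (hj : j ≤ n) (l u : ℝ) :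
    ∑ N ∈ Finset.range (n + 1), (n.choose N : ℝ) * l ^ N * u ^ (n - N) * ((N.choose j : ℝ) / 2 ^ N)
      = n.choose j * (l / 2) ^ j * (l / 2 + u) ^ (n - j) := by
  rw [Finset.range_eq_Ico, ← Finset.sum_Ico_consecutive _ (Nat.zero_le j) (by omega : j ≤ n + 1)]
  have h0 : ∑ N ∈ Finset.Ico 0 j, (n.choose N : ℝ) * l ^ N * u ^ (n - N) *
      ((N.choose j : ℝ) / 2 ^ N) = 0 := by
    refine Finset.sum_eq_zero fun N hN => ?_
    rw [Finset.mem_Ico] at hN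
    rw [Nat.choose_eq_zero_of_lt hN.2]; simp
  rw [h0, zero_add, Finset.sum_Ico_eq_sum_range, add_pow, Finset.mul_sum]
  have e : n + 1 - j = n - j + 1 := by omega
  rw [e]
  refine Finset.sum_congr rfl fun i hi => ?_
  rw [Finset.mem_range] at hi
  have h1 : (n.choose (j + i) : ℝ) * (j + i).choose j = n.choose j * (n - j).choose i := by
    have := Nat.choose_mul (n := n) (k := j + i) (s := j) (by omega)
    rw [Nat.add_sub_cancel_left] at this
    exact_mod_cast this
  have e2 : n - (j + i) = n - j - i := by omega
  rw [e2, div_pow, div_pow, pow_add, pow_add]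
  field_simp
  linear_combination l ^ j * l ^ i * u ^ (n - j - i) * h1

theorem binom_max_le (n j : ℕ) (hj : j ≤ n) (z : ℝ) (hz : 0 < z) (hz1 : z ≤ 1) :
    (n.choose j * z ^ j / (1 + z) ^ n) ^ 2 ≤ (1 + z) / (2 * z * (n + 1)) := by
  set l : ℝ := 2 * z / (1 + z) with hl
  set u : ℝ := (1 - z) / (1 + z) with hu
  have hl0 : 0 < l := by positivity
  have hu0 : 0 ≤ u := div_nonneg (by linarith) (by linarith)
  have hlu : l + u = 1 := by rw [hl, hu]; field_simp; ring
  have h1 := mix_id n j hj l u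
  have e1 : l / 2 = z / (1 + z) := by rw [hl]; field_simp
  have e2 : l / 2 + u = 1 / (1 + z) := by rw [hl, hu]; field_simp; ring
  have e3 : (n.choose j : ℝ) * (l / 2) ^ j * (l / 2 + u) ^ (n - j) =
      n.choose j * z ^ j / (1 + z) ^ n := by
    rw [e2, e1, div_pow, div_pow, one_pow]
    have : (1 + z) ^ n = (1 + z) ^ j * (1 + z) ^ (n - j) := by
      rw [← pow_add]; congr 1; omega
    rw [this]; field_simp
  rw [e3] at h1
  rw [← h1]
  have hw0 : ∀ N, 0 ≤ (n.choose N : ℝ) * l ^ N * u ^ (n - N) := fun N => by positivity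
  have h2 := Finset.sum_sq_le_sum_mul_sum_of_sq_le_mul (Finset.range (n + 1))
    (f := fun N => (n.choose N : ℝ) * l ^ N * u ^ (n - N))
    (g := fun N => (n.choose N : ℝ) * l ^ N * u ^ (n - N) * ((N.choose j : ℝ) / 2 ^ N) ^ 2)
    (r := fun N => (n.choose N : ℝ) * l ^ N * u ^ (n - N) * ((N.choose j : ℝ) / 2 ^ N))
    (fun N _ => hw0 N) (fun N _ => mul_nonneg (hw0 N) (sq_nonneg _)) (fun N _ => le_of_eq (by ring))
  refine h2.trans ?_
  have h3 : ∑ N ∈ Finset.range (n + 1), (n.choose N : ℝ) * l ^ N * u ^ (n - N) = 1 := by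
    have := add_pow l u n
    rw [hlu, one_pow] at this
    rw [this]
    exact Finset.sum_congr rfl fun N _ => by ring
  rw [h3, one_mul]
  have h4 : (1 + z) / (2 * z * (n + 1)) = 1 / ((n + 1) * l) := by
    rw [hl]; field_simp
  rw [h4]
  refine le_trans (Finset.sum_le_sum fun N _ => ?_) (inv_moment n l u hl0 hu0 hlu)
  rw [div_eq_mul_one_div _ ((N : ℝ) + 1)]
  refine mul_le_mul_of_nonneg_left ?_ (hw0 N)
  have h5 : (N.choose j : ℝ) ^ 2 * (N + 1) ≤ 4 ^ N := by exact_mod_cast choose_sq_le N j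
  rw [div_pow, ← pow_mul, mul_comm N 2, pow_mul, div_le_div_iff₀ (by positivity) (by positivity)]
  norm_num
  exact h5

theorem binom_max_le' (n k : ℕ) (hk : k ≤ n) (x : ℝ) (hx : 1 ≤ x) :
    (n.choose k * x ^ k / (1 + x) ^ n) ^ 2 ≤ (1 + x) / (2 * (n + 1)) := by
  have hx0 : 0 < x := by linarith
  have h := binom_max_le n (n - k) (by omega) (1 / x) (by positivity) ((div_le_one hx0).2 hx)
  rw [Nat.choose_symm hk] at h
  have e1 : (n.choose k : ℝ) * (1 / x) ^ (n - k) / (1 + 1 / x) ^ n =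
      n.choose k * x ^ k / (1 + x) ^ n := by
    have e : 1 + 1 / x = (1 + x) / x := by field_simp; ring
    have e' : x ^ n = x ^ k * x ^ (n - k) := by rw [← pow_add]; congr 1; omega
    rw [e, div_pow, div_pow, one_pow, e']
    field_simp
  have e2 : (1 + 1 / x) / (2 * (1 / x) * (n + 1)) = (1 + x) / (2 * (n + 1)) := by
    field_simp; ring
  rwa [e1, e2] at h

theorem binom_le_one (n k : ℕ) (hk : k ≤ n) (x : ℝ) (hx : 0 < x) :
    n.choose k * x ^ k / (1 + x) ^ n ≤ 1 := by
  rw [div_le_one (by positivity), add_comm, add_pow]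
  have := Finset.single_le_sum (f := fun m => x ^ m * 1 ^ (n - m) * (n.choose m : ℝ))
    (fun m _ => by positivity) (Finset.mem_range.2 (by omega : k < n + 1))
  simp only [one_pow, mul_one] at this ⊢
  linarith

theorem negbin_sum (n : ℕ) (y : ℝ) (hy : 0 < y) (hy1 : y < 1) :
    ∑ k ∈ Finset.range (n + 1), ((n + k).choose k : ℝ) * y ^ k * (1 - y) ^ n ≤ 1 / (1 - y) := by
  have hn : ‖y‖ < 1 := by rw [Real.norm_of_nonneg hy.le]; exact hy1
  have h1 := (summable_choose_mul_geometric_of_norm_lt_one n hn).sum_le_tsum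
    (Finset.range (n + 1)) (fun k _ => by positivity)
  rw [tsum_choose_mul_geometric_of_norm_lt_one n hn] at h1
  have hp : 0 < 1 - y := by linarith
  rw [← Finset.sum_mul]
  have e : ∀ k, (k + n).choose n = (n + k).choose k := fun k => by
    rw [add_comm]; exact Nat.choose_symm_add
  simp only [e] at h1
  calc _ ≤ 1 / (1 - y) ^ (n + 1) * (1 - y) ^ n := by gcongr
    _ = _ := by rw [pow_succ]; field_simp

theorem upper_one (r : ℕ) (hr : 3 ≤ r) (n : ℕ) :
    ∑ k ∈ Finset.range (n + 1), (n.choose k : ℝ) ^ r ≤ ((2 : ℝ) ^ r) ^ n * (1 / (n + 1)) := by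
  have key : ∀ k ∈ Finset.range (n + 1), (n.choose k : ℝ) ^ r ≤
      ((2 : ℝ) ^ r) ^ n * ((1 / (n + 1)) * (n.choose k / 2 ^ n)) := by
    intro k hk
    rw [Finset.mem_range] at hk
    have h1 := binom_max_le' n k (by omega) 1 le_rfl
    have h2 := binom_le_one n k (by omega) 1 one_pos
    have e : (1 + 1 : ℝ) = 2 := by norm_num
    simp only [one_pow, mul_one, e] at h1 h2
    have e3 : (n.choose k : ℝ) ^ r = ((2 : ℝ) ^ r) ^ n * (n.choose k / 2 ^ n) ^ r := by
      rw [div_pow, ← pow_mul, ← pow_mul, mul_comm r n]; field_simp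
    rw [e3]
    gcongr
    calc ((n.choose k : ℝ) / 2 ^ n) ^ r ≤ (n.choose k / 2 ^ n) ^ 3 :=
          pow_le_pow_of_le_one (by positivity) h2 hr
      _ = (n.choose k / 2 ^ n) ^ 2 * (n.choose k / 2 ^ n) := by ring
      _ ≤ _ := by
        gcongr
        refine h1.trans (le_of_eq ?_)
        field_simp
  refine (Finset.sum_le_sum key).trans ?_
  rw [← Finset.mul_sum, ← Finset.mul_sum, ← Finset.sum_div]
  have : ∑ k ∈ Finset.range (n + 1), (n.choose k : ℝ) = 2 ^ n := by
    exact_mod_cast Nat.sum_range_choose n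
  rw [this, div_self (by positivity), mul_one]

theorem upper_two (d r : ℕ) (hr : 1 ≤ r) (hdr : 2 ≤ d * r) (x y : ℝ) (hx : 1 ≤ x) (hy : 0 < y)
    (hy1 : y < 1) (hxy : x ^ d * y = 1) (n : ℕ) :
    ∑ k ∈ Finset.range (n + 1), (n.choose k : ℝ) ^ (d * r) * ((n + k).choose k : ℝ) ^ r ≤
      (((1 + x) ^ d / (1 - y)) ^ r) ^ n *
        ((1 + x) / (2 * (n + 1)) * (1 / (1 - y)) ^ r) := by
  have hp : 0 < 1 - y := by linarith
  have hx0 : 0 < x := by linarith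
  have hQ := negbin_sum n y hy hy1
  set K := 1 / (1 - y) with hK
  have hK0 : 0 < K := by positivity
  have key : ∀ k ∈ Finset.range (n + 1), (n.choose k : ℝ) ^ (d * r) * ((n + k).choose k : ℝ) ^ r ≤
      (((1 + x) ^ d / (1 - y)) ^ r) ^ n * ((1 + x) / (2 * (n + 1)) *
        (K ^ (r - 1) * (((n + k).choose k : ℝ) * y ^ k * (1 - y) ^ n))) := by
    intro k hk
    have hQk : ((n + k).choose k : ℝ) * y ^ k * (1 - y) ^ n ≤ K :=
      (Finset.single_le_sum (f := fun k => ((n + k).choose k : ℝ) * y ^ k * (1 - y) ^ n)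
        (fun m _ => by positivity) hk).trans hQ
    rw [Finset.mem_range] at hk
    have h1 := binom_max_le' n k (by omega) x hx
    have h2 := binom_le_one n k (by omega) x hx0
    have e3 : (n.choose k : ℝ) ^ (d * r) * ((n + k).choose k : ℝ) ^ r =
        (((1 + x) ^ d / (1 - y)) ^ r) ^ n * ((n.choose k * x ^ k / (1 + x) ^ n) ^ (d * r) *
          (((n + k).choose k : ℝ) * y ^ k * (1 - y) ^ n) ^ r) := by
      have e4 : (x ^ k) ^ (d * r) * (y ^ k) ^ r = 1 := by
        calc (x ^ k) ^ (d * r) * (y ^ k) ^ r = (x ^ d * y) ^ (k * r) := by ring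
          _ = 1 := by rw [hxy, one_pow]
      have e5 : (((1 + x) ^ d / (1 - y)) ^ r) ^ n =
          ((1 + x) ^ n) ^ (d * r) / ((1 - y) ^ n) ^ r := by
        rw [div_pow, div_pow]
        congr 1
        · ring
        · ring
      rw [e5, mul_pow, mul_pow, div_pow, mul_pow]
      have q1 : ((1 + x) ^ n) ^ (d * r) ≠ 0 := by positivity
      have q2 : ((1 - y) ^ n) ^ r ≠ 0 := by positivity
      rw [div_mul_eq_mul_div, eq_div_iff q2]
      field_simp
      rw [mul_assoc, e4, mul_one]
    rw [e3]
    gcongr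
    · exact (pow_le_pow_of_le_one (by positivity) h2 hdr).trans h1
    · obtain ⟨r', rfl⟩ : ∃ r', r = r' + 1 := ⟨r - 1, by omega⟩
      rw [Nat.add_sub_cancel, pow_succ]
      gcongr
  refine (Finset.sum_le_sum key).trans ?_
  rw [← Finset.mul_sum, ← Finset.mul_sum, ← Finset.mul_sum]
  gcongr
  obtain ⟨r', rfl⟩ : ∃ r', r = r' + 1 := ⟨r - 1, by omega⟩
  rw [Nat.add_sub_cancel, pow_succ]
  gcongr

theorem mode_bound (n k₀ : ℕ) (x : ℝ) (hx : 0 < x) (h1 : (k₀ : ℝ) * (1 + x) ≤ n * x)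
    (h2 : (n : ℝ) * x < (k₀ + 1) * (1 + x)) :
    (1 + x) ^ n ≤ (1 + x) * (n + 1) * (n.choose k₀ * x ^ k₀) := by
  set P : ℕ → ℝ := fun k => n.choose k * x ^ k with hP
  have hP0 : ∀ k, 0 ≤ P k := fun k => by simp only [hP]; positivity
  have hrec : ∀ k, k ≤ n → P (k + 1) * (k + 1) = P k * ((n - k) * x) := by
    intro k hk
    have := Nat.choose_succ_right_eq n k
    have e : (n.choose (k + 1) : ℝ) * (k + 1) = n.choose k * (n - k) := by
      rw [← Nat.cast_sub hk]; exact_mod_cast this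
    simp only [hP, pow_succ]
    linear_combination x ^ k * x * e
  have hk0n : k₀ ≤ n := by
    have : (k₀ : ℝ) ≤ n := by
      by_contra hc
      push Not at hc
      nlinarith
    exact_mod_cast this
  have hinc : ∀ k m, k ≤ m → m ≤ k₀ → P k ≤ P m := by
    intro k m hkm
    induction m, hkm using Nat.le_induction with
    | base => intro _; exact le_rfl
    | succ m hm ih =>
      intro hm'
      refine (ih (by omega)).trans ?_
      have h3 := hrec m (by omega)
      have h4 : (m : ℝ) + 1 ≤ k₀ := by exact_mod_cast hm'
      have h5 : (m : ℝ) + 1 ≤ (n - m) * x := by nlinarith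
      have h6 : P m * (m + 1) ≤ P (m + 1) * (m + 1) := by
        rw [h3]; exact mul_le_mul_of_nonneg_left h5 (hP0 m)
      exact le_of_mul_le_mul_right h6 (by positivity)
  have hdec : ∀ m, k₀ + 1 ≤ m → P m ≤ P (k₀ + 1) := by
    intro m hm
    induction m, hm using Nat.le_induction with
    | base => exact le_rfl
    | succ m hm ih =>
      refine le_trans ?_ ih
      rcases le_or_gt n m with hnm | hnm
      · have : P (m + 1) = 0 := by
          simp only [hP]; rw [Nat.choose_eq_zero_of_lt (by omega)]; simp
        rw [this]; exact hP0 m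
      · have h3 := hrec m (by omega)
        have h4 : (k₀ : ℝ) + 1 ≤ m := by exact_mod_cast hm
        have h5 : (n - m) * x ≤ (m : ℝ) + 1 := by nlinarith
        have h6 : P (m + 1) * (m + 1) ≤ P m * (m + 1) := by
          rw [h3]; exact mul_le_mul_of_nonneg_left h5 (hP0 m)
        exact le_of_mul_le_mul_right h6 (by positivity)
  have hstep : P (k₀ + 1) ≤ (1 + x) * P k₀ := by
    have h3 := hrec k₀ hk0n
    have hk : (0 : ℝ) ≤ k₀ := Nat.cast_nonneg _
    have h5 : (n - k₀) * x ≤ (1 + x) * ((k₀ : ℝ) + 1) := by nlinarith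
    have h6 : P (k₀ + 1) * (k₀ + 1) ≤ (1 + x) * P k₀ * (k₀ + 1) := by
      rw [h3]
      have := mul_le_mul_of_nonneg_left h5 (hP0 k₀)
      linarith
    exact le_of_mul_le_mul_right h6 (by positivity)
  have hall : ∀ k, P k ≤ (1 + x) * P k₀ := by
    intro k
    rcases le_or_gt k k₀ with hk | hk
    · have := hinc k k₀ hk le_rfl
      nlinarith [hP0 k₀]
    · exact (hdec k hk).trans hstep
  calc (1 + x) ^ n = ∑ k ∈ Finset.range (n + 1), P k := by
        rw [add_comm, add_pow]
        exact Finset.sum_congr rfl fun k _ => by simp only [hP]; simp; ring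
    _ ≤ ∑ k ∈ Finset.range (n + 1), (1 + x) * P k₀ := Finset.sum_le_sum fun k _ => hall k
    _ = _ := by rw [Finset.sum_const, Finset.card_range]; simp; ring

theorem lower_one (n : ℕ) : ∃ k ≤ n, (2 : ℝ) ^ n ≤ 2 * (2 * n + 1) ^ 1 * n.choose k := by
  refine ⟨n / 2, Nat.div_le_self _ _, ?_⟩
  have h1 : ((n / 2 : ℕ) : ℝ) * (1 + 1) ≤ n * 1 := by
    have : n / 2 * (1 + 1) ≤ n * 1 := by omega
    exact_mod_cast this
  have h2 : (n : ℝ) * 1 < ((n / 2 : ℕ) + 1) * (1 + 1) := by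
    have : n * 1 < (n / 2 + 1) * (1 + 1) := by omega
    exact_mod_cast this
  have := mode_bound n (n / 2) 1 one_pos h1 h2
  simp only [one_pow, mul_one] at this
  have e : (1 + 1 : ℝ) = 2 := by norm_num
  rw [e] at this
  refine this.trans ?_
  rw [pow_one]
  have : (0 : ℝ) ≤ n := Nat.cast_nonneg _
  gcongr
  linarith

theorem lower_two (d : ℕ) (x κ : ℝ) (hκ : 0 < κ) (hκ1 : κ < 1) (hx : 0 < x)
    (hκx : κ * (1 + x) = x) (hd : x ^ d * κ = 1 + κ) (n : ℕ) :
    ∃ k ≤ n, ((1 + x) ^ d * (1 + κ)) ^ n ≤ ((1 + x) ^ d * (1 + κ)) * (2 * n + 1) ^ (d + 1) *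
      ((n.choose k : ℝ) ^ d * (n + k).choose k) := by
  set k := ⌊κ * n⌋₊ with hk
  have hn : (0 : ℝ) ≤ n := Nat.cast_nonneg _
  have hk1 : (k : ℝ) ≤ κ * n := Nat.floor_le (by positivity)
  have hk2 : κ * n < k + 1 := Nat.lt_floor_add_one _
  have hkn' : (k : ℝ) ≤ n := by nlinarith
  have hkn : k ≤ n := by exact_mod_cast hkn'
  refine ⟨k, hkn, ?_⟩
  have m1 := mode_bound n k x hx (by
    calc (k : ℝ) * (1 + x) ≤ κ * n * (1 + x) := by gcongr
      _ = n * x := by linear_combination (n : ℝ) * hκx) (by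
    calc (n : ℝ) * x = κ * n * (1 + x) := by linear_combination -(n : ℝ) * hκx
      _ < _ := by gcongr)
  have m2 := mode_bound (n + k) k κ hκ (by push_cast; linarith) (by push_cast; linarith)
  have hpos : 0 < x ^ (k * d) * κ ^ k := by positivity
  refine le_of_mul_le_mul_right ?_ hpos
  have e1 : x ^ (k * d) * κ ^ k = (1 + κ) ^ k := by
    rw [← hd]; ring
  calc ((1 + x) ^ d * (1 + κ)) ^ n * (x ^ (k * d) * κ ^ k)
      = ((1 + x) ^ n) ^ d * (1 + κ) ^ (n + k) := by rw [e1, mul_pow, pow_add]; ring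
    _ ≤ ((1 + x) * (n + 1) * (n.choose k * x ^ k)) ^ d *
        ((1 + κ) * ((n + k : ℕ) + 1) * ((n + k).choose k * κ ^ k)) := by gcongr
    _ ≤ ((1 + x) * (2 * n + 1) * (n.choose k * x ^ k)) ^ d *
        ((1 + κ) * (2 * n + 1) * ((n + k).choose k * κ ^ k)) := by
        push_cast
        gcongr
        · linarith
        · linarith
    _ = _ := by
        simp only [mul_pow]; ring

open Filter Topology in
theorem not_summable_of_growth (s t : ℕ → ℝ) (G A : ℝ) (hG : 0 < G) (m r : ℕ)
    (ht : ∀ n, G ^ n ≤ A * (2 * n + 1) ^ m * t n) (hA : 0 < A)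
    (hst : ∀ n, t n ^ r ≤ s n) (y : ℝ) (hy : (G ^ r)⁻¹ < y) :
    ¬ Summable fun n => s n * y ^ n := by
  intro hs
  have hy0 : 0 < y := lt_trans (by positivity) hy
  have hGy : 1 < G ^ r * y := by
    rw [inv_lt_iff_one_lt_mul₀ (by positivity)] at hy
    linarith
  have h1 := hs.tendsto_atTop_zero
  have h2 := tendsto_pow_const_div_const_pow_of_one_lt (m * r) hGy
  have h3 := (h2.mul h1).const_mul (A ^ r * 3 ^ (m * r))
  simp only [mul_zero] at h3
  have h4 : (1 : ℝ) ≤ 0 := by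
    refine ge_of_tendsto h3 ?_
    filter_upwards [eventually_ge_atTop 1] with n hn
    have hn' : (1 : ℝ) ≤ n := by exact_mod_cast hn
    have h5 : (G ^ n) ^ r ≤ (A * (2 * n + 1) ^ m) ^ r * s n := by
      calc (G ^ n) ^ r ≤ (A * (2 * n + 1) ^ m * t n) ^ r := by
            gcongr; exact ht n
        _ = (A * (2 * n + 1) ^ m) ^ r * t n ^ r := by rw [mul_pow]
        _ ≤ _ := by gcongr; exact hst n
    have hsn : 0 ≤ s n := by
      by_contra hc
      push Not at hc
      have : 0 < (A * (2 * (n : ℝ) + 1) ^ m) ^ r := by positivity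
      have : 0 < (G ^ n) ^ r := by positivity
      nlinarith
    have h6 : (A * (2 * n + 1) ^ m) ^ r ≤ A ^ r * 3 ^ (m * r) * (n : ℝ) ^ (m * r) := by
      calc (A * (2 * (n : ℝ) + 1) ^ m) ^ r ≤ (A * (3 * n) ^ m) ^ r := by
            gcongr; linarith
        _ = _ := by rw [mul_pow, ← pow_mul, mul_pow]; ring
    have h7 : (G ^ n) ^ r ≤ A ^ r * 3 ^ (m * r) * (n : ℝ) ^ (m * r) * s n :=
      h5.trans (mul_le_mul_of_nonneg_right h6 hsn)
    have e : A ^ r * 3 ^ (m * r) * ((n : ℝ) ^ (m * r) / (G ^ r * y) ^ n * (s n * y ^ n)) =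
        A ^ r * 3 ^ (m * r) * (n : ℝ) ^ (m * r) * s n / (G ^ n) ^ r := by
      rw [mul_pow, ← pow_mul, ← pow_mul, mul_comm r n]
      field_simp
    rw [e, one_le_div (by positivity)]
    exact h7
  linarith

theorem quad_pow (q : ℕ) (u : ℝ) (a b : ℚ) (ha : 0 < a) (hb : 0 < b) (hu : u = a + b * √(q : ℝ))
    (r : ℕ) (hr : 1 ≤ r) : ∃ c d : ℚ, 0 < c ∧ 0 < d ∧ u ^ r = c + d * √(q : ℝ) := by
  induction r, hr using Nat.le_induction with
  | base => exact ⟨a, b, ha, hb, by rw [pow_one, hu]⟩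
  | succ r hr ih =>
    obtain ⟨c, d, hc, hd, h⟩ := ih
    refine ⟨c * a + d * b * q, c * b + d * a, by positivity, by positivity, ?_⟩
    have hs : √(q : ℝ) * √(q : ℝ) = q := Real.mul_self_sqrt (Nat.cast_nonneg _)
    rw [pow_succ, h, hu]
    push_cast
    linear_combination (d : ℝ) * b * hs

theorem quad_irr (q : ℕ) (hq : Irrational √(q : ℝ)) (c d e : ℚ) (hd : d ≠ 0) :
    (c : ℝ) + d * √(q : ℝ) ≠ e := by
  intro h
  apply hq
  refine ⟨(e - c) / d, ?_⟩
  have : (d : ℝ) ≠ 0 := by exact_mod_cast hd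
  push_cast
  field_simp
  linarith

theorem irr_two : Irrational √((2 : ℕ) : ℝ) := Nat.prime_two.irrational_sqrt
theorem irr_five : Irrational √((5 : ℕ) : ℝ) := (by norm_num : Nat.Prime 5).irrational_sqrt
theorem irr_ten : Irrational √((10 : ℕ) : ℝ) := by
  rw [irrational_sqrt_natCast_iff]
  rintro ⟨k, hk⟩
  have : k ≤ 3 := by nlinarith
  interval_cases k <;> omega

theorem quad_ne (a b c d : ℚ) (hb : 0 < b) (hd : 0 < d) :
    (a : ℝ) + b * √((2 : ℕ) : ℝ) ≠ c + d * √((5 : ℕ) : ℝ) := by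
  intro h
  have h2 : √((2 : ℕ) : ℝ) * √((2 : ℕ) : ℝ) = 2 := Real.mul_self_sqrt (by norm_num)
  have h5 : √((5 : ℕ) : ℝ) * √((5 : ℕ) : ℝ) = 5 := Real.mul_self_sqrt (by norm_num)
  have h10 : √((10 : ℕ) : ℝ) = √((2 : ℕ) : ℝ) * √((5 : ℕ) : ℝ) := by
    rw [← Real.sqrt_mul (by norm_num)]; norm_num
  refine quad_irr 10 irr_ten (2 * b ^ 2 + 5 * d ^ 2) (-2 * b * d) ((c - a) ^ 2) ?_ ?_
  · have : 0 < b * d := mul_pos hb hd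
    intro h0; nlinarith
  · push_cast at h h2 h5 h10 ⊢
    rw [h10]
    have e : (b : ℝ) * √2 - d * √5 = c - a := by linarith
    rw [← e]
    linear_combination (-(b : ℝ) ^ 2) * h2 - (d : ℝ) ^ 2 * h5

theorem fam_two (d r : ℕ) (hr : 1 ≤ r) (hdr : 2 ≤ d * r) (x κ G : ℝ) (hκ : 0 < κ) (hκ1 : κ < 1)
    (hx : 1 ≤ x) (hκx : κ * (1 + x) = x) (hd : x ^ d * κ = 1 + κ)
    (hG : (1 + x) ^ d * (1 + κ) = G) :
    (∃ C : ℝ, ∀ n : ℕ, 1 ≤ n → (TT (d * r) r n : ℝ) * ((G ^ r)⁻¹) ^ n ≤ C / n) ∧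
    ∀ y, (G ^ r)⁻¹ < y → ¬ Summable fun n => (TT (d * r) r n : ℝ) * y ^ n := by
  have hx0 : 0 < x := by linarith
  have hG0 : 0 < G := by rw [← hG]; positivity
  constructor
  · set y : ℝ := κ / (1 + κ) with hy
    have hy0 : 0 < y := by positivity
    have hy2 : 1 - y = 1 / (1 + κ) := by rw [hy]; field_simp; ring
    have hy1 : y < 1 := by
      have : 0 < 1 / (1 + κ) := by positivity
      linarith
    have hxy : x ^ d * y = 1 := by
      rw [hy, ← mul_div_assoc, hd, div_self (by positivity)]
    refine ⟨(1 + x) * (1 / (1 - y)) ^ r, fun n hn => ?_⟩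
    have h := upper_two d r hr hdr x y hx hy0 hy1 hxy n
    have e : (1 + x) ^ d / (1 - y) = G := by rw [hy2, ← hG]; field_simp
    rw [e] at h
    have eT : (TT (d * r) r n : ℝ) =
        ∑ k ∈ Finset.range (n + 1), (n.choose k : ℝ) ^ (d * r) * ((n + k).choose k : ℝ) ^ r := by
      unfold TT; push_cast; rfl
    rw [eT, inv_pow, ← div_eq_mul_inv, div_le_iff₀ (by positivity)]
    refine h.trans ?_
    have hn' : (0 : ℝ) < n := by exact_mod_cast hn
    have h1y : 0 < 1 - y := by linarith
    rw [mul_comm]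
    gcongr
    rw [div_mul_eq_mul_div]
    gcongr
    linarith
  · have hl := lower_two d x κ hκ hκ1 hx0 hκx hd
    choose k hk hk' using hl
    rw [hG] at hk'
    intro y hy
    refine not_summable_of_growth _ (fun n => (n.choose (k n) : ℝ) ^ d * (n + k n).choose (k n))
      G G hG0 (d + 1) r hk' hG0 (fun n => ?_) y hy
    unfold TT
    push_cast
    have := Finset.single_le_sum
      (f := fun k => (n.choose k : ℝ) ^ (d * r) * ((n + k).choose k : ℝ) ^ r)
      (fun m _ => by positivity) (Finset.mem_range.2 (by have := hk n; omega : k n < n + 1))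
    rw [mul_pow, ← pow_mul]
    exact this

theorem fam_one (r : ℕ) (hr : 3 ≤ r) :
    (∃ C : ℝ, ∀ n : ℕ, 1 ≤ n → (TT r 0 n : ℝ) * (((2 : ℝ) ^ r)⁻¹) ^ n ≤ C / n) ∧
    ∀ y, ((2 : ℝ) ^ r)⁻¹ < y → ¬ Summable fun n => (TT r 0 n : ℝ) * y ^ n := by
  have eT : ∀ n, (TT r 0 n : ℝ) = ∑ k ∈ Finset.range (n + 1), (n.choose k : ℝ) ^ r := by
    intro n; unfold TT; push_cast; simp
  constructor
  · refine ⟨1, fun n hn => ?_⟩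
    rw [eT, inv_pow, ← div_eq_mul_inv, div_le_iff₀ (by positivity)]
    refine (upper_one r hr n).trans ?_
    have hn' : (0 : ℝ) < n := by exact_mod_cast hn
    rw [mul_comm]
    gcongr
    linarith
  · choose k hk hk' using lower_one
    intro y hy
    refine not_summable_of_growth _ (fun n => (n.choose (k n) : ℝ))
      2 2 two_pos 1 r hk' two_pos (fun n => ?_) y hy
    rw [eT]
    exact Finset.single_le_sum (f := fun k => (n.choose k : ℝ) ^ r)
      (fun m _ => by positivity) (Finset.mem_range.2 (by have := hk n; omega : k n < n + 1))

theorem fam_A (r : ℕ) (hr : 2 ≤ r) :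
    (∃ C : ℝ, ∀ n : ℕ, 1 ≤ n → (TT r r n : ℝ) * (((3 + 2 * √2) ^ r)⁻¹) ^ n ≤ C / n) ∧
    ∀ y, ((3 + 2 * √2) ^ r)⁻¹ < y → ¬ Summable fun n => (TT r r n : ℝ) * y ^ n := by
  have h2 : √2 * √2 = 2 := Real.mul_self_sqrt (by norm_num)
  have h0 : 0 < √2 := by positivity
  have h1 : √2 < 2 := by nlinarith
  have := fam_two 1 r (by omega) (by omega) (1 + √2) (√2 / 2) (3 + 2 * √2) (by positivity)
    (by linarith) (by linarith) (by linarith) (by linarith) (by linarith)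
  rwa [one_mul] at this

theorem fam_B (r : ℕ) (hr : 1 ≤ r) :
    (∃ C : ℝ, ∀ n : ℕ, 1 ≤ n → (TT (2 * r) r n : ℝ) * (((11 + 5 * √5) / 2) ^ r)⁻¹ ^ n ≤ C / n) ∧
    ∀ y, (((11 + 5 * √5) / 2) ^ r)⁻¹ < y → ¬ Summable fun n => (TT (2 * r) r n : ℝ) * y ^ n := by
  have h2 : √5 * √5 = 5 := Real.mul_self_sqrt (by norm_num)
  have h0 : 0 < √5 := by positivity
  have h1 : √5 < 3 := by nlinarith
  have h3 : 2 < √5 := by nlinarith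
  exact fam_two 2 r hr (by omega) ((1 + √5) / 2) ((√5 - 1) / 2) ((11 + 5 * √5) / 2) (by linarith)
    (by linarith) (by linarith) (by linear_combination h2 / 4)
    (by linear_combination (1 + √5) * h2 / 8) (by linear_combination (√5 + 7) * h2 / 8)

noncomputable def famBase : FamIdx → ℝ
  | .inl _ => 2
  | .inr (.inl _) => 3 + 2 * √2
  | .inr (.inr _) => (11 + 5 * √5) / 2

def famExp : FamIdx → ℕ
  | .inl r => r
  | .inr (.inl r) => r
  | .inr (.inr r) => r

def famSeq : FamIdx → ℕ → ℕ
  | .inl r => TT r 0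
  | .inr (.inl r) => TT r r
  | .inr (.inr r) => TT (2 * (r : ℕ)) r

theorem famSeries_eq (i : FamIdx) :
    famSeries i = PowerSeries.mk fun n => (famSeq i n : ℂ) := by
  rcases i with r | r | r
  · simp only [famSeries, famSeq, TT]; push_cast; simp
  · simp only [famSeries, famSeq, TT]; push_cast; rfl
  · simp only [famSeries, famSeq, TT]; push_cast; rfl

theorem famSeq_zero (i : FamIdx) : famSeq i 0 = 1 := by
  rcases i with r | r | r <;> exact TT_zero _ _

theorem famSeq_lucas (i : FamIdx) (p : ℕ) [Fact p.Prime] (n m : ℕ) (hm : m < p) :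
    ((famSeq i (n * p + m) : ℕ) : ZMod p) = famSeq i n * famSeq i m := by
  rcases i with r | r | r
  · exact TT_lucas _ _ (by have := r.2; omega) p n m hm
  · exact TT_lucas _ _ (by have := r.2; omega) p n m hm
  · exact TT_lucas _ _ (by have := r.2; omega) p n m hm

theorem famSeq_growth (i : FamIdx) :
    (∃ C : ℝ, ∀ n : ℕ, 1 ≤ n → (famSeq i n : ℝ) * ((famBase i ^ famExp i)⁻¹) ^ n ≤ C / n) ∧
    ∀ y, (famBase i ^ famExp i)⁻¹ < y → ¬ Summable fun n => (famSeq i n : ℝ) * y ^ n := by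
  rcases i with r | r | r
  · exact fam_one r r.2
  · exact fam_A r r.2
  · exact fam_B r r.2

theorem famBase_one_lt (i : FamIdx) : 1 < famBase i := by
  have h2 : 0 ≤ √2 := by positivity
  have h5 : 0 ≤ √5 := by positivity
  rcases i with r | r | r <;> simp only [famBase] <;> linarith

theorem famA_pow (r : ℕ) (hr : 1 ≤ r) :
    ∃ c d : ℚ, 0 < c ∧ 0 < d ∧ (3 + 2 * √2) ^ r = c + d * √((2 : ℕ) : ℝ) :=
  quad_pow 2 _ 3 2 (by norm_num) (by norm_num) (by push_cast; ring) r hr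

theorem famB_pow (r : ℕ) (hr : 1 ≤ r) :
    ∃ c d : ℚ, 0 < c ∧ 0 < d ∧ ((11 + 5 * √5) / 2) ^ r = c + d * √((5 : ℕ) : ℝ) :=
  quad_pow 5 _ (11 / 2) (5 / 2) (by norm_num) (by norm_num) (by push_cast; ring) r hr

theorem famAB (r s : ℕ) (hr : 1 ≤ r) (hs : 1 ≤ s) : (3 + 2 * √2) ^ r ≠ ((11 + 5 * √5) / 2) ^ s := by
  obtain ⟨a, b, _, hb, h1⟩ := famA_pow r hr
  obtain ⟨c, d, _, hd, h2⟩ := famB_pow s hs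
  rw [h1, h2]
  exact quad_ne a b c d hb hd

theorem fam2A (r s : ℕ) (hr : 1 ≤ r) : (3 + 2 * √2) ^ r ≠ 2 ^ s := by
  obtain ⟨a, b, _, hb, h1⟩ := famA_pow r hr
  rw [h1]
  have := quad_irr 2 irr_two a b (2 ^ s) hb.ne'
  push_cast at this ⊢
  exact this

theorem fam2B (r s : ℕ) (hr : 1 ≤ r) : ((11 + 5 * √5) / 2) ^ r ≠ 2 ^ s := by
  obtain ⟨a, b, _, hb, h1⟩ := famB_pow r hr
  rw [h1]
  have := quad_irr 5 irr_five a b (2 ^ s) hb.ne'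
  push_cast at this ⊢
  exact this

theorem famRho_inj : Function.Injective fun i => (famBase i ^ famExp i)⁻¹ := by
  intro i j hij
  have hij : famBase i ^ famExp i = famBase j ^ famExp j := inv_injective hij
  have hi := famBase_one_lt i
  rcases i with r | r | r <;> rcases j with s | s | s <;> have h1 := r.2 <;> have h2 := s.2 <;>
    simp only [famBase, famExp] at hij hi
  · rw [Subtype.ext (pow_right_injective₀ (by linarith) hi.ne' hij)]
  · exact absurd hij.symm (fam2A _ _ (by omega))
  · exact absurd hij.symm (fam2B _ _ (by omega))
  · exact absurd hij (fam2A _ _ (by omega))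
  · rw [Subtype.ext (pow_right_injective₀ (by linarith) hi.ne' hij)]
  · exact absurd hij (famAB _ _ (by omega) (by omega))
  · exact absurd hij (fam2B _ _ (by omega))
  · exact absurd hij.symm (famAB _ _ (by omega) (by omega))
  · rw [Subtype.ext (pow_right_injective₀ (by linarith) hi.ne' hij)]


end Helpers

/-- All elements of the family `ℱ` (the union of the three families of
generating series above) are algebraically independent over `ℂ(z)`: every finite subfamily
satisfies no non-trivial polynomial relation with coefficients in `ℂ(z)`. -/
theorem famSeries_algebraically_independent :
    AlgebraicIndependent (Polynomial ℂ) famSeries := by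
  rw [algebraicIndependent_iff]
  intro P hP
  by_contra hne
  have e : famSeries = fun i => PowerSeries.mk fun n => (famSeq i n : ℂ) := funext famSeries_eq
  rw [e] at hP
  obtain ⟨α, β, hαβ, U, V, hU, hV, h⟩ :=
    alg_main famSeq famSeq_zero (fun i p _ n m hm => famSeq_lucas i p n m hm) P hne hP
  choose C hC using fun i => (famSeq_growth i).1
  exact analytic_main famSeq famSeq_zero (fun i => (famBase i ^ famExp i)⁻¹)
    (fun i => inv_pos.2 (pow_pos (by have := famBase_one_lt i; linarith) _)) famRho_inj C hC
    (fun i => (famSeq_growth i).2) α β hαβ U V hU hV h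
end
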